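/- Let G=(V,A) and G'=(V,A') be two (≤6)-hemimorphic digraphs such that G does not satisfy condition C_∞, let D be an arc-connected component of G, and let I0⊆V with |I0|=C_dual(G), G[I0] not self-dual, and G'[I0]≅G[I0]. Then: (1) for every difference class C∈D_{G[D],G'[D]} such that G[C] is neither a one-end infinite consecutivity nor a non-self-dual diamond-free tournament, if C is different from its arc-connected component then C is an interval of both G and G' and G'[C]≅G[C]; (2) if G[D] has no interval inducing a one-end infinite consecutivity or a non-self-dual diamond-free tournament and 𝔇_{G[D],G'[D]} has at least two equivalence classes, then every C∈D_{G[D],G'[D]} is an interval of both G and G' with G'[C]≅G[C], and consequently G'[D]≅G[D]. -/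

import Mathlib

universe u v

/-- A digraph: an irreflexive binary relation on a vertex type. -/
structure Dgraph (V : Type u) where
  Arc : V → V → Prop
  irrefl : ∀ x, ¬ Arc x x

namespace Dgraph

variable {V : Type u} {W : Type v}

/-- The dual digraph. -/
def dual (G : Dgraph V) : Dgraph V :=
  ⟨fun x y => G.Arc y x, fun x h => G.irrefl x h⟩

/-- Subdigraph induced by a set of vertices. -/
def ind (G : Dgraph V) (X : Set V) : Dgraph X :=
  ⟨fun x y => G.Arc x y, fun x h => G.irrefl x h⟩

/-- Isomorphism of digraphs. -/
def Iso (G : Dgraph V) (G' : Dgraph W) : Prop :=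
  ∃ e : V ≃ W, ∀ x y, G.Arc x y ↔ G'.Arc (e x) (e y)

/-- `G` and `G'` are hemimorphic: `G'` is isomorphic to `G` or to its dual. -/
def Hemi (G : Dgraph V) (G' : Dgraph W) : Prop :=
  Iso G G' ∨ Iso G.dual G'

/-- Self-dual digraph. -/
def SelfDual (G : Dgraph V) : Prop := Iso G G.dual

/-- `{x,y}` is a directed pair. -/
def Dir (G : Dgraph V) (x y : V) : Prop :=
  (G.Arc x y ∧ ¬ G.Arc y x) ∨ (G.Arc y x ∧ ¬ G.Arc x y)

/-- `{x,y}` is a neutral pair (full or void). -/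
def Neutral (G : Dgraph V) (x y : V) : Prop :=
  x ≠ y ∧ ¬ G.Dir x y

/-- Interval of a digraph. -/
def IsInterval (G : Dgraph V) (I : Set V) : Prop :=
  ∀ x ∉ I,
    (∀ y ∈ I, G.Arc x y ∧ ¬ G.Arc y x) ∨ (∀ y ∈ I, G.Arc y x ∧ ¬ G.Arc x y) ∨
    (∀ y ∈ I, G.Arc x y ∧ G.Arc y x) ∨ (∀ y ∈ I, ¬ G.Arc x y ∧ ¬ G.Arc y x)

/-- The arc-connectivity equivalence relation. -/
def ACRel (G : Dgraph V) : V → V → Prop := Relation.ReflTransGen G.Dir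

/-- Arc-connected components. -/
def IsACComponent (G : Dgraph V) (D : Set V) : Prop :=
  ∃ x, D = {y | G.ACRel x y}

/-- Arc-connected digraph (at most one arc-connected component). -/
def ArcConnected (G : Dgraph V) : Prop := ∀ x y, G.ACRel x y

/-- Tournament. -/
def IsTournament (G : Dgraph V) : Prop := ∀ x y, x ≠ y → G.Dir x y

/-- Chain (transitive tournament). -/
def IsChainD (G : Dgraph V) : Prop :=
  G.IsTournament ∧ ∀ x y z, G.Arc x y → G.Arc y z → G.Arc x z

/-- Dgraph from a relation, with forced irreflexivity. -/
def ofRel (r : V → V → Prop) : Dgraph V := ⟨fun x y => x ≠ y ∧ r x y, fun x h => h.1 rfl⟩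

/-- The model flag. -/
def flagD : Dgraph (Fin 3) :=
  ofRel (fun x y => (x = 0 ∧ y = 1) ∨ (x = 1 ∧ y = 2) ∨ (x = 2 ∧ y = 1))

/-- First model peak. -/
def peakD1 : Dgraph (Fin 3) :=
  ofRel (fun x y => (x = 0 ∧ y = 1) ∨ (x = 0 ∧ y = 2) ∨ (x = 1 ∧ y = 2) ∨ (x = 2 ∧ y = 1))

/-- Second model peak. -/
def peakD2 : Dgraph (Fin 3) :=
  ofRel (fun x y => (x = 0 ∧ y = 1) ∨ (x = 0 ∧ y = 2))

/-- The model diamond. -/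
def diamondD : Dgraph (Fin 4) :=
  ofRel (fun x y => (x = 0 ∧ y = 1) ∨ (x = 0 ∧ y = 2) ∨ (x = 0 ∧ y = 3) ∨
    (x = 1 ∧ y = 2) ∨ (x = 2 ∧ y = 3) ∨ (x = 3 ∧ y = 1))

/-- A flag is a digraph hemimorphic to the model flag. -/
def IsFlag (G : Dgraph V) : Prop := Hemi G flagD

/-- A peak is a digraph hemimorphic to one of the two model peaks. -/
def IsPeak (G : Dgraph V) : Prop := Hemi G peakD1 ∨ Hemi G peakD2

/-- A diamond is a digraph hemimorphic to the model diamond. -/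
def IsDiamond (G : Dgraph V) : Prop := Hemi G diamondD

/-- Prechain: embeds no peak, no diamond, no two adjacent neutral pairs. -/
def IsPrechain (G : Dgraph V) : Prop :=
  (∀ X : Set V, ¬ IsPeak (G.ind X)) ∧ (∀ X : Set V, ¬ IsDiamond (G.ind X)) ∧
  ¬ ∃ x y z : V, y ≠ z ∧ G.Neutral x y ∧ G.Neutral x z

/-- Proper prechain: a prechain which is not a chain. -/
def ProperPrechain (G : Dgraph V) : Prop := G.IsPrechain ∧ ¬ G.IsChainD

/-- Diamond-free tournament. -/
def DiamondFreeTournament (G : Dgraph V) : Prop :=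
  G.IsTournament ∧ ∀ X : Set V, ¬ IsDiamond (G.ind X)

/-- Non-tournament prechain. -/
def NonTournamentPrechain (G : Dgraph V) : Prop := G.IsPrechain ∧ ¬ G.IsTournament

/-- Model finite consecutivity on `n` vertices (`full` decides whether the
non-consecutive pairs are all full or all void). -/
def consecFin (n : ℕ) (full : Bool) : Dgraph (Fin n) :=
  ofRel (fun i j => i.1 + 1 = j.1 ∨ (full = true ∧ (i.1 + 1 < j.1 ∨ j.1 + 1 < i.1)))

/-- Model consecutivity of type ω. -/
def consecNat (full : Bool) : Dgraph ℕ :=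
  ofRel (fun i j => i + 1 = j ∨ (full = true ∧ (i + 1 < j ∨ j + 1 < i)))

/-- Model consecutivity of type ω*+ω. -/
def consecInt (full : Bool) : Dgraph ℤ :=
  ofRel (fun i j => i + 1 = j ∨ (full = true ∧ (i + 1 < j ∨ j + 1 < i)))

/-- One-end infinite consecutivity (obtained from ω or ω*). -/
def OneEndInfiniteConsecutivity (G : Dgraph V) : Prop :=
  ∃ full, Iso G (consecNat full) ∨ Iso G (consecNat full).dual

/-- Consecutivity. -/
def IsConsecutivity (G : Dgraph V) : Prop :=
  (∃ n, 3 ≤ n ∧ ∃ full, Iso G (consecFin n full)) ∨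
  G.OneEndInfiniteConsecutivity ∨ (∃ full, Iso G (consecInt full))

/-- Model cycle on `n ≥ 3` vertices obtained from the finite consecutivity by
replacing the neutral pair `{0, n-1}` by the arc `(n-1, 0)`. -/
def cycleD (n : ℕ) (full : Bool) : Dgraph (Fin n) :=
  ofRel (fun i j => i.1 + 1 = j.1 ∨ (i.1 = n - 1 ∧ j.1 = 0) ∨
    (full = true ∧ (i.1 + 1 < j.1 ∨ j.1 + 1 < i.1) ∧
      ¬ (i.1 = 0 ∧ j.1 = n - 1) ∧ ¬ (i.1 = n - 1 ∧ j.1 = 0)))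

/-- Cycle. -/
def IsCycle (G : Dgraph V) : Prop := ∃ n, 3 ≤ n ∧ ∃ full, Iso G (cycleD n full)

/-- Near-chain: obtained from a chain by exchanging the directed pair formed
by its extremities. -/
def IsNearChain (G : Dgraph V) : Prop :=
  ∃ (H : Dgraph V) (m M : V), H.IsChainD ∧ m ≠ M ∧
    (∀ x, x ≠ m → H.Arc m x) ∧ (∀ x, x ≠ M → H.Arc x M) ∧
    (∀ x y, G.Arc x y ↔ ((H.Arc x y ∧ ¬ (x = m ∧ y = M)) ∨ (x = M ∧ y = m)))

/-- `{k}`-hypomorphy. -/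
def KHypo (k : ℕ) (G G' : Dgraph V) : Prop :=
  ∀ X : Set V, X.Finite → X.ncard = k → Iso (G.ind X) (G'.ind X)

/-- `(≤ k)`-hypomorphy. -/
def LeHypo (k : ℕ) (G G' : Dgraph V) : Prop :=
  ∀ j, 1 ≤ j → j ≤ k → KHypo j G G'

/-- `{k}`-hemimorphy. -/
def KHemi (k : ℕ) (G G' : Dgraph V) : Prop :=
  ∀ X : Set V, X.Finite → X.ncard = k → Hemi (G.ind X) (G'.ind X)

/-- `(≤ k)`-hemimorphy. -/
def LeHemi (k : ℕ) (G G' : Dgraph V) : Prop :=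
  ∀ j, 1 ≤ j → j ≤ k → KHemi j G G'

/-- `(≤ k)`-half-reconstructibility. -/
def HalfRecon (k : ℕ) (G : Dgraph V) : Prop :=
  ∀ G' : Dgraph V, LeHemi k G G' → Hemi G G'

/-- One step of the difference relation. -/
def DiffStep (G G' : Dgraph V) (x y : V) : Prop := G.Arc x y ↔ ¬ G'.Arc x y

/-- The difference relation `𝔇_{G,G'}`. -/
def DiffRel (G G' : Dgraph V) (x y : V) : Prop :=
  x = y ∨ Relation.TransGen (DiffStep G G') x y

/-- Difference classes: `C ∈ D_{G,G'}`. -/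
def DiffClass (G G' : Dgraph V) (C : Set V) : Prop :=
  ∃ x, C = {y | DiffRel G G' x y}

/-- The difference relation has at least two equivalence classes. -/
def AtLeastTwoDiffClasses (G G' : Dgraph V) : Prop :=
  ∃ C₁ C₂ : Set V, DiffClass G G' C₁ ∧ DiffClass G G' C₂ ∧ C₁ ≠ C₂

/-- `C_dual(G)`: the smallest cardinality of a finite set of vertices inducing a
non-self-dual subdigraph (`⊤` if there is none). -/
noncomputable def Cdual (G : Dgraph V) : ℕ∞ :=
  sInf {n : ℕ∞ | ∃ X : Set V, X.Finite ∧ ¬ SelfDual (G.ind X) ∧ n = (X.ncard : ℕ∞)}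

/-- The contracted digraph `G_I` (the vertex `none` plays the role of `I`). -/
def contract (G : Dgraph V) (I : Set V) : Dgraph (Option {x : V // x ∉ I}) where
  Arc := fun a b =>
    match a, b with
    | some x, some y => G.Arc x.1 y.1
    | some x, none => ∃ z ∈ I, G.Arc x.1 z
    | none, some y => ∃ z ∈ I, G.Arc z y.1
    | none, none => False
  irrefl := by
    rintro (_ | ⟨x, hx⟩)
    · simp
    · exact G.irrefl x

/-- There is an isomorphism `f` from `G_I` onto `G'_I` with `f(I) = I`. -/
def ContractIsoFix (G G' : Dgraph V) (I : Set V) : Prop :=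
  ∃ e : Option {x : V // x ∉ I} ≃ Option {x : V // x ∉ I},
    e none = none ∧ ∀ a b, (G.contract I).Arc a b ↔ (G'.contract I).Arc (e a) (e b)

/-- `D` is disjoint from every flag of `G`. -/
def FlagDisjoint (G : Dgraph V) (D : Set V) : Prop :=
  ∀ F : Set V, IsFlag (G.ind F) → D ∩ F = ∅

/-- `D` contains a vertex `a` of a flag `{a,b,c}` of `G` with `b, c ∉ D` and
`{b,c}` the directed pair of the flag. -/
def FlagVertexCond (G : Dgraph V) (D : Set V) : Prop :=
  ∃ a ∈ D, ∃ b c : V, b ∉ D ∧ c ∉ D ∧ IsFlag (G.ind {a, b, c}) ∧ G.Dir b c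

/-- Condition `C_∞`. -/
def CondCinf (G : Dgraph V) : Prop :=
  (∃ I : Set V, I.Infinite ∧ G.IsInterval I ∧ (G.ind I).IsChainD) ∨
  (∃ I J : Set V, I ≠ J ∧ G.IsInterval I ∧ G.IsInterval J ∧
     (G.ind I).OneEndInfiniteConsecutivity ∧ (G.ind J).OneEndInfiniteConsecutivity) ∨
  (∃ I : Set V, G.IsInterval I ∧ (G.ind I).OneEndInfiniteConsecutivity ∧
     (∀ J : Set V, G.IsInterval J → (G.ind J).OneEndInfiniteConsecutivity → J = I) ∧
     ¬ ContractIsoFix G G.dual I)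

/-- The kind of component occurring in conditions `K1` and `K2`. -/
def K12Kind (G : Dgraph V) (D : Set V) : Prop :=
  DiamondFreeTournament (G.ind D) ∨ (NonTournamentPrechain (G.ind D) ∧ G.FlagDisjoint D)

/-- Condition `K1`. -/
def CondK1 (G : Dgraph V) : Prop :=
  G.Cdual = 3 ∧ ∃ D₁ D₂ : Set V, D₁ ≠ D₂ ∧
    (G.IsACComponent D₁ ∧ ¬ SelfDual (G.ind D₁) ∧ G.IsInterval D₁ ∧ G.K12Kind D₁) ∧
    (G.IsACComponent D₂ ∧ ¬ SelfDual (G.ind D₂) ∧ G.IsInterval D₂ ∧ G.K12Kind D₂)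

/-- Condition `K2`. -/
def CondK2 (G : Dgraph V) : Prop :=
  G.Cdual = 3 ∧ ∃ D₀ : Set V, G.IsACComponent D₀ ∧ ¬ SelfDual (G.ind D₀) ∧
    (∀ D, G.IsACComponent D → ¬ SelfDual (G.ind D) → D = D₀) ∧
    G.K12Kind D₀ ∧ ¬ ContractIsoFix G G.dual D₀

/-- Condition `K3`. -/
def CondK3 (G : Dgraph V) : Prop :=
  G.Cdual = 4 ∧ ∃ D₁ D₂ : Set V, D₁ ≠ D₂ ∧
    (G.IsACComponent D₁ ∧ ¬ SelfDual (G.ind D₁) ∧ G.IsInterval D₁) ∧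
    (G.IsACComponent D₂ ∧ ¬ SelfDual (G.ind D₂) ∧ G.IsInterval D₂)

/-- Condition `K4`. -/
def CondK4 (G : Dgraph V) : Prop :=
  G.Cdual = 5 ∧ ∃ D₁ D₂ : Set V, D₁ ≠ D₂ ∧
    (G.IsACComponent D₁ ∧ ¬ SelfDual (G.ind D₁) ∧ G.IsInterval D₁ ∧ IsPrechain (G.ind D₁)) ∧
    (G.IsACComponent D₂ ∧ ¬ SelfDual (G.ind D₂) ∧ G.IsInterval D₂ ∧ IsPrechain (G.ind D₂))

/-- Condition `K5`. -/
def CondK5 (G : Dgraph V) : Prop :=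
  G.Cdual = 6 ∧ ∃ D₁ D₂ : Set V, D₁ ≠ D₂ ∧
    (G.IsACComponent D₁ ∧ ¬ SelfDual (G.ind D₁) ∧ G.IsInterval D₁ ∧
      DiamondFreeTournament (G.ind D₁)) ∧
    (G.IsACComponent D₂ ∧ ¬ SelfDual (G.ind D₂) ∧ G.IsInterval D₂ ∧
      DiamondFreeTournament (G.ind D₂))

/-- The kind of interval occurring in conditions `L1` and `L2`. -/
def L12Int (G : Dgraph V) (I : Set V) : Prop :=
  G.IsInterval I ∧ DiamondFreeTournament (G.ind I) ∧ ¬ SelfDual (G.ind I) ∧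
    ¬ G.IsACComponent I

/-- Condition `L1`. -/
def CondL1 (G : Dgraph V) : Prop :=
  ∃ I₁ I₂ : Set V, I₁ ≠ I₂ ∧ G.L12Int I₁ ∧ G.L12Int I₂

/-- Condition `L2`. -/
def CondL2 (G : Dgraph V) : Prop :=
  ∃ I₀ : Set V, G.L12Int I₀ ∧ (∀ I, G.L12Int I → I = I₀) ∧ ¬ ContractIsoFix G G.dual I₀

/-- Condition `L3`. -/
def CondL3 (G : Dgraph V) : Prop :=
  G.Cdual = 3 ∧ ∃ D₁ D₂ : Set V, D₁ ≠ D₂ ∧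
    (G.IsACComponent D₁ ∧ ¬ SelfDual (G.ind D₁) ∧ G.IsInterval D₁) ∧
    (G.IsACComponent D₂ ∧ ¬ SelfDual (G.ind D₂) ∧ G.IsInterval D₂) ∧
    ((G.FlagDisjoint D₁ ∧ Cdual (G.ind D₁) = 4 ∧ G.FlagDisjoint D₂ ∧ Cdual (G.ind D₂) = 4) ∨
     (NonTournamentPrechain (G.ind D₁) ∧ G.FlagVertexCond D₁ ∧
      NonTournamentPrechain (G.ind D₂) ∧ G.FlagVertexCond D₂))

/-- Condition `L4`. -/
def CondL4 (G : Dgraph V) : Prop :=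
  G.Cdual = 3 ∧ ∃ D₀ : Set V, G.IsACComponent D₀ ∧ ¬ SelfDual (G.ind D₀) ∧
    (∀ D, G.IsACComponent D → ¬ SelfDual (G.ind D) → D = D₀) ∧
    G.IsInterval D₀ ∧
    ((G.FlagDisjoint D₀ ∧ Cdual (G.ind D₀) = 4) ∨
     (NonTournamentPrechain (G.ind D₀) ∧ G.FlagVertexCond D₀)) ∧
    ¬ ContractIsoFix G G.dual D₀

end Dgraph

namespace Dgraph

variable {V : Type u} {W : Type v}

/-- `x → y`: the pair `{x, y}` is directed from `x` to `y`. -/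
def To (G : Dgraph V) (x y : V) : Prop := G.Arc x y ∧ ¬ G.Arc y x

/-- The pair `{x, y}` is directed in both digraphs, with opposite directions. -/
def Rev (G G' : Dgraph V) (x y : V) : Prop :=
  (G.To x y ∧ G'.To y x) ∨ (G.To y x ∧ G'.To x y)

/-- The pair `{x, y}` is directed in both digraphs, with the same direction. -/
def Kept (G G' : Dgraph V) (x y : V) : Prop :=
  (G.To x y ∧ G'.To x y) ∨ (G.To y x ∧ G'.To y x)

theorem LeHemi.exists_map {G G' : Dgraph V} {k : ℕ} (h : LeHemi k G G') {X : Set V}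
    (hX : X.Finite) (h1 : X.Nonempty) (hk : X.ncard ≤ k) :
    ∃ f : V → V, (∀ x ∈ X, f x ∈ X) ∧ Set.InjOn f X ∧
      ((∀ x ∈ X, ∀ y ∈ X, G.Arc x y ↔ G'.Arc (f x) (f y)) ∨
       (∀ x ∈ X, ∀ y ∈ X, G.Arc y x ↔ G'.Arc (f x) (f y))) := by
  classical
  have h0 : 1 ≤ X.ncard := (Set.ncard_pos hX).2 h1
  have key : ∀ e : X ≃ X, ∃ f : V → V, (∀ x ∈ X, f x ∈ X) ∧ Set.InjOn f X ∧
      ∀ x : X, f x = e x := by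
    intro e
    refine ⟨fun x => if hx : x ∈ X then e ⟨x, hx⟩ else x, ?_, ?_, ?_⟩
    · intro x hx
      simp [hx]
    · intro x hx y hy hxy
      simp only [hx, hy, dite_true] at hxy
      have := e.injective (Subtype.ext hxy)
      simpa using this
    · intro x
      simp
  rcases h _ h0 hk X hX rfl with ⟨e, he⟩ | ⟨e, he⟩
  · obtain ⟨f, hf, hi, hfe⟩ := key e
    refine ⟨f, hf, hi, Or.inl fun x hx y hy => ?_⟩
    have := he ⟨x, hx⟩ ⟨y, hy⟩
    rw [hfe ⟨x, hx⟩, hfe ⟨y, hy⟩]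
    exact this
  · obtain ⟨f, hf, hi, hfe⟩ := key e
    refine ⟨f, hf, hi, Or.inr fun x hx y hy => ?_⟩
    have := he ⟨x, hx⟩ ⟨y, hy⟩
    rw [hfe ⟨x, hx⟩, hfe ⟨y, hy⟩]
    exact this

theorem LeHemi.pair {G G' : Dgraph V} (h : LeHemi 6 G G') {x y : V} (hxy : x ≠ y) :
    ((G'.Arc x y ↔ G.Arc x y) ∧ (G'.Arc y x ↔ G.Arc y x)) ∨
    ((G'.Arc x y ↔ G.Arc y x) ∧ (G'.Arc y x ↔ G.Arc x y)) := by
  obtain ⟨f, hf, hi, hh⟩ := h.exists_map (X := {x, y}) (by simp) (by simp)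
    (by rw [Set.ncard_pair hxy]; omega)
  have h1 := hf x (by simp)
  have h2 := hf y (by simp)
  have h3 : f x ≠ f y := fun e => hxy (hi (by simp) (by simp) e)
  simp only [Set.mem_insert_iff, Set.mem_singleton_iff, forall_eq_or_imp, forall_eq] at hh h1 h2
  grind

/-- A permutation of three distinct vertices carries `G` or its dual onto `G'`. -/
theorem LeHemi.triple {G G' : Dgraph V} (h : LeHemi 6 G G') {x y z : V} (hxy : x ≠ y)
    (hxz : x ≠ z) (hyz : y ≠ z) :
    ∃ a b c : V, (a = x ∨ a = y ∨ a = z) ∧ (b = x ∨ b = y ∨ b = z) ∧ (c = x ∨ c = y ∨ c = z) ∧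
      a ≠ b ∧ a ≠ c ∧ b ≠ c ∧
      (((G.Arc x y ↔ G'.Arc a b) ∧ (G.Arc y x ↔ G'.Arc b a) ∧ (G.Arc x z ↔ G'.Arc a c) ∧
        (G.Arc z x ↔ G'.Arc c a) ∧ (G.Arc y z ↔ G'.Arc b c) ∧ (G.Arc z y ↔ G'.Arc c b)) ∨
       ((G.Arc y x ↔ G'.Arc a b) ∧ (G.Arc x y ↔ G'.Arc b a) ∧ (G.Arc z x ↔ G'.Arc a c) ∧
        (G.Arc x z ↔ G'.Arc c a) ∧ (G.Arc z y ↔ G'.Arc b c) ∧ (G.Arc y z ↔ G'.Arc c b))) := by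
  obtain ⟨f, hf, hi, hh⟩ := h.exists_map (X := {x, y, z}) (by simp) (by simp)
    ((Set.ncard_insert_le _ _).trans (by rw [Set.ncard_pair hyz]; omega))
  refine ⟨f x, f y, f z, by simpa using hf x (by simp), by simpa using hf y (by simp),
    by simpa using hf z (by simp), fun e => hxy (hi (by simp) (by simp) e),
    fun e => hxz (hi (by simp) (by simp) e), fun e => hyz (hi (by simp) (by simp) e), ?_⟩
  rcases hh with hh | hh
  · refine Or.inl ⟨?_, ?_, ?_, ?_, ?_, ?_⟩ <;> exact hh _ (by simp) _ (by simp)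
  · refine Or.inr ⟨?_, ?_, ?_, ?_, ?_, ?_⟩ <;> exact hh _ (by simp) _ (by simp)

/-- A permutation of four distinct vertices carries `G` or its dual onto `G'`. -/
theorem LeHemi.quadruple {G G' : Dgraph V} (h : LeHemi 6 G G') {p x y z : V} (hpx : p ≠ x)
    (hpy : p ≠ y) (hpz : p ≠ z) (hxy : x ≠ y) (hxz : x ≠ z) (hyz : y ≠ z) :
    ∃ d a b c : V, (d = p ∨ d = x ∨ d = y ∨ d = z) ∧ (a = p ∨ a = x ∨ a = y ∨ a = z) ∧
      (b = p ∨ b = x ∨ b = y ∨ b = z) ∧ (c = p ∨ c = x ∨ c = y ∨ c = z) ∧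
      d ≠ a ∧ d ≠ b ∧ d ≠ c ∧ a ≠ b ∧ a ≠ c ∧ b ≠ c ∧
      (((G.Arc x y ↔ G'.Arc a b) ∧ (G.Arc y x ↔ G'.Arc b a) ∧ (G.Arc x z ↔ G'.Arc a c) ∧
        (G.Arc z x ↔ G'.Arc c a) ∧ (G.Arc y z ↔ G'.Arc b c) ∧ (G.Arc z y ↔ G'.Arc c b) ∧
        (G.Arc p x ↔ G'.Arc d a) ∧ (G.Arc x p ↔ G'.Arc a d) ∧ (G.Arc p y ↔ G'.Arc d b) ∧
        (G.Arc y p ↔ G'.Arc b d) ∧ (G.Arc p z ↔ G'.Arc d c) ∧ (G.Arc z p ↔ G'.Arc c d)) ∨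
       ((G.Arc y x ↔ G'.Arc a b) ∧ (G.Arc x y ↔ G'.Arc b a) ∧ (G.Arc z x ↔ G'.Arc a c) ∧
        (G.Arc x z ↔ G'.Arc c a) ∧ (G.Arc z y ↔ G'.Arc b c) ∧ (G.Arc y z ↔ G'.Arc c b) ∧
        (G.Arc x p ↔ G'.Arc d a) ∧ (G.Arc p x ↔ G'.Arc a d) ∧ (G.Arc y p ↔ G'.Arc d b) ∧
        (G.Arc p y ↔ G'.Arc b d) ∧ (G.Arc z p ↔ G'.Arc d c) ∧ (G.Arc p z ↔ G'.Arc c d))) := by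
  obtain ⟨f, hf, hi, hh⟩ := h.exists_map (X := {p, x, y, z}) (by simp) (by simp)
    ((Set.ncard_insert_le _ _).trans (Nat.succ_le_succ
      ((Set.ncard_insert_le _ _).trans (by rw [Set.ncard_pair hyz]; omega))))
  refine ⟨f p, f x, f y, f z, by simpa using hf p (by simp), by simpa using hf x (by simp),
    by simpa using hf y (by simp),
    by simpa using hf z (by simp), fun e => hpx (hi (by simp) (by simp) e),
    fun e => hpy (hi (by simp) (by simp) e), fun e => hpz (hi (by simp) (by simp) e),
    fun e => hxy (hi (by simp) (by simp) e),
    fun e => hxz (hi (by simp) (by simp) e), fun e => hyz (hi (by simp) (by simp) e), ?_⟩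
  rcases hh with hh | hh
  · refine Or.inl ⟨?_, ?_, ?_, ?_, ?_, ?_, ?_, ?_, ?_, ?_, ?_, ?_⟩ <;>
      exact hh _ (by simp) _ (by simp)
  · refine Or.inr ⟨?_, ?_, ?_, ?_, ?_, ?_, ?_, ?_, ?_, ?_, ?_, ?_⟩ <;>
      exact hh _ (by simp) _ (by simp)

theorem To.ne {G : Dgraph V} {x y : V} (h : G.To x y) : x ≠ y := by
  rintro rfl; exact G.irrefl x h.1

theorem Rev.ne {G G' : Dgraph V} {x y : V} (h : Rev G G' x y) : x ≠ y := by
  rcases h with h | h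
  · exact h.1.ne
  · exact h.1.ne.symm

theorem Kept.ne {G G' : Dgraph V} {x y : V} (h : Kept G G' x y) : x ≠ y := by
  rcases h with h | h
  · exact h.1.ne
  · exact h.1.ne.symm

theorem Rev.symm {G G' : Dgraph V} {x y : V} (h : Rev G G' x y) : Rev G G' y x := Or.symm h

theorem Kept.symm {G G' : Dgraph V} {x y : V} (h : Kept G G' x y) : Kept G G' y x := Or.symm h

theorem Neutral.symm {G : Dgraph V} {x y : V} (h : G.Neutral x y) : G.Neutral y x :=
  ⟨h.1.symm, fun hd => h.2 (Or.symm hd)⟩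

namespace LeHemi

variable {G G' : Dgraph V}

/-- A vertex which forms no reversed pair with `x` and `y` does not distinguish the reversed
pair `{x, y}`, unless the three vertices form a flag. -/
theorem rev_uniform (h : LeHemi 6 G G') {x y z : V} (hxy : Rev G G' x y)
    (hx : ¬ Rev G G' x z) (hy : ¬ Rev G G' y z) (hxz : x ≠ z) (hyz : y ≠ z) :
    (G.To z x ↔ G.To z y) ∧ (G.To x z ↔ G.To y z) := by
  obtain ⟨a, b, c, ha, hb, hc, hab, hac, hbc, hh⟩ := h.triple hxy.ne hxz hyz
  have p1 := h.pair hxz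
  have p2 := h.pair hyz
  unfold Rev To at *
  rcases ha with rfl | rfl | rfl <;> rcases hb with rfl | rfl | rfl <;>
    rcases hc with rfl | rfl | rfl <;>
    first
      | exact absurd rfl hab
      | exact absurd rfl hac
      | exact absurd rfl hbc
      | grind

end LeHemi

namespace LeHemi

variable {G G' : Dgraph V}

theorem rev_rev_kept (h : LeHemi 6 G G') {x y z : V} (hxy : Rev G G' x y)
    (hxz : Rev G G' x z) (hyz : Kept G G' y z) : G.To x y ↔ G.To x z := by
  obtain ⟨a, b, c, ha, hb, hc, hab, hac, hbc, hh⟩ := h.triple hxy.ne hxz.ne hyz.ne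
  unfold Rev Kept To at *
  rcases ha with rfl | rfl | rfl <;> rcases hb with rfl | rfl | rfl <;>
    rcases hc with rfl | rfl | rfl <;>
    first
      | exact absurd rfl hab
      | exact absurd rfl hac
      | exact absurd rfl hbc
      | grind

theorem rev_rev_neutral (h : LeHemi 6 G G') {p x y z : V}
    (px : G.To p x) (py : G.To p y) (pz : G.To p z)
    (px' : G'.To p x) (py' : G'.To p y) (pz' : G'.To p z)
    (hxy : Rev G G' x y) (hxz : Rev G G' x z) (hyz : G.Neutral y z) :
    G.To y x ↔ G.To x z := by
  obtain ⟨d, a, b, c, hd, ha, hb, hc, hda, hdb, hdc, hab, hac, hbc, hh⟩ :=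
    h.quadruple px.ne py.ne pz.ne hxy.ne hxz.ne hyz.1
  have p3 := h.pair hyz.1
  unfold Rev Neutral Dir To at *
  rcases hd with rfl | rfl | rfl | rfl <;> rcases ha with rfl | rfl | rfl | rfl <;>
    first
      | exact absurd rfl hda
      | skip
    <;> rcases hb with rfl | rfl | rfl | rfl <;>
    first
      | exact absurd rfl hdb
      | exact absurd rfl hab
      | skip
    <;> rcases hc with rfl | rfl | rfl | rfl <;>
    first
      | exact absurd rfl hdc
      | exact absurd rfl hac
      | exact absurd rfl hbc
      | grind

theorem rev_neutral_neutral (h : LeHemi 6 G G') {p x y z : V} (hpz : p ≠ z)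
    (px : G.To p x) (py : G.To p y) (px' : G'.To p x) (py' : G'.To p y)
    (hxy : Rev G G' x y) (hzx : G.Neutral z x) (hzy : G.Neutral z y) :
    G.Arc z x ↔ G.Arc z y := by
  obtain ⟨d, a, b, c, hd, ha, hb, hc, hda, hdb, hdc, hab, hac, hbc, hh⟩ :=
    h.quadruple px.ne py.ne hpz hxy.ne hzx.1.symm hzy.1.symm
  have p1 := h.pair hpz
  have p2 := h.pair hzx.1
  have p3 := h.pair hzy.1
  unfold Rev Neutral Dir To at *
  rcases hd with rfl | rfl | rfl | rfl <;> rcases ha with rfl | rfl | rfl | rfl <;>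
    first
      | exact absurd rfl hda
      | skip
    <;> rcases hb with rfl | rfl | rfl | rfl <;>
    first
      | exact absurd rfl hdb
      | exact absurd rfl hab
      | skip
    <;> rcases hc with rfl | rfl | rfl | rfl <;>
    first
      | exact absurd rfl hdc
      | exact absurd rfl hac
      | exact absurd rfl hbc
      | grind

end LeHemi

theorem surjOn_of_injOn {X : Set V} (hX : X.Finite) {f : V → V} (hf : ∀ x ∈ X, f x ∈ X)
    (hi : Set.InjOn f X) : ∀ y ∈ X, ∃ x ∈ X, f x = y := by
  intro y hy
  have h1 := Set.eq_of_subset_of_ncard_le (s := f '' X) (t := X)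
    (by rintro _ ⟨x, hx, rfl⟩; exact hf x hx) hi.ncard_image.ge hX
  rw [← h1] at hy
  exact hy

namespace LeHemi

variable {G G' : Dgraph V}

theorem rev_cycle (h : LeHemi 6 G G') {x y z : V} (hxy : G.To x y) (hyz : G.To y z)
    (hzx : G.To z x) :
    (G'.To x y ∧ G'.To y z ∧ G'.To z x) ∨ (G'.To y x ∧ G'.To z y ∧ G'.To x z) := by
  have p1 := h.pair hxy.ne
  have p2 := h.pair hyz.ne
  have p3 := h.pair hzx.ne
  have t1 := h.rev_rev_kept (x := x) (y := y) (z := z)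
  have t2 := h.rev_rev_kept (x := y) (y := z) (z := x)
  have t3 := h.rev_rev_kept (x := z) (y := x) (z := y)
  have u1 := h.rev_uniform (x := x) (y := y) (z := z)
  have u2 := h.rev_uniform (x := y) (y := z) (z := x)
  have u3 := h.rev_uniform (x := z) (y := x) (z := y)
  have n1 := hxy.ne
  have n2 := hyz.ne
  have n3 := hzx.ne
  unfold Rev Kept To at *
  grind

theorem rev_source_cycle (h : LeHemi 6 G G') {s x y z : V} (hxy : G.To x y) (hyz : G.To y z)
    (hzx : G.To z x) (sx : G.To s x) (sy : G.To s y) (sz : G.To s z) (hr : Rev G G' s x) :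
    G'.To x s ∧ G'.To y s ∧ G'.To z s := by
  have p2 := h.pair sy.ne
  have p3 := h.pair sz.ne
  have t1 := h.rev_rev_kept (x := x) (y := s) (z := y)
  have t2 := h.rev_rev_kept (x := x) (y := s) (z := z)
  have t3 := h.rev_rev_kept (x := z) (y := s) (z := y)
  have t4 := h.rev_rev_kept (x := y) (y := s) (z := x)
  have t5 := h.rev_rev_kept (x := y) (y := s) (z := z)
  have t6 := h.rev_rev_kept (x := z) (y := s) (z := x)
  have u1 := h.rev_uniform (x := s) (y := x) (z := z)
  have u2 := h.rev_uniform (x := s) (y := z) (z := y)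
  have u3 := h.rev_uniform (x := s) (y := x) (z := y)
  have u4 := h.rev_uniform (x := s) (y := y) (z := z)
  have u5 := h.rev_uniform (x := s) (y := y) (z := x)
  have u6 := h.rev_uniform (x := s) (y := z) (z := x)
  have n1 := sx.ne
  have n2 := sy.ne
  have n3 := sz.ne
  have n4 := hxy.ne
  have n5 := hyz.ne
  have n6 := hzx.ne
  have c := h.rev_cycle hxy hyz hzx
  unfold Rev Kept To at *
  grind

theorem rev_sink_cycle (h : LeHemi 6 G G') {s x y z : V} (hxy : G.To x y) (hyz : G.To y z)
    (hzx : G.To z x) (sx : G.To x s) (sy : G.To y s) (sz : G.To z s) (hr : Rev G G' s x) :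
    G'.To s x ∧ G'.To s y ∧ G'.To s z := by
  have p2 := h.pair sy.ne
  have p3 := h.pair sz.ne
  have t1 := h.rev_rev_kept (x := x) (y := s) (z := y)
  have t2 := h.rev_rev_kept (x := x) (y := s) (z := z)
  have t3 := h.rev_rev_kept (x := z) (y := s) (z := y)
  have t4 := h.rev_rev_kept (x := y) (y := s) (z := x)
  have t5 := h.rev_rev_kept (x := y) (y := s) (z := z)
  have t6 := h.rev_rev_kept (x := z) (y := s) (z := x)
  have u1 := h.rev_uniform (x := s) (y := x) (z := z)
  have u2 := h.rev_uniform (x := s) (y := z) (z := y)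
  have u3 := h.rev_uniform (x := s) (y := x) (z := y)
  have u4 := h.rev_uniform (x := s) (y := y) (z := z)
  have u5 := h.rev_uniform (x := s) (y := y) (z := x)
  have u6 := h.rev_uniform (x := s) (y := z) (z := x)
  have n1 := sx.ne.symm
  have n2 := sy.ne.symm
  have n3 := sz.ne.symm
  have n4 := hxy.ne
  have n5 := hyz.ne
  have n6 := hzx.ne
  have c := h.rev_cycle hxy hyz hzx
  unfold Rev Kept To at *
  grind

/-- A set of at most five vertices without source or sink, dominated by a vertex whose pairs
are kept, induces isomorphic subdigraphs. -/
theorem exists_map_of_dominated (h : LeHemi 6 G G') {p : V} {X : Set V} (hX : X.Finite)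
    (hc : X.ncard ≤ 5) (hne : X.Nonempty) (hp : ∀ x ∈ X, G.To p x) (hp' : ∀ x ∈ X, G'.To p x)
    (hs : ∀ q ∈ X, ∃ y ∈ X, y ≠ q ∧ ¬ G.To y q) :
    ∃ f : V → V, (∀ x ∈ X, f x ∈ X) ∧ Set.InjOn f X ∧
      ∀ x ∈ X, ∀ y ∈ X, G.Arc x y ↔ G'.Arc (f x) (f y) := by
  obtain ⟨f, hf, hi, hh⟩ := h.exists_map (X := insert p X) (hX.insert p) (by simp)
    ((Set.ncard_insert_le _ _).trans (by omega))
  have hpX : p ∉ X := fun hpX => (hp p hpX).ne rfl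
  have hsurj : ∃ q ∈ insert p X, f q = p := by
    exact surjOn_of_injOn (hX.insert p) hf hi p (Set.mem_insert _ _)
  obtain ⟨q, hq, hqp⟩ := hsurj
  have hqe : q ∈ X → f p ∈ X := by
    intro hqX
    rcases hf p (Set.mem_insert _ _) with e | e
    · exact absurd (hi (Set.mem_insert _ _) hq (e.trans hqp.symm)) (fun e => hpX (e ▸ hqX))
    · exact e
  rcases hh with hh | hh
  · have hfp : f p = p := by
      rcases hq with rfl | hqX
      · exact hqp
      · have h1 := (hp q hqX).1
        rw [hh p (Set.mem_insert _ _) q (Set.mem_insert_of_mem _ hqX), hqp] at h1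
        exact absurd h1 (hp' _ (hqe hqX)).2
    refine ⟨f, ?_, hi.mono (Set.subset_insert _ _), fun x hx y hy =>
      hh x (Set.mem_insert_of_mem _ hx) y (Set.mem_insert_of_mem _ hy)⟩
    intro x hx
    rcases hf x (Set.mem_insert_of_mem _ hx) with e | e
    · have := hi (Set.mem_insert_of_mem _ hx) (Set.mem_insert _ _) (e.trans hfp.symm)
      exact absurd hx (this ▸ hpX)
    · exact e
  · exfalso
    have hfX : ∀ y ∈ insert p X, y ≠ q → f y ∈ X := by
      intro y hy hyq
      rcases hf y hy with e | e
      · exact absurd (hi hy hq (e.trans hqp.symm)) hyq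
      · exact e
    rcases hq with rfl | hqX
    · obtain ⟨x, hx⟩ := hne
      have h1 := hh x (Set.mem_insert_of_mem _ hx) q (Set.mem_insert _ _)
      rw [hqp] at h1
      exact (hp' _ (hfX x (Set.mem_insert_of_mem _ hx) (hp x hx).ne.symm)).2 (h1.1 (hp x hx).1)
    · obtain ⟨y, hy, hyq, hn⟩ := hs q hqX
      have hyX := hfX y (Set.mem_insert_of_mem _ hy) hyq
      have h1 := hh q (Set.mem_insert_of_mem _ hqX) y (Set.mem_insert_of_mem _ hy)
      have h2 := hh y (Set.mem_insert_of_mem _ hy) q (Set.mem_insert_of_mem _ hqX)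
      rw [hqp] at h1 h2
      have h3 := hp' _ hyX
      exact hn ⟨h1.2 h3.1, fun h4 => h3.2 (h2.1 h4)⟩

theorem dominated_source_cycle (h : LeHemi 6 G G') {p s x y z : V} (ps : G.To p s)
    (px : G.To p x) (py : G.To p y) (pz : G.To p z) (ps' : G'.To p s)
    (px' : G'.To p x) (py' : G'.To p y) (pz' : G'.To p z)
    (hxy : G.To x y) (hyz : G.To y z) (hzx : G.To z x)
    (sx : G.To s x) (sy : G.To s y) (sz : G.To s z) : ¬ Rev G G' s x := by
  intro hr
  obtain ⟨f, hf, hi, hh⟩ := h.exists_map_of_dominated (p := p) (X := {s, x, y, z}) (by simp)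
    ((Set.ncard_insert_le _ _).trans (Nat.succ_le_succ
      ((Set.ncard_insert_le _ _).trans (by rw [Set.ncard_pair hyz.ne]; omega)))) (by simp)
    (by simp [ps, px, py, pz]) (by simp [ps', px', py', pz'])
    (by
      simp only [Set.mem_insert_iff, Set.mem_singleton_iff, forall_eq_or_imp, forall_eq,
        exists_eq_or_imp, exists_eq_left]
      have := sx.ne
      have := sy.ne
      have := sz.ne
      have := hxy.ne
      unfold To at *
      grind)
  have c := h.rev_cycle hxy hyz hzx
  have c' := h.rev_source_cycle hxy hyz hzx sx sy sz hr
  have key : ∃ w ∈ ({s, x, y, z} : Set V), G'.To w (f s) := by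
    have := hf s (by simp)
    simp only [Set.mem_insert_iff, Set.mem_singleton_iff, exists_eq_or_imp, exists_eq_left] at *
    rcases this with e | e | e | e <;> rw [e] <;> tauto
  obtain ⟨w, hw, hws⟩ := key
  obtain ⟨u, hu, rfl⟩ := surjOn_of_injOn (by simp) hf hi w hw
  have h1 := hh u hu s (by simp)
  have h2 := hh s (by simp) u hu
  have hus : G.To u s := ⟨h1.2 hws.1, fun h3 => hws.2 (h2.1 h3)⟩
  simp only [Set.mem_insert_iff, Set.mem_singleton_iff] at hu
  rcases hu with rfl | rfl | rfl | rfl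
  · exact hus.ne rfl
  · exact hus.2 sx.1
  · exact hus.2 sy.1
  · exact hus.2 sz.1

theorem dominated_sink_cycle (h : LeHemi 6 G G') {p s x y z : V} (ps : G.To p s)
    (px : G.To p x) (py : G.To p y) (pz : G.To p z) (ps' : G'.To p s)
    (hxy : G.To x y) (hyz : G.To y z) (hzx : G.To z x)
    (sx : G.To x s) (sy : G.To y s) (sz : G.To z s) : ¬ Rev G G' s x := by
  intro hr
  obtain ⟨f, hf, hi, hh⟩ := h.exists_map (X := {p, s, x, y, z}) (by simp) (by simp)
    ((Set.ncard_insert_le _ _).trans (Nat.succ_le_succ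
      ((Set.ncard_insert_le _ _).trans (Nat.succ_le_succ
      ((Set.ncard_insert_le _ _).trans (by rw [Set.ncard_pair hyz.ne]; omega))))))
  have c := h.rev_cycle hxy hyz hzx
  have c' := h.rev_sink_cycle hxy hyz hzx sx sy sz hr
  have key : ∀ q ∈ ({p, s, x, y, z} : Set V), ∃ w ∈ ({p, s, x, y, z} : Set V),
      G'.To (f q) w := by
    intro q hq
    have := hf q hq
    simp only [Set.mem_insert_iff, Set.mem_singleton_iff, exists_eq_or_imp, exists_eq_left] at this ⊢
    rcases this with e | e | e | e | e <;> rw [e] <;> tauto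
  rcases hh with hh | hh
  · obtain ⟨w, hw, hws⟩ := key s (by simp)
    obtain ⟨u, hu, rfl⟩ := surjOn_of_injOn (by simp) hf hi w hw
    have h1 := hh u hu s (by simp)
    have h2 := hh s (by simp) u hu
    have hus : G.To s u := ⟨h2.2 hws.1, fun h3 => hws.2 (h1.1 h3)⟩
    simp only [Set.mem_insert_iff, Set.mem_singleton_iff] at hu
    rcases hu with rfl | rfl | rfl | rfl | rfl
    · exact hus.2 ps.1
    · exact hus.ne rfl
    · exact hus.2 sx.1
    · exact hus.2 sy.1
    · exact hus.2 sz.1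
  · obtain ⟨w, hw, hws⟩ := key p (by simp)
    obtain ⟨u, hu, rfl⟩ := surjOn_of_injOn (by simp) hf hi w hw
    have h1 := hh u hu p (by simp)
    have h2 := hh p (by simp) u hu
    have hus : G.To u p := ⟨h2.2 hws.1, fun h3 => hws.2 (h1.1 h3)⟩
    simp only [Set.mem_insert_iff, Set.mem_singleton_iff] at hu
    rcases hu with rfl | rfl | rfl | rfl | rfl
    · exact hus.ne rfl
    · exact hus.2 ps.1
    · exact hus.2 px.1
    · exact hus.2 py.1
    · exact hus.2 pz.1

end LeHemi

/-- The constraints relating the restrictions of two `(≤ 6)`-hemimorphic digraphs to a difference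
class which is uniformly dominated by (or dominates) a vertex. -/
structure Rules (G G' : Dgraph V) : Prop where
  pair : ∀ {x y}, x ≠ y → Rev G G' x y ∨ Kept G G' x y ∨
    (G.Neutral x y ∧ (G'.Arc x y ↔ G.Arc x y) ∧ (G'.Arc y x ↔ G.Arc y x))
  rkn : ∀ {x y z}, Rev G G' x y → Kept G G' x z → ¬ G.Neutral y z
  rkk : ∀ {x y z}, Rev G G' x y → Kept G G' z x → Kept G G' z y → (G.To z x ↔ G.To z y)
  rrk : ∀ {x y z}, Rev G G' x y → Rev G G' x z → Kept G G' y z → (G.To x y ↔ G.To x z)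
  rrn : ∀ {x y z}, Rev G G' x y → Rev G G' x z → G.Neutral y z → (G.To y x ↔ G.To x z)
  rnn : ∀ {x y z}, Rev G G' x y → G.Neutral z x → G.Neutral z y → (G.Arc z x ↔ G.Arc z y)
  source : ∀ {s x y z}, G.To x y → G.To y z → G.To z x → G.To s x → G.To s y → G.To s z →
    ¬ Rev G G' s x
  sink : ∀ {s x y z}, G.To x y → G.To y z → G.To z x → G.To x s → G.To y s → G.To z s →
    ¬ Rev G G' s x
  kept : ∀ X : Set V, X.Finite → X.ncard ≤ 5 → X.Nonempty →
    (∀ q ∈ X, ∃ y ∈ X, y ≠ q ∧ ¬ G.To y q) → (∀ q ∈ X, ∃ y ∈ X, y ≠ q ∧ ¬ G.To q y) →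
    ∃ f : V → V, (∀ x ∈ X, f x ∈ X) ∧ Set.InjOn f X ∧
      ∀ x ∈ X, ∀ y ∈ X, G.Arc x y ↔ G'.Arc (f x) (f y)
  conn : ∀ x y, Relation.ReflTransGen (Rev G G') x y

theorem Rev.not_kept {G G' : Dgraph V} {x y : V} (h : Rev G G' x y) : ¬ Kept G G' x y := by
  unfold Rev Kept To at *
  tauto

theorem Rev.not_neutral {G G' : Dgraph V} {x y : V} (h : Rev G G' x y) : ¬ G.Neutral x y := by
  unfold Rev Neutral Dir To at *
  tauto

theorem Kept.not_neutral {G G' : Dgraph V} {x y : V} (h : Kept G G' x y) : ¬ G.Neutral x y := by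
  unfold Kept Neutral Dir To at *
  tauto

theorem Rules.dual {G G' : Dgraph V} (h : Rules G G') : Rules G.dual G'.dual where
  pair := by
    intro x y hxy
    rcases h.pair hxy.symm with h1 | h1 | ⟨h1, h2⟩
    · exact Or.inl h1
    · exact Or.inr (Or.inl h1)
    · exact Or.inr (Or.inr ⟨⟨hxy, h1.2⟩, h2⟩)
  rkn := by
    intro x y z h1 h2 h3
    exact h.rkn (Rev.symm h1) (Kept.symm h2) ⟨h3.1, fun h4 => h3.2 (Or.symm h4)⟩
  rkk := by
    intro x y z h1 h2 h3
    have := h.rkk (Rev.symm h1) (Kept.symm h2) (Kept.symm h3)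
    change Kept G G' x z at h2
    change Kept G G' y z at h3
    change G.To x z ↔ G.To y z
    unfold Kept To at *
    tauto
  rrk := by
    intro x y z h1 h2 h3
    have := h.rrk (Rev.symm h1) (Rev.symm h2) (Kept.symm h3)
    change Rev G G' y x at h1
    change Rev G G' z x at h2
    change G.To y x ↔ G.To z x
    unfold Rev To at *
    tauto
  rrn := by
    intro x y z h1 h2 h3
    have := h.rrn (Rev.symm h1) (Rev.symm h2) ⟨h3.1, fun h4 => h3.2 (Or.symm h4)⟩
    change Rev G G' y x at h1
    change Rev G G' z x at h2
    change G.To x y ↔ G.To z x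
    unfold Rev To at *
    tauto
  rnn := by
    intro x y z h1 h2 h3
    have h2' : G.Neutral z x := ⟨h2.1, fun h4 => h2.2 (Or.symm h4)⟩
    have h3' : G.Neutral z y := ⟨h3.1, fun h4 => h3.2 (Or.symm h4)⟩
    have := h.rnn (Rev.symm h1) h2' h3'
    change G.Arc x z ↔ G.Arc y z
    unfold Neutral Dir at *
    tauto
  source := by
    intro s x y z h1 h2 h3 h4 h5 h6 h7
    exact h.sink (s := s) (x := x) (y := z) (z := y) h3 h2 h1 h4 h6 h5 (Rev.symm h7)
  sink := by
    intro s x y z h1 h2 h3 h4 h5 h6 h7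
    exact h.source (s := s) (x := x) (y := z) (z := y) h3 h2 h1 h4 h6 h5 (Rev.symm h7)
  kept := by
    intro X hX h5 hne h1 h2
    obtain ⟨f, h3, h4, h6⟩ := h.kept X hX h5 hne h2 h1
    exact ⟨f, h3, h4, fun x hx y hy => h6 y hy x hx⟩
  conn := by
    intro x y
    exact Relation.ReflTransGen.mono (fun a b hab => Rev.symm hab) _ _ (h.conn x y)

theorem Iso.dual {G : Dgraph V} {H : Dgraph W} (h : Iso G H) : Iso G.dual H.dual := by
  obtain ⟨e, he⟩ := h
  exact ⟨e, fun x y => he y x⟩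

theorem LeHemi.dual {G G' : Dgraph V} {k : ℕ} (h : LeHemi k G G') : LeHemi k G.dual G'.dual := by
  intro j h1 h2 X hX hj
  rcases h j h1 h2 X hX hj with h3 | h3
  · exact Or.inl h3.dual
  · exact Or.inr h3.dual

set_option maxHeartbeats 2000000 in
theorem LeHemi.rules_of_dominated {G G' : Dgraph V} (h : LeHemi 6 G G') {p : V} {C : Set V}
    (hp : ∀ x ∈ C, G.To p x) (hp' : ∀ x ∈ C, G'.To p x)
    (conn : ∀ x y, Relation.ReflTransGen (Rev (G.ind C) (G'.ind C)) x y) :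
    Rules (G.ind C) (G'.ind C) where
  pair := by
    intro x y hxy
    have hxy' : x.1 ≠ y.1 := fun e => hxy (Subtype.ext e)
    have := h.pair hxy'
    have key : Rev G G' x.1 y.1 ∨ Kept G G' x.1 y.1 ∨
      (G.Neutral x.1 y.1 ∧ (G'.Arc x.1 y.1 ↔ G.Arc x.1 y.1) ∧
        (G'.Arc y.1 x.1 ↔ G.Arc y.1 x.1)) := by
      unfold Rev Kept Neutral Dir To
      tauto
    rcases key with h1 | h1 | ⟨h1, h2⟩
    · exact Or.inl h1
    · exact Or.inr (Or.inl h1)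
    · exact Or.inr (Or.inr ⟨⟨hxy, h1.2⟩, h2⟩)
  rkn := by
    intro x y z h1 h2 h3
    change Rev G G' x.1 y.1 at h1
    change Kept G G' x.1 z.1 at h2
    have h3' : G.Neutral y.1 z.1 := ⟨fun e => h3.1 (Subtype.ext e), h3.2⟩
    have := h.rev_uniform h1 (fun h4 => h4.not_kept h2) (fun h4 => h4.not_neutral h3') h2.ne h3'.1
    unfold Kept Neutral Dir To at *
    tauto
  rkk := by
    intro x y z h1 h2 h3
    change Rev G G' x.1 y.1 at h1
    change Kept G G' z.1 x.1 at h2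
    change Kept G G' z.1 y.1 at h3
    exact (h.rev_uniform h1 (fun h4 => h4.symm.not_kept h2) (fun h4 => h4.symm.not_kept h3)
      h2.ne.symm h3.ne.symm).1
  rrk := by
    intro x y z h1 h2 h3
    exact h.rev_rev_kept (x := x.1) (y := y.1) (z := z.1) h1 h2 h3
  rrn := by
    intro x y z h1 h2 h3
    exact h.rev_rev_neutral (x := x.1) (y := y.1) (z := z.1) (hp _ x.2) (hp _ y.2) (hp _ z.2)
      (hp' _ x.2) (hp' _ y.2) (hp' _ z.2) h1 h2 ⟨fun e => h3.1 (Subtype.ext e), h3.2⟩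
  rnn := by
    intro x y z h1 h2 h3
    exact h.rev_neutral_neutral (x := x.1) (y := y.1) (z := z.1) (hp _ z.2).ne (hp _ x.2)
      (hp _ y.2) (hp' _ x.2) (hp' _ y.2) h1 ⟨fun e => h2.1 (Subtype.ext e), h2.2⟩
      ⟨fun e => h3.1 (Subtype.ext e), h3.2⟩
  source := by
    intro s x y z h1 h2 h3 h4 h5 h6
    exact h.dominated_source_cycle (hp _ s.2) (hp _ x.2) (hp _ y.2) (hp _ z.2) (hp' _ s.2)
      (hp' _ x.2) (hp' _ y.2) (hp' _ z.2) h1 h2 h3 h4 h5 h6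
  sink := by
    intro s x y z h1 h2 h3 h4 h5 h6
    exact h.dominated_sink_cycle (hp _ s.2) (hp _ x.2) (hp _ y.2) (hp _ z.2) (hp' _ s.2)
      h1 h2 h3 h4 h5 h6
  kept := by
    classical
    intro X hX h5 hne hs _
    obtain ⟨f, h1, h2, h3⟩ := h.exists_map_of_dominated (p := p) (X := Subtype.val '' X)
      (hX.image _) ((Set.ncard_image_le hX).trans h5) (hne.image _)
      (by rintro _ ⟨x, -, rfl⟩; exact hp _ x.2) (by rintro _ ⟨x, -, rfl⟩; exact hp' _ x.2)
      (by
        rintro _ ⟨q, hq, rfl⟩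
        obtain ⟨y, hy, hyq, hn⟩ := hs q hq
        exact ⟨y.1, ⟨y, hy, rfl⟩, fun e => hyq (Subtype.ext e), hn⟩)
    have h4 : ∀ x ∈ X, ∃ y ∈ X, f x.1 = y.1 := by
      intro x hx
      obtain ⟨y, hy, e⟩ := h1 x.1 ⟨x, hx, rfl⟩
      exact ⟨y, hy, e.symm⟩
    choose! g hg hgf using h4
    refine ⟨g, hg, ?_, ?_⟩
    · intro x hx y hy hxy
      refine Subtype.ext (h2 ⟨x, hx, rfl⟩ ⟨y, hy, rfl⟩ ?_)
      rw [hgf x hx, hgf y hy, hxy]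
    · intro x hx y hy
      have := h3 x.1 ⟨x, hx, rfl⟩ y.1 ⟨y, hy, rfl⟩
      rw [hgf x hx, hgf y hy] at this
      exact this
  conn := conn

theorem Iso.symm {G : Dgraph V} {H : Dgraph W} (h : Iso G H) : Iso H G := by
  obtain ⟨e, he⟩ := h
  exact ⟨e.symm, fun x y => by simp [he]⟩

theorem Iso.trans {G : Dgraph V} {H : Dgraph W} {U : Type*} {K : Dgraph U} (h : Iso G H)
    (h' : Iso H K) : Iso G K := by
  obtain ⟨e, he⟩ := h
  obtain ⟨e', he'⟩ := h'
  exact ⟨e.trans e', fun x y => (he x y).trans (he' _ _)⟩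

/-- Isomorphisms between the blocks of a partition glue together when the arcs between distinct
blocks depend only on the blocks. -/
theorem Iso.glue {ι : Type*} {H H' : Dgraph V} (p : V → ι)
    (hout : ∀ x y x' y', p x ≠ p y → p x' = p x → p y' = p y → (H.Arc x y ↔ H'.Arc x' y'))
    (hin : ∀ i, Iso (H.ind {y | p y = i}) (H'.ind {y | p y = i})) : Iso H H' := by
  choose e he using hin
  let E : V ≃ V := (Equiv.sigmaFiberEquiv p).symm.trans
    ((Equiv.sigmaCongrRight e).trans (Equiv.sigmaFiberEquiv p))
  have hE : ∀ x i (h : p x = i), E x = (e i ⟨x, h⟩).1 := by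
    rintro x _ rfl
    rfl
  have hpE : ∀ x, p (E x) = p x := by
    intro x
    rw [hE x _ rfl]
    exact (e (p x) ⟨x, rfl⟩).2
  refine ⟨E, fun x y => ?_⟩
  by_cases hxy : p y = p x
  · rw [hE x _ rfl, hE y _ hxy]
    exact he (p x) ⟨x, rfl⟩ ⟨y, hxy⟩
  · exact hout x y _ _ (Ne.symm hxy) (hpE x) (hpE y)

theorem IsChainD.exists_rank [Finite V] {G : Dgraph V} (h : G.IsChainD) :
    ∃ e : V ≃ Fin (Nat.card V), ∀ x y, G.Arc x y ↔ e x < e y := by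
  have hlt : ∀ x y, G.Arc x y → {z | G.Arc z x}.ncard < {z | G.Arc z y}.ncard := by
    intro x y hxy
    refine Set.ncard_lt_ncard ⟨fun z hz => h.2 z x y hz hxy, fun hs => G.irrefl x (hs hxy)⟩
      (Set.toFinite _)
  have hb : ∀ x, {z | G.Arc z x}.ncard < Nat.card V := by
    intro x
    rw [← Set.ncard_univ]
    exact Set.ncard_lt_ncard ⟨Set.subset_univ _, fun hs => G.irrefl x (hs (Set.mem_univ x))⟩
      (Set.toFinite _)
  let f : V → Fin (Nat.card V) := fun x => ⟨_, hb x⟩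
  have hf : ∀ x y, G.Arc x y ↔ f x < f y := by
    intro x y
    refine ⟨fun hxy => hlt x y hxy, fun hxy => ?_⟩
    have hne : x ≠ y := by
      rintro rfl
      exact lt_irrefl _ hxy
    rcases h.1 x y hne with h1 | h1
    · exact h1.1
    · exact absurd (hlt y x h1.1) (not_lt.2 (le_of_lt hxy))
  have hi : Function.Injective f := by
    intro x y hxy
    by_contra hne
    rcases h.1 x y hne with h1 | h1
    · exact absurd ((hf _ _).1 h1.1) (by simp [hxy])
    · exact absurd ((hf _ _).1 h1.1) (by simp [hxy])
  have hbij : Function.Bijective f :=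
    (Nat.bijective_iff_injective_and_card f).2 ⟨hi, by simp⟩
  exact ⟨Equiv.ofBijective f hbij, hf⟩

theorem IsChainD.iso [Finite V] {G H : Dgraph V} (hG : G.IsChainD) (hH : H.IsChainD) :
    Iso G H := by
  obtain ⟨e, he⟩ := hG.exists_rank
  obtain ⟨e', he'⟩ := hH.exists_rank
  exact ⟨e.trans e'.symm, fun x y => by simp [he, he']⟩

theorem IsChainD.dual {G : Dgraph V} (h : G.IsChainD) : G.dual.IsChainD :=
  ⟨fun x y hxy => h.1 y x hxy.symm, fun x y z h1 h2 => h.2 z y x h2 h1⟩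

namespace Rules

variable {G G' : Dgraph V}

theorem pair_of_tournament (h : Rules G G') (ht : G.IsTournament) {x y : V} (hxy : x ≠ y) :
    Rev G G' x y ∨ Kept G G' x y := by
  rcases h.pair hxy with h1 | h1 | ⟨h1, -⟩
  · exact Or.inl h1
  · exact Or.inr h1
  · exact absurd (ht x y hxy) h1.2

theorem tri (h : Rules G G') (x y z : V) :
    (Rev G G' x y → Rev G G' x z → Kept G G' y z → (G.To x y ↔ G.To x z)) ∧
    (Rev G G' y x → Rev G G' y z → Kept G G' x z → (G.To y x ↔ G.To y z)) ∧
    (Rev G G' z x → Rev G G' z y → Kept G G' x y → (G.To z x ↔ G.To z y)) ∧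
    (Rev G G' y z → Kept G G' x y → Kept G G' x z → (G.To x y ↔ G.To x z)) ∧
    (Rev G G' x z → Kept G G' y x → Kept G G' y z → (G.To y x ↔ G.To y z)) ∧
    (Rev G G' x y → Kept G G' z x → Kept G G' z y → (G.To z x ↔ G.To z y)) :=
  ⟨h.rrk, h.rrk, h.rrk, h.rkk, h.rkk, h.rkk⟩

theorem not_source_cycle (h : Rules G G') (ht : G.IsTournament) {q x y z : V}
    (hxy : G.To x y) (hyz : G.To y z) (hzx : G.To z x) :
    ¬ (G.To q x ∧ G.To q y ∧ G.To q z) := by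
  have start : ∀ q, G.To q x ∧ G.To q y ∧ G.To q z →
      (G.To q x ∧ G.To q y ∧ G.To q z) ∧ Kept G G' q x ∧ Kept G G' q y ∧ Kept G G' q z := by
    rintro q ⟨h1, h2, h3⟩
    have s1 := h.source hxy hyz hzx h1 h2 h3
    have s2 := h.source hyz hzx hxy h2 h3 h1
    have s3 := h.source hzx hxy hyz h3 h1 h2
    exact ⟨⟨h1, h2, h3⟩, (h.pair_of_tournament ht h1.ne).resolve_left s1,
      (h.pair_of_tournament ht h2.ne).resolve_left s2,
      (h.pair_of_tournament ht h3.ne).resolve_left s3⟩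
  have step : ∀ q q', (G.To q x ∧ G.To q y ∧ G.To q z) → Rev G G' q q' →
      (G.To q' x ∧ G.To q' y ∧ G.To q' z) := by
    intro q q' hq hr
    obtain ⟨h0, k1, k2, k3⟩ := start q hq
    have n1 : q' ≠ x := by rintro rfl; exact hr.not_kept k1
    have n2 : q' ≠ y := by rintro rfl; exact hr.not_kept k2
    have n3 : q' ≠ z := by rintro rfl; exact hr.not_kept k3
    have p1 := h.pair_of_tournament ht n1
    have p2 := h.pair_of_tournament ht n2
    have p3 := h.pair_of_tournament ht n3
    have c1 := h.pair_of_tournament ht hxy.ne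
    have c2 := h.pair_of_tournament ht hyz.ne
    have c3 := h.pair_of_tournament ht hzx.ne
    have s1 := h.sink (s := q') hxy hyz hzx
    have t1 := h.tri q q' x
    have t2 := h.tri q q' y
    have t3 := h.tri q q' z
    have t4 := h.tri q' x y
    have t5 := h.tri q' y z
    have t6 := h.tri q' z x
    have s2 := (start q')
    clear start
    unfold Rev Kept To at *
    grind (splits := 40)
  intro hq
  have key : ∀ r, Relation.ReflTransGen (Rev G G') q r → G.To r x ∧ G.To r y ∧ G.To r z := by
    intro r hr
    induction hr with
    | refl => exact hq
    | tail _ h1 ih => exact step _ _ ih h1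
  exact (key x (h.conn q x)).1.ne rfl

theorem not_sink_cycle (h : Rules G G') (ht : G.IsTournament) {q x y z : V}
    (hxy : G.To x y) (hyz : G.To y z) (hzx : G.To z x) :
    ¬ (G.To x q ∧ G.To y q ∧ G.To z q) := by
  rintro ⟨h1, h2, h3⟩
  exact h.dual.not_source_cycle (fun a b hab => ht b a hab.symm) (q := q) (x := x) (y := z)
    (z := y) hzx hyz hxy ⟨h1, h3, h2⟩

theorem diamondFree (h : Rules G G') (ht : G.IsTournament) : G.DiamondFreeTournament := by
  have to01 : diamondD.To 0 1 := by simp [To, diamondD, ofRel]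
  have to02 : diamondD.To 0 2 := by simp [To, diamondD, ofRel]
  have to03 : diamondD.To 0 3 := by simp [To, diamondD, ofRel]
  have to12 : diamondD.To 1 2 := by simp [To, diamondD, ofRel]
  have to23 : diamondD.To 2 3 := by simp [To, diamondD, ofRel]
  have to31 : diamondD.To 3 1 := by simp [To, diamondD, ofRel]
  refine ⟨ht, ?_⟩
  rintro X (⟨e, he⟩ | ⟨e, he⟩)
  · have key : ∀ i j, diamondD.To i j → G.To (e.symm i).1 (e.symm j).1 := by
      intro i j hij
      have h1 := he (e.symm i) (e.symm j)
      have h2 := he (e.symm j) (e.symm i)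
      simp only [Equiv.apply_symm_apply] at h1 h2
      exact ⟨h1.2 hij.1, fun h3 => hij.2 (h2.1 h3)⟩
    exact h.not_source_cycle ht (key _ _ to12) (key _ _ to23) (key _ _ to31)
      ⟨key _ _ to01, key _ _ to02, key _ _ to03⟩
  · have key : ∀ i j, diamondD.To i j → G.To (e.symm j).1 (e.symm i).1 := by
      intro i j hij
      have h1 := he (e.symm i) (e.symm j)
      have h2 := he (e.symm j) (e.symm i)
      simp only [Equiv.apply_symm_apply] at h1 h2
      exact ⟨h1.2 hij.1, fun h3 => hij.2 (h2.1 h3)⟩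
    exact h.not_sink_cycle ht (key _ _ to31) (key _ _ to23) (key _ _ to12)
      ⟨key _ _ to01, key _ _ to03, key _ _ to02⟩

theorem not_rev_cycle (h : Rules G G') (ht : G.IsTournament)
    (hK : ∀ x y, Relation.ReflTransGen (Kept G G') x y) {a b c : V}
    (hab : G.To a b) (hbc : G.To b c) (hca : G.To c a) (rab : Rev G G' a b)
    (rbc : Rev G G' b c) (rca : Rev G G' c a) : False := by
  have step : ∀ p p', (G.To p b ∧ G.To c p ∧ Rev G G' p b ∧ Rev G G' c p) → Kept G G' p p' →
      (G.To p' b ∧ G.To c p' ∧ Rev G G' p' b ∧ Rev G G' c p') := by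
    rintro p p' ⟨h1, h2, h3, h4⟩ k
    have n1 : p' ≠ b := by rintro rfl; exact h3.not_kept k
    have n2 : p' ≠ c := by rintro rfl; exact h4.symm.not_kept k
    have p1 := h.pair_of_tournament ht n1
    have p2 := h.pair_of_tournament ht n2
    have s1 := h.not_source_cycle ht (q := p') h1 hbc h2
    have s2 := h.not_sink_cycle ht (q := p') h1 hbc h2
    have t1 := h.tri p' p b
    have t2 := h.tri p' p c
    have t3 := h.tri p' b c
    unfold Rev Kept To at *
    grind (splits := 40)
  have key : ∀ r, Relation.ReflTransGen (Kept G G') a r →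
      (G.To r b ∧ G.To c r ∧ Rev G G' r b ∧ Rev G G' c r) := by
    intro r hr
    induction hr with
    | refl => exact ⟨hab, hca, rab, rca⟩
    | tail _ h1 ih => exact step _ _ ih h1
  exact (key b (hK a b)).1.ne rfl

theorem not_kept_cycle (h : Rules G G') (ht : G.IsTournament) {a b c : V}
    (hab : G.To a b) (hbc : G.To b c) (hca : G.To c a) (rab : Kept G G' a b)
    (rbc : Kept G G' b c) (rca : Kept G G' c a) : False := by
  have step : ∀ p p', (G.To p b ∧ G.To c p ∧ Kept G G' p b ∧ Kept G G' c p) → Rev G G' p p' →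
      (G.To p' b ∧ G.To c p' ∧ Kept G G' p' b ∧ Kept G G' c p') := by
    rintro p p' ⟨h1, h2, h3, h4⟩ k
    have n1 : p' ≠ b := by rintro rfl; exact k.not_kept h3
    have n2 : p' ≠ c := by rintro rfl; exact k.symm.not_kept h4
    have p1 := h.pair_of_tournament ht n1
    have p2 := h.pair_of_tournament ht n2
    have s1 := h.not_source_cycle ht (q := p') h1 hbc h2
    have s2 := h.not_sink_cycle ht (q := p') h1 hbc h2
    have t1 := h.tri p' p b
    have t2 := h.tri p' p c
    have t3 := h.tri p' b c
    unfold Rev Kept To at *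
    grind (splits := 40)
  have key : ∀ r, Relation.ReflTransGen (Rev G G') a r →
      (G.To r b ∧ G.To c r ∧ Kept G G' r b ∧ Kept G G' c r) := by
    intro r hr
    induction hr with
    | refl => exact ⟨hab, hca, rab, rca⟩
    | tail _ h1 ih => exact step _ _ ih h1
  exact (key b (h.conn a b)).1.ne rfl

end Rules

/-- The vertices joined to `x` by a path of kept pairs. -/
def keptClass (G G' : Dgraph V) (x : V) : Set V := {y | Relation.ReflTransGen (Kept G G') x y}

theorem keptClass_symm {G G' : Dgraph V} {x y : V} (h : y ∈ keptClass G G' x) :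
    x ∈ keptClass G G' y := by
  have hs : Std.Symm (Kept G G') := ⟨fun _ _ => Kept.symm⟩
  exact Relation.ReflTransGen.stdSymm.symm _ _ h

theorem keptClass_eq_iff {G G' : Dgraph V} {x y : V} :
    keptClass G G' x = keptClass G G' y ↔ y ∈ keptClass G G' x := by
  constructor
  · intro h
    rw [h]
    exact Relation.ReflTransGen.refl
  · intro h
    ext z
    exact ⟨fun hz => Relation.ReflTransGen.trans (keptClass_symm h) hz,
      fun hz => Relation.ReflTransGen.trans h hz⟩

theorem To.of_arc {G : Dgraph V} {x y : V} (h : G.Arc x y) (hd : G.Dir x y) : G.To x y := by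
  unfold Dir To at *
  tauto

theorem isChainD_ind_of_not_cycle {G : Dgraph V} {X : Set V}
    (ht : ∀ x ∈ X, ∀ y ∈ X, x ≠ y → G.Dir x y)
    (hX : ∀ a ∈ X, ∀ b ∈ X, ∀ c ∈ X, G.To a b → G.To b c → G.To c a → False) :
    (G.ind X).IsChainD := by
  refine ⟨fun a b hab => ht _ a.2 _ b.2 fun e => hab (Subtype.ext e), fun a b c hab hbc => ?_⟩
  have to_of_arc : ∀ a b : X, G.Arc a.1 b.1 → G.To a.1 b.1 := fun a b hab =>
    To.of_arc hab (ht _ a.2 _ b.2 fun e => G.irrefl b.1 (by rw [e] at hab; exact hab))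
  have tab := to_of_arc _ _ hab
  have tbc := to_of_arc _ _ hbc
  by_contra hac
  have hne : a.1 ≠ c.1 := by
    intro e
    rw [← e] at tbc
    exact tab.2 tbc.1
  refine hX _ a.2 _ b.2 _ c.2 tab tbc ?_
  rcases ht _ a.2 _ c.2 hne with h1 | h1
  · exact absurd h1.1 hac
  · exact h1

theorem IsTournament.isChainD_ind {G : Dgraph V} (ht : G.IsTournament) {X : Set V}
    (hX : ∀ a ∈ X, ∀ b ∈ X, ∀ c ∈ X, G.To a b → G.To b c → G.To c a → False) :
    (G.ind X).IsChainD :=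
  isChainD_ind_of_not_cycle (fun x _ y _ => ht x y) hX

namespace Rules

variable {G G' : Dgraph V}

theorem to_iff_of_mem_keptClass (h : Rules G G') {z x y : V}
    (hz : ∀ w ∈ keptClass G G' x, Rev G G' z w) (hy : y ∈ keptClass G G' x) :
    G.To z x ↔ G.To z y := by
  have key : ∀ w, Relation.ReflTransGen (Kept G G') x w → (G.To z x ↔ G.To z w) := by
    intro w hw
    induction hw with
    | refl => exact Iff.rfl
    | tail h1 h2 ih => exact ih.trans (h.rrk (hz _ h1) (hz _ (h1.tail h2)) h2)
  exact key y hy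

theorem rev_of_notMem_keptClass (h : Rules G G') (ht : G.IsTournament) {x z w : V}
    (hz : z ∉ keptClass G G' x) (hw : w ∈ keptClass G G' x) : Rev G G' z w := by
  refine (h.pair_of_tournament ht ?_).resolve_right fun hk => hz (Relation.ReflTransGen.tail hw hk.symm)
  rintro rfl
  exact hz hw

theorem not_cycle_keptClass (h : Rules G G') (ht : G.IsTournament) {x a b c : V}
    (ha : a ∈ keptClass G G' x) (hb : b ∈ keptClass G G' x) (hc : c ∈ keptClass G G' x)
    (hab : G.To a b) (hbc : G.To b c) (hca : G.To c a) : False := by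
  by_cases hQ : ∃ z, z ∉ keptClass G G' x
  · obtain ⟨z, hz⟩ := hQ
    have r : ∀ w ∈ keptClass G G' x, Rev G G' z w :=
      fun w hw => h.rev_of_notMem_keptClass ht hz hw
    have i1 := h.to_iff_of_mem_keptClass r ha
    have i2 := h.to_iff_of_mem_keptClass r hb
    have i3 := h.to_iff_of_mem_keptClass r hc
    have s1 := h.not_source_cycle ht (q := z) hab hbc hca
    have s2 := h.not_sink_cycle ht (q := z) hab hbc hca
    have r1 := r a ha
    have r2 := r b hb
    have r3 := r c hc
    unfold Rev To at *
    grind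
  · have hQ' : ∀ z, z ∈ keptClass G G' x := fun z => by_contra fun hz => hQ ⟨z, hz⟩
    have hK : ∀ y z, Relation.ReflTransGen (Kept G G') y z := fun y z =>
      Relation.ReflTransGen.trans (keptClass_symm (hQ' y)) (hQ' z)
    have n1 := h.not_rev_cycle ht hK hab hbc hca
    have n2 := h.not_kept_cycle ht hab hbc hca
    have p1 := h.pair_of_tournament ht hab.ne
    have p2 := h.pair_of_tournament ht hbc.ne
    have p3 := h.pair_of_tournament ht hca.ne
    have t := h.tri a b c
    unfold Rev Kept To at *
    grind (splits := 30)

theorem not_cycle_keptClass' (h : Rules G G') (ht : G.IsTournament) {x a b c : V}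
    (ha : a ∈ keptClass G G' x) (hb : b ∈ keptClass G G' x) (hc : c ∈ keptClass G G' x)
    (hab : G'.To a b) (hbc : G'.To b c) (hca : G'.To c a) : False := by
  have c1 := h.not_cycle_keptClass ht ha hb hc
  have c2 := h.not_cycle_keptClass ht ha hc hb
  have p1 := h.pair_of_tournament ht hab.ne
  have p2 := h.pair_of_tournament ht hbc.ne
  have p3 := h.pair_of_tournament ht hca.ne
  have t := h.tri a b c
  unfold Rev Kept To at *
  grind (splits := 30)

theorem iso_of_tournament (h : Rules G G') (ht : G.IsTournament)
    (hfin : ∀ Q : Set V, G.IsInterval Q → (G.ind Q).IsChainD → Q.Finite)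
    (hsd : G.DiamondFreeTournament → G.SelfDual) : Iso G' G := by
  have hd : Iso G G.dual := hsd (h.diamondFree ht)
  have ht' : G'.IsTournament := by
    intro x y hxy
    have := h.pair_of_tournament ht hxy
    unfold Rev Kept To at this
    unfold Dir
    tauto
  have hint : ∀ x, G.IsInterval (keptClass G G' x) := by
    intro x z hz
    have r : ∀ w ∈ keptClass G G' x, Rev G G' z w :=
      fun w hw => h.rev_of_notMem_keptClass ht hz hw
    by_cases hzx : G.To z x
    · exact Or.inl fun y hy => (h.to_iff_of_mem_keptClass r hy).1 hzx
    · refine Or.inr (Or.inl fun y hy => ?_)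
      have h1 := r y hy
      have h2 := h.to_iff_of_mem_keptClass r hy
      unfold Rev at h1
      unfold To at *
      tauto
  have hch : ∀ x, (G.ind (keptClass G G' x)).IsChainD := fun x =>
    ht.isChainD_ind fun a ha b hb c hc => h.not_cycle_keptClass ht ha hb hc
  have hch' : ∀ x, (G'.ind (keptClass G G' x)).IsChainD := fun x =>
    ht'.isChainD_ind fun a ha b hb c hc => h.not_cycle_keptClass' ht ha hb hc
  have hglue : Iso G.dual G' := by
    refine Iso.glue (keptClass G G') ?_ ?_
    · intro x y x' y' hxy hx hy
      have hyx : y ∉ keptClass G G' x := fun hm => hxy (keptClass_eq_iff.2 hm)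
      have hxy' : x' ∉ keptClass G G' y := fun hm => hxy (by rw [← hx, keptClass_eq_iff.2 hm])
      have r1 : ∀ w ∈ keptClass G G' x, Rev G G' y w :=
        fun w hw => h.rev_of_notMem_keptClass ht hyx hw
      have r2 : ∀ w ∈ keptClass G G' y, Rev G G' x' w :=
        fun w hw => h.rev_of_notMem_keptClass ht hxy' hw
      have mx : x' ∈ keptClass G G' x := keptClass_eq_iff.1 hx.symm
      have my : y' ∈ keptClass G G' y := keptClass_eq_iff.1 hy.symm
      have i1 := h.to_iff_of_mem_keptClass r1 mx
      have i2 := h.to_iff_of_mem_keptClass r2 my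
      have q1 := r1 x Relation.ReflTransGen.refl
      have q2 := r1 x' mx
      have q3 := r2 y' my
      change G.Arc y x ↔ G'.Arc x' y'
      unfold Rev To at *
      grind
    · intro i
      by_cases hi : ∃ x, keptClass G G' x = i
      · obtain ⟨x, rfl⟩ := hi
        have he : {y | keptClass G G' y = keptClass G G' x} = keptClass G G' x := by
          ext y
          exact ⟨fun hy => keptClass_eq_iff.1 (Eq.symm hy), fun hy => (keptClass_eq_iff.2 hy).symm⟩
        rw [he]
        have : Finite (keptClass G G' x) := hfin _ (hint x) (hch x)
        exact (hch x).dual.iso (hch' x)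
      · have : IsEmpty {y | keptClass G G' y = i} := ⟨fun y => hi ⟨y.1, y.2⟩⟩
        exact ⟨Equiv.refl _, fun x => this.elim x⟩
  exact (hd.trans hglue).symm

end Rules

theorem Rev.to_of_to {G G' : Dgraph V} {x y : V} (h : Rev G G' x y) (hxy : G.To x y) : G'.To y x := by
  unfold Rev To at *
  tauto

theorem To.asymm {G : Dgraph V} {x y : V} (h : G.To x y) : ¬ G.To y x := fun h1 => h.2 h1.1

namespace Rules

variable {G G' : Dgraph V}

theorem neutral_iff (h : Rules G G') {x y : V} : G.Neutral x y ↔ G'.Neutral x y := by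
  by_cases hxy : x = y
  · exact ⟨fun h1 => absurd hxy h1.1, fun h1 => absurd hxy h1.1⟩
  · have := h.pair hxy
    unfold Rev Kept Neutral Dir To at *
    tauto

/-- A set of at most five vertices which contains neutral pairs through each of its source-like
or sink-like vertices admits a map carrying `G` onto `G'`. -/
theorem exists_map (h : Rules G G') {X : Set V} (hX : X.Finite) (h5 : X.ncard ≤ 5)
    (hne : X.Nonempty) (h1 : ∀ q ∈ X, ∃ y ∈ X, y ≠ q ∧ ¬ G.To y q)
    (h2 : ∀ q ∈ X, ∃ y ∈ X, y ≠ q ∧ ¬ G.To q y) :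
    ∃ f : V → V, (∀ x ∈ X, f x ∈ X) ∧ Set.InjOn f X ∧
      (∀ x ∈ X, ∀ y ∈ X, G.Arc x y ↔ G'.Arc (f x) (f y)) ∧
      (∀ x ∈ X, ∀ y ∈ X, G.To x y ↔ G'.To (f x) (f y)) ∧
      (∀ x ∈ X, ∀ y ∈ X, G.Neutral x y ↔ G.Neutral (f x) (f y)) := by
  obtain ⟨f, h3, h4, h6⟩ := h.kept X hX h5 hne h1 h2
  have hto : ∀ x ∈ X, ∀ y ∈ X, G.To x y ↔ G'.To (f x) (f y) := by
    intro x hx y hy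
    have := h6 x hx y hy
    have := h6 y hy x hx
    unfold To
    tauto
  refine ⟨f, h3, h4, h6, hto, fun x hx y hy => ?_⟩
  rw [h.neutral_iff (x := f x)]
  have i1 := hto x hx y hy
  have i2 := hto y hy x hx
  have i3 : x = y ↔ f x = f y := ⟨fun e => by rw [e], fun e => h4 hx hy e⟩
  unfold Neutral Dir To at *
  tauto

theorem claw (h : Rules G G') {a b c x : V} (hac : G.Dir a c) (hba : G.Neutral b a)
    (hbc : G.Neutral b c) (hxa : Rev G G' x a) (hxc : Rev G G' x c) (hxb : Rev G G' x b) :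
    False := by
  have hne : a ≠ c := by
    rintro rfl
    unfold Dir at hac
    tauto
  have r1 := h.rrn hxa hxb hba.symm
  have r2 := h.rrn hxc hxb hbc.symm
  have xa := hxa.ne
  have xb := hxb.ne
  have xc := hxc.ne
  have ba := hba.1
  have bc := hbc.1
  have dba := hba.2
  have dbc := hbc.2
  obtain ⟨f, hf, hi, -, hto, hn⟩ := h.exists_map (X := {a, b, c, x}) (by simp)
    ((Set.ncard_insert_le _ _).trans (Nat.succ_le_succ
      ((Set.ncard_insert_le _ _).trans (by rw [Set.ncard_pair xc.symm]; omega)))) (by simp)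
    (by
      rintro q (rfl | rfl | rfl | rfl)
      · exact ⟨b, by simp, ba, fun h1 => dba (Or.inl h1)⟩
      · exact ⟨a, by simp, ba.symm, fun h1 => dba (Or.inr h1)⟩
      · exact ⟨b, by simp, bc, fun h1 => dbc (Or.inl h1)⟩
      · by_cases h3 : G.To b q
        · exact ⟨a, by simp, xa.symm, fun h1 => (r1.1 h1).asymm h3⟩
        · exact ⟨b, by simp, xb.symm, h3⟩)
    (by
      rintro q (rfl | rfl | rfl | rfl)
      · exact ⟨b, by simp, ba, fun h1 => dba (Or.inr h1)⟩
      · exact ⟨a, by simp, ba.symm, fun h1 => dba (Or.inl h1)⟩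
      · exact ⟨b, by simp, bc, fun h1 => dbc (Or.inr h1)⟩
      · by_cases h3 : G.To q b
        · exact ⟨a, by simp, xa.symm, fun h1 => (r1.2 h3).asymm h1⟩
        · exact ⟨b, by simp, xb.symm, h3⟩)
  have fa := hf a (by simp)
  have fb := hf b (by simp)
  have fc := hf c (by simp)
  have fx := hf x (by simp)
  have n1 := (hn b (by simp) a (by simp)).1 hba
  have n2 := (hn b (by simp) c (by simp)).1 hbc
  have t1 := hto x (by simp) b (by simp)
  have i1 : f a ≠ f c := fun e => hne (hi (by simp) (by simp) e)
  have i2 : f x ≠ f a := fun e => xa (hi (by simp) (by simp) e)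
  have i3 : f x ≠ f c := fun e => xc (hi (by simp) (by simp) e)
  have i4 : f x ≠ f b := fun e => xb (hi (by simp) (by simp) e)
  have q1 := hxa.not_neutral
  have q2 := hxb.not_neutral
  have q3 := hxc.not_neutral
  have q4 : ¬ G.Neutral a c := fun h4 => h4.2 hac
  have q5 : ∀ u v, G.Neutral u v → G.Neutral v u := fun u v => Neutral.symm
  have q6 : ∀ u, ¬ G.Neutral u u := fun u hu => hu.1 rfl
  simp only [Set.mem_insert_iff, Set.mem_singleton_iff] at fa fb fc fx
  clear hto hn hi hf r1 r2 hxa hxc dba dbc hac hba hbc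
  have ha : ∀ u, u = a ∨ u = b ∨ u = c ∨ u = x → G.Neutral a u → u = b := by
    rintro u (rfl | rfl | rfl | rfl) hu
    · exact absurd hu (q6 _)
    · rfl
    · exact absurd hu q4
    · exact absurd (q5 _ _ hu) q1
  have hc : ∀ u, u = a ∨ u = b ∨ u = c ∨ u = x → G.Neutral c u → u = b := by
    rintro u (rfl | rfl | rfl | rfl) hu
    · exact absurd (q5 _ _ hu) q4
    · rfl
    · exact absurd hu (q6 _)
    · exact absurd (q5 _ _ hu) q3
  have hx : ∀ u, u = a ∨ u = b ∨ u = c ∨ u = x → ¬ G.Neutral x u := by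
    rintro u (rfl | rfl | rfl | rfl)
    exacts [q1, q2, q3, q6 _]
  have hb : ∀ u, u = a ∨ u = b ∨ u = c ∨ u = x → G.Neutral b u → u = a ∨ u = c := by
    rintro u (rfl | rfl | rfl | rfl) hu
    · exact Or.inl rfl
    · exact absurd hu (q6 _)
    · exact Or.inr rfl
    · exact absurd (q5 _ _ hu) q2
  have eb : f b = b := by
    rcases fb with e | e | e | e
    · rw [e] at n1 n2
      exact absurd ((ha _ fa n1).trans (ha _ fc n2).symm) i1
    · exact e
    · rw [e] at n1 n2
      exact absurd ((hc _ fa n1).trans (hc _ fc n2).symm) i1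
    · rw [e] at n1
      exact absurd n1 (hx _ fa)
  rw [eb] at n1 n2 i4
  have ex : f x = x := by
    have e1 := hb _ fa n1
    have e2 := hb _ fc n2
    clear * - e1 e2 fx i1 i2 i3 i4
    grind
  rw [eb, ex] at t1
  rcases hxb with ⟨h1, h2⟩ | ⟨h1, h2⟩
  · exact (t1.1 h1).asymm h2
  · exact h1.asymm (t1.2 h2)

theorem five_aux (h : Rules G G') {a b x y z : V} (hab : G.Neutral a b)
    (rax : Rev G G' a x) (rbx : Rev G G' b x) (ray : Rev G G' a y) (rby : Rev G G' b y)
    (raz : Rev G G' a z) (rbz : Rev G G' b z) (rzx : Rev G G' z x)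
    (rzy : Rev G G' z y) (hax : G.To a x) (hxb : G.To x b)
    (hay : G.To a y) (hyb : G.To y b) (hbz : G.To b z) (hza : G.To z a) (hxy : G.To x y) :
    G.To z x ↔ G.To y z := by
  obtain ⟨f, hf, hi, -, hto, hn⟩ := h.exists_map (X := {a, b, x, y, z}) (by simp)
    ((Set.ncard_insert_le _ _).trans (Nat.succ_le_succ
      ((Set.ncard_insert_le _ _).trans (Nat.succ_le_succ
      ((Set.ncard_insert_le _ _).trans (by rw [Set.ncard_pair rzy.ne.symm])))))) (by simp)
    (by
      rintro q (rfl | rfl | rfl | rfl | rfl)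
      · exact ⟨b, by simp, hab.1.symm, fun h1 => hab.2 (Or.inr h1)⟩
      · exact ⟨a, by simp, hab.1, fun h1 => hab.2 (Or.inl h1)⟩
      · exact ⟨b, by simp, rbx.ne, hxb.asymm⟩
      · exact ⟨b, by simp, rby.ne, hyb.asymm⟩
      · exact ⟨a, by simp, raz.ne, hza.asymm⟩)
    (by
      rintro q (rfl | rfl | rfl | rfl | rfl)
      · exact ⟨b, by simp, hab.1.symm, fun h1 => hab.2 (Or.inl h1)⟩
      · exact ⟨a, by simp, hab.1, fun h1 => hab.2 (Or.inr h1)⟩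
      · exact ⟨a, by simp, rax.ne, hax.asymm⟩
      · exact ⟨a, by simp, ray.ne, hay.asymm⟩
      · exact ⟨b, by simp, rbz.ne, hbz.asymm⟩)
  have fa := hf a (by simp)
  have fb := hf b (by simp)
  have fx := hf x (by simp)
  have fy := hf y (by simp)
  have fz := hf z (by simp)
  have n1 := (hn a (by simp) b (by simp)).1 hab
  have t1 := (hto a (by simp) x (by simp)).1 hax
  have t2 := (hto a (by simp) y (by simp)).1 hay
  have t3 := (hto z (by simp) a (by simp)).1 hza
  have t4 := (hto x (by simp) y (by simp)).1 hxy
  have t5 := hto z (by simp) x (by simp)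
  have i1 : f x ≠ f y := fun e => hxy.ne (hi (by simp) (by simp) e)
  have i2 : f x ≠ f z := fun e => rzx.ne.symm (hi (by simp) (by simp) e)
  have i3 : f y ≠ f z := fun e => rzy.ne.symm (hi (by simp) (by simp) e)
  have q1 := rax.not_neutral
  have q2 := rbx.not_neutral
  have q3 := ray.not_neutral
  have q4 := rby.not_neutral
  have q5 := raz.not_neutral
  have q6 := rbz.not_neutral
  have q7 := rzx.not_neutral
  have q8 := rzy.not_neutral
  have q9 : ¬ G.Neutral x y := fun h4 => h4.2 (Or.inl hxy)
  have q10 : ∀ u v, G.Neutral u v → G.Neutral v u := fun u v => Neutral.symm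
  have q11 : ∀ u, ¬ G.Neutral u u := fun u hu => hu.1 rfl
  have q12 : ∀ u, ¬ G'.To u u := fun u hu => hu.ne rfl
  have q13 : ∀ u v, G'.To u v → ¬ G'.To v u := fun u v => To.asymm
  have q14 : ¬ G'.To a b ∧ ¬ G'.To b a := by
    have h1 := (h.neutral_iff (x := a) (y := b)).1 hab
    exact ⟨fun h2 => h1.2 (Or.inl h2), fun h2 => h1.2 (Or.inr h2)⟩
  have p1 := rax.to_of_to hax
  have p2 := rbx.symm.to_of_to hxb
  have p3 := ray.to_of_to hay
  have p4 := rby.symm.to_of_to hyb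
  have p5 := rbz.to_of_to hbz
  have p6 := raz.symm.to_of_to hza
  have p7 : ¬ (G.To z x ↔ G'.To z x) := by
    clear * - rzx
    unfold Rev To at *
    tauto
  have p8 : G'.To z y ↔ G.To y z := by
    clear * - rzy
    unfold Rev To at *
    tauto
  simp only [Set.mem_insert_iff, Set.mem_singleton_iff] at fa fb fx fy fz
  clear hto hn hi hf rax ray raz rbx rby rbz rzx rzy hax hay hza hxb hyb hbz
      hxy
  have e1 : (f a = a ∧ f b = b) ∨ (f a = b ∧ f b = a) := by
    have hx : ∀ u, u = a ∨ u = b ∨ u = x ∨ u = y ∨ u = z → ¬ G.Neutral u x := by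
      rintro u (rfl | rfl | rfl | rfl | rfl)
      exacts [q1, q2, q11 _, fun h1 => q9 (q10 _ _ h1), q7]
    have hy : ∀ u, u = a ∨ u = b ∨ u = x ∨ u = y ∨ u = z → ¬ G.Neutral u y := by
      rintro u (rfl | rfl | rfl | rfl | rfl)
      exacts [q3, q4, q9, q11 _, q8]
    have hz : ∀ u, u = a ∨ u = b ∨ u = x ∨ u = y ∨ u = z → ¬ G.Neutral u z := by
      rintro u (rfl | rfl | rfl | rfl | rfl)
      exacts [q5, q6, fun h1 => q7 (q10 _ _ h1), fun h1 => q8 (q10 _ _ h1), q11 _]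
    have key : ∀ u, u = a ∨ u = b ∨ u = x ∨ u = y ∨ u = z → ∀ v,
        v = a ∨ v = b ∨ v = x ∨ v = y ∨ v = z → G.Neutral u v → u = a ∨ u = b := by
      rintro u (hu | hu | rfl | rfl | rfl) v hv h1
      · exact Or.inl hu
      · exact Or.inr hu
      · exact absurd (q10 _ _ h1) (hx v hv)
      · exact absurd (q10 _ _ h1) (hy v hv)
      · exact absurd (q10 _ _ h1) (hz v hv)
    have k1 := key _ fa _ fb n1
    have k2 := key _ fb _ fa (q10 _ _ n1)
    have k3 := n1.1
    clear * - k1 k2 k3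
    grind
  rcases e1 with ⟨ea, eb⟩ | ⟨ea, eb⟩
  · rw [ea] at t1 t2
    have key : ∀ u, u = a ∨ u = b ∨ u = x ∨ u = y ∨ u = z → G'.To a u → u = z := by
      rintro u (rfl | rfl | rfl | rfl | rfl) h1
      exacts [absurd h1 (q12 _), absurd h1 q14.1, absurd h1 (q13 _ _ p1),
        absurd h1 (q13 _ _ p3), rfl]
    exact absurd ((key _ fx t1).trans (key _ fy t2).symm) i1
  · rw [ea] at t1 t2 t3
    have key : ∀ u, u = a ∨ u = b ∨ u = x ∨ u = y ∨ u = z → G'.To u b → u = z := by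
      rintro u (rfl | rfl | rfl | rfl | rfl) h1
      exacts [absurd h1 q14.1, absurd h1 (q12 _), absurd h1 (q13 _ _ p2),
        absurd h1 (q13 _ _ p4), rfl]
    have ez : f z = z := key _ fz t3
    have key' : ∀ u, u = a ∨ u = b ∨ u = x ∨ u = y ∨ u = z → G'.To b u → u ≠ z →
        u = x ∨ u = y := by
      rintro u (rfl | rfl | rfl | rfl | rfl) h1 h2
      exacts [absurd h1 q14.2, absurd h1 (q12 _), Or.inl rfl, Or.inr rfl, absurd rfl h2]
    rw [ez] at i2 i3
    have ex : f x = y := by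
      rcases key' _ fx t1 i2 with e | e
      · exact absurd (by rw [t5, ez, e]) p7
      · exact e
    rw [t5, ez, ex, p8]

theorem five (h : Rules G G') {a b x y z : V} (hab : G.Neutral a b)
    (rax : Rev G G' a x) (rbx : Rev G G' b x) (ray : Rev G G' a y) (rby : Rev G G' b y)
    (raz : Rev G G' a z) (rbz : Rev G G' b z) (hax : G.To a x) (hxb : G.To x b)
    (hay : G.To a y) (hyb : G.To y b) (hbz : G.To b z) (hza : G.To z a) (hxy : G.To x y)
    (hzx : G.Dir z x) (hzy : G.Dir z y) : G.To y z ∧ G.To z x := by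
  have zx : z ≠ x := by
    rintro rfl
    exact hax.2 hza.1
  have zy : z ≠ y := by
    rintro rfl
    exact hay.2 hza.1
  have rzx : Rev G G' z x := by
    rcases h.pair zx with p | p | p
    · exact p
    · exact absurd ((h.rrk raz rax p).2 hax) hza.asymm
    · exact absurd hzx p.1.2
  have rzy : Rev G G' z y := by
    rcases h.pair zy with p | p | p
    · exact p
    · exact absurd ((h.rrk raz ray p).2 hay) hza.asymm
    · exact absurd hzy p.1.2
  have e := h.five_aux hab rax rbx ray rby raz rbz rzx rzy hax hxb hay hyb hbz hza hxy
  have s1 : G.To x z → ¬ G.To z y := fun h1 h2 =>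
    h.sink (s := y) (x := a) (y := x) (z := z) hax h1 hza hay hxy h2 ray.symm
  clear * - e s1 hzx hzy
  unfold Dir at *
  unfold To at *
  tauto

end Rules

theorem Kept.dir {G G' : Dgraph V} {x y : V} (h : Kept G G' x y) : G.Dir x y := by
  unfold Kept Dir To at *
  tauto

theorem Rev.dir {G G' : Dgraph V} {x y : V} (h : Rev G G' x y) : G.Dir x y := by
  unfold Rev Dir To at *
  tauto

theorem Rev.to_or {G G' : Dgraph V} {x y : V} (h : Rev G G' x y) : G.To x y ∨ G.To y x :=
  h.imp And.left And.left

/-- Two reversed pairs sharing a vertex whose other ends form a neutral pair. -/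
structure Wedge (G G' : Dgraph V) (y x z : V) : Prop where
  yx : Rev G G' y x
  xz : Rev G G' x z
  n : G.Neutral y z
  tyx : G.To y x
  txz : G.To x z

namespace Rules

variable {G G' : Dgraph V}

theorem trichotomy (h : Rules G G') {x y : V} (hxy : x ≠ y) :
    Rev G G' x y ∨ Kept G G' x y ∨ G.Neutral x y := by
  rcases h.pair hxy with h1 | h1 | h1
  exacts [Or.inl h1, Or.inr (Or.inl h1), Or.inr (Or.inr h1.1)]

theorem wedge_or (h : Rules G G') {x y z : V} (h1 : Rev G G' x y) (h2 : Rev G G' x z)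
    (h3 : G.Neutral y z) : Wedge G G' y x z ∨ Wedge G G' z x y := by
  rcases h1.to_or with h4 | h4
  · exact Or.inr ⟨h2.symm, h1, h3.symm, (h.rrn h2 h1 h3.symm).2 h4, h4⟩
  · exact Or.inl ⟨h1.symm, h2, h3, h4, (h.rrn h1 h2 h3).1 h4⟩

theorem exists_wedge (h : Rules G G') {a b : V} (hab : G.Neutral a b) :
    ∃ y x z, Wedge G G' y x z := by
  by_contra hno
  have key : ∀ x y z, Rev G G' x y → Rev G G' x z → ¬ G.Neutral y z := fun x y z h1 h2 h3 =>
    (h.wedge_or h1 h2 h3).elim (fun h4 => hno ⟨_, _, _, h4⟩) (fun h4 => hno ⟨_, _, _, h4⟩)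
  have inv : ∀ w, Relation.ReflTransGen (Rev G G') a w → ¬ G.Neutral a w := by
    intro w hw
    induction hw with
    | refl => exact fun h1 => h1.1 rfl
    | @tail v w _ hvw ih =>
      intro hn
      by_cases hv : a = v
      · subst hv
        exact hvw.not_neutral hn
      · rcases h.trichotomy hv with h1 | h1 | h1
        · exact key v a w h1.symm hvw hn
        · exact h.rkn hvw h1.symm hn.symm
        · exact ih h1
  exact inv b (h.conn a b) hab

theorem types (h : Rules G G') {y x z w : V} (e : Wedge G G' y x z) (wy : w ≠ y) (wx : w ≠ x)
    (wz : w ≠ z) :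
    (Kept G G' w y ∧ Kept G G' w x ∧ Kept G G' w z) ∨
    (Rev G G' w y ∧ Kept G G' w x ∧ Rev G G' w z) ∨
    (Rev G G' w y ∧ G.Neutral w x ∧ Rev G G' w z) ∨
    (G.Neutral w y ∧ G.Neutral w x ∧ G.Neutral w z) ∨
    (Rev G G' w y ∧ G.Neutral w x ∧ G.Neutral w z ∧ G.To w y) ∨
    (G.Neutral w y ∧ G.Neutral w x ∧ Rev G G' w z ∧ G.To z w) ∨
    (Rev G G' w y ∧ Rev G G' w x ∧ Rev G G' w z) := by
  obtain ⟨hyx, hxz, hn, tyx, txz⟩ := e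
  rcases h.trichotomy wy with p1 | p1 | p1 <;> rcases h.trichotomy wx with p2 | p2 | p2 <;>
    rcases h.trichotomy wz with p3 | p3 | p3
  · exact Or.inr (Or.inr (Or.inr (Or.inr (Or.inr (Or.inr ⟨p1, p2, p3⟩)))))
  · exact absurd hn (h.rkn p1 p3)
  · exact (h.claw p1.dir p3.symm hn.symm p2.symm hyx.symm hxz).elim
  · exact Or.inr (Or.inl ⟨p1, p2, p3⟩)
  · exact absurd hn (h.rkn p1 p3)
  · exact absurd p3.symm (h.rkn hxz p2.symm)
  · exact Or.inr (Or.inr (Or.inl ⟨p1, p2, p3⟩))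
  · exact absurd hn (h.rkn p1 p3)
  · exact Or.inr (Or.inr (Or.inr (Or.inr (Or.inl
      ⟨p1, p2, p3, (h.rrn p1.symm hyx p2).2 tyx⟩))))
  · exact absurd hn.symm (h.rkn p3 p1)
  · have e1 := h.rrk p2.symm hyx.symm p1
    have e2 := h.rrk p2.symm hxz p3
    exact absurd (e1.1 (e2.2 txz)) tyx.asymm
  · exact (h.claw p1.dir p3.symm hn.symm p2.symm hyx.symm hxz).elim
  · exact absurd hn.symm (h.rkn p3 p1)
  · exact Or.inl ⟨p1, p2, p3⟩
  · exact absurd p3.symm (h.rkn hxz p2.symm)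
  · exact absurd p2.symm (h.rkn hyx p1.symm)
  · exact absurd p2.symm (h.rkn hyx p1.symm)
  · exact absurd p2.symm (h.rkn hyx p1.symm)
  · exact (h.claw p3.dir p1.symm hn p2.symm hxz hyx.symm).elim
  · exact (h.claw p3.dir p1.symm hn p2.symm hxz hyx.symm).elim
  · have e1 := h.rrn p2.symm hxz p3
    have e2 := h.rrn p2.symm hyx.symm p1
    exact absurd (e2.1 (e1.2 txz)) tyx.asymm
  · exact absurd p1.symm (h.rkn hyx.symm p2.symm)
  · exact absurd p1.symm (h.rkn hyx.symm p2.symm)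
  · exact absurd p1.symm (h.rkn hyx.symm p2.symm)
  · exact Or.inr (Or.inr (Or.inr (Or.inr (Or.inr (Or.inl
      ⟨p1, p2, p3, (h.rrn hxz.symm p3.symm p2.symm).1 txz⟩)))))
  · exact absurd p2.symm (h.rkn hxz.symm p3.symm)
  · exact Or.inr (Or.inr (Or.inr (Or.inl ⟨p1, p2, p3⟩)))

/-- No vertex is joined to a wedge by three kept pairs. -/
theorem not_kept_wedge (h : Rules G G') {y x z w : V} (e : Wedge G G' y x z) :
    ¬ (Kept G G' w y ∧ Kept G G' w x ∧ Kept G G' w z) := by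
  intro hw
  have inv : ∀ v, Relation.ReflTransGen (Rev G G') w v →
      Kept G G' v y ∧ Kept G G' v x ∧ Kept G G' v z := by
    intro v hv
    induction hv with
    | refl => exact hw
    | @tail u v _ huv ih =>
      obtain ⟨k1, k2, k3⟩ := ih
      have vy : v ≠ y := by
        rintro rfl
        exact huv.not_kept k1
      have vx : v ≠ x := by
        rintro rfl
        exact huv.not_kept k2
      have vz : v ≠ z := by
        rintro rfl
        exact huv.not_kept k3
      have n1 := h.rkn huv k1
      have n2 := h.rkn huv k2
      have n3 := h.rkn huv k3
      have main : Rev G G' v y → Rev G G' v z → False := by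
        intro r1 r3
        have e1 := h.rrk huv.symm r1 k1
        have e2 := h.rrk huv.symm r3 k3
        have e3 := h.rrn r1 r3 e.n
        rcases r1.to_or with t | t
        · exact (e3.2 (e2.1 (e1.2 t))).asymm t
        · exact t.asymm (e1.1 (e2.2 (e3.1 t)))
      rcases h.types e vy vx vz with t | t | t | t | t | t | t
      · exact t
      · exact (main t.1 t.2.2).elim
      · exact absurd t.2.1 n2
      · exact absurd t.2.1 n2
      · exact absurd t.2.1 n2
      · exact absurd t.2.1 n2
      · exact (main t.1 t.2.2).elim
  exact (inv x (h.conn w x)).2.1.ne rfl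

end Rules

/-- An oriented path on four vertices all of whose arcs are reversed. -/
structure PathFour (G G' : Dgraph V) (w y x z : V) : Prop where
  left : Wedge G G' w y x
  right : Wedge G G' y x z
  n : G.Neutral w z

namespace Rules

variable {G G' : Dgraph V}

/-- Without a path on four vertices, both ends of a wedge form reversed pairs with all the other
vertices. -/
theorem rev_of_not_pathFour (h : Rules G G') (hno : ∀ a b c d, ¬ PathFour G G' a b c d)
    {y x z w : V} (e : Wedge G G' y x z) (wy : w ≠ y) (wz : w ≠ z) :
    Rev G G' w y ∧ Rev G G' w z := by
  have hT : ∀ v, v ≠ y → v ≠ x → v ≠ z → (Rev G G' v y ∧ Rev G G' v z) ∨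
      (G.Neutral v y ∧ G.Neutral v x ∧ G.Neutral v z) := by
    intro v vy vx vz
    rcases h.types e vy vx vz with t | t | t | t | t | t | t
    · exact (h.not_kept_wedge e t).elim
    · exact Or.inl ⟨t.1, t.2.2⟩
    · exact Or.inl ⟨t.1, t.2.2⟩
    · exact Or.inr t
    · exact (hno v y x z ⟨⟨t.1, e.yx, t.2.1, t.2.2.2, e.tyx⟩, e, t.2.2.1⟩).elim
    · exact (hno y x z v ⟨e, ⟨e.xz, t.2.2.1.symm, t.2.1.symm, e.txz, t.2.2.2⟩, t.1.symm⟩).elim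
    · exact Or.inl ⟨t.1, t.2.2⟩
  by_cases wx : w = x
  · subst wx
    exact ⟨e.yx.symm, e.xz⟩
  rcases hT w wy wx wz with t | t
  · exact t
  exfalso
  have inv : ∀ v, Relation.ReflTransGen (Rev G G') w v →
      G.Neutral v y ∧ G.Neutral v x ∧ G.Neutral v z := by
    intro v hv
    induction hv with
    | refl => exact t
    | @tail u v _ huv ih =>
      obtain ⟨k1, k2, k3⟩ := ih
      have vy : v ≠ y := by
        rintro rfl
        exact huv.not_neutral k1
      have vx : v ≠ x := by
        rintro rfl
        exact huv.not_neutral k2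
      have vz : v ≠ z := by
        rintro rfl
        exact huv.not_neutral k3
      rcases hT v vy vx vz with ⟨r1, r3⟩ | s
      · have e1 := h.rrn huv.symm r1 k1
        have e2 := h.rrn huv.symm r3 k3
        have e3 := h.rrn r1 r3 e.n
        rcases r1.to_or with t | t
        · exact ((e3.2 (e2.1 (e1.2 t))).asymm t).elim
        · exact (t.asymm (e1.1 (e2.2 (e3.1 t)))).elim
      · exact s
  exact (inv x (h.conn w x)).2.1.1 rfl

end Rules

theorem OneEndInfiniteConsecutivity.dual {G : Dgraph V} (h : G.OneEndInfiniteConsecutivity) :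
    G.dual.OneEndInfiniteConsecutivity := by
  obtain ⟨full, h | h⟩ := h
  · exact ⟨full, Or.inr h.dual⟩
  · exact ⟨full, Or.inl h.dual⟩

/-- Digraphs whose arc-connectivity structure is a path or a cycle and whose neutral pairs are
all full or all void. -/
structure Pathlike (G : Dgraph V) (t : Prop) : Prop where
  n : ∀ {x y}, G.Neutral x y → (G.Arc x y ↔ t)
  succ : ∀ {x y z}, G.To x y → G.To x z → y = z
  pred : ∀ {x y z}, G.To y x → G.To z x → y = z
  conn : ∀ x y, Relation.ReflTransGen G.Dir x y

namespace Pathlike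

variable {G : Dgraph V} {t : Prop}

theorem dual (h : Pathlike G t) : Pathlike G.dual t where
  n := fun {x y} hn => h.n (x := y) (y := x) ⟨hn.1.symm, hn.2⟩
  succ := fun h1 h2 => h.pred h1 h2
  pred := fun h1 h2 => h.succ h1 h2
  conn := fun x y => Relation.ReflTransGen.mono (fun _ _ => Or.symm) x y (h.conn x y)

theorem arc_iff (h : Pathlike G t) {x y : V} :
    G.Arc x y ↔ G.To x y ∨ (x ≠ y ∧ ¬ G.To y x ∧ t) := by
  by_cases hxy : x = y
  · subst hxy
    have := G.irrefl x
    unfold To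
    tauto
  by_cases h1 : G.To x y
  · exact ⟨fun _ => Or.inl h1, fun _ => h1.1⟩
  by_cases h2 : G.To y x
  · exact ⟨fun h3 => absurd h3 h2.2, fun h3 => h3.elim And.left fun h3 => absurd h2 h3.2.1⟩
  · have := h.n (x := x) (y := y) ⟨hxy, fun h3 => h3.elim h1 h2⟩
    tauto

theorem selfDual_of_equiv (h : Pathlike G t) (f : V ≃ V)
    (hf : ∀ x y, G.To x y ↔ G.To (f y) (f x)) : G.SelfDual := by
  refine ⟨f, fun x y => ?_⟩
  change G.Arc x y ↔ G.Arc (f y) (f x)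
  rw [h.arc_iff, h.arc_iff, hf x y, hf y x, f.injective.ne_iff, ne_comm]

theorem exists_reversal (σ : Equiv.Perm V) (x₀ x₁ : V) (hσ : ∀ v, ∃ k : ℤ, (σ ^ k) x₀ = v) :
    ∃ f : V ≃ V, f x₁ = x₀ ∧ ∀ x, f (σ x) = σ⁻¹ (f x) := by
  choose k hk using hσ
  obtain ⟨m, hm⟩ : ∃ m : ℤ, (σ ^ m) x₀ = x₁ := ⟨_, hk x₁⟩
  have wd : ∀ i j : ℤ, (σ ^ i) x₀ = (σ ^ j) x₀ → (σ ^ (m - i)) x₀ = (σ ^ (m - j)) x₀ := by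
    intro i j hij
    have := congrArg (σ ^ (m - i - j)) hij
    rw [← Equiv.Perm.mul_apply, ← Equiv.Perm.mul_apply, ← zpow_add, ← zpow_add] at this
    rw [show m - i = m - i - j + j by ring, show m - j = m - i - j + i by ring]
    exact this.symm
  have ev : ∀ i : ℤ, (σ ^ (m - k ((σ ^ i) x₀))) x₀ = (σ ^ (m - i)) x₀ := fun i => wd _ _ (hk _)
  have inv : Function.Involutive fun v => (σ ^ (m - k v)) x₀ := by
    intro v
    simp only [ev, sub_sub_cancel, hk]
  refine ⟨inv.toPerm, ?_, fun x => ?_⟩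
  · change (σ ^ (m - k x₁)) x₀ = x₀
    conv_lhs => rw [← hm]
    rw [ev]
    simp
  · change (σ ^ (m - k (σ x))) x₀ = σ⁻¹ ((σ ^ (m - k x)) x₀)
    have e1 : σ x = (σ ^ (k x + 1)) x₀ := by
      rw [add_comm, zpow_add, Equiv.Perm.mul_apply, hk, zpow_one]
    rw [e1, ev, ← Equiv.Perm.mul_apply, ← zpow_neg_one, ← zpow_add]
    congr 2
    ring

theorem reach (h : Pathlike G t) {x₀ : V} (h₀ : ∀ y, ¬ G.To y x₀) (v : V) :
    Relation.ReflTransGen G.To x₀ v := by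
  have := h.conn x₀ v
  induction this with
  | refl => exact .refl
  | @tail u v _ huv ih =>
    rcases huv with h1 | h1
    · exact ih.tail h1
    · rcases Relation.ReflTransGen.cases_tail ih with e | ⟨w, h2, h3⟩
      · exact absurd (e ▸ h1) (h₀ v)
      · exact h.pred h3 h1 ▸ h2

theorem source_unique (h : Pathlike G t) {x₀ x : V} (h₀ : ∀ y, ¬ G.To y x₀)
    (hx : ∀ y, ¬ G.To y x) : x = x₀ := by
  rcases Relation.ReflTransGen.cases_tail (h.reach h₀ x) with e | ⟨w, -, h3⟩
  · exact e
  · exact absurd h3 (hx w)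

theorem sink_unique (h : Pathlike G t) {x₀ x : V} (h₀ : ∀ y, ¬ G.To x₀ y)
    (hx : ∀ y, ¬ G.To x y) : x = x₀ := h.dual.source_unique h₀ hx

theorem selfDual_of_no_end (h : Pathlike G t) (hs : ∀ x, ∃ y, G.To x y)
    (hp : ∀ x, ∃ y, G.To y x) : G.SelfDual := by
  choose s hs using hs
  choose p hp using hp
  let σ : Equiv.Perm V := ⟨s, p, fun x => h.pred (hp _) (hs _), fun x => h.succ (hs _) (hp _)⟩
  have hσ : ∀ x y, G.To x y ↔ y = σ x := fun x y =>
    ⟨fun h1 => h.succ h1 (hs x), fun h1 => h1 ▸ hs x⟩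
  rcases isEmpty_or_nonempty V with hV | ⟨⟨x₀⟩⟩
  · exact ⟨Equiv.refl V, fun x => isEmptyElim x⟩
  have tr : ∀ v, ∃ k : ℤ, (σ ^ k) x₀ = v := by
    intro v
    have := h.conn x₀ v
    induction this with
    | refl => exact ⟨0, rfl⟩
    | @tail u v _ huv ih =>
      obtain ⟨k, hk⟩ := ih
      rcases huv with h1 | h1
      · refine ⟨1 + k, ?_⟩
        rw [zpow_add, Equiv.Perm.mul_apply, hk, zpow_one]
        exact ((hσ _ _).1 h1).symm
      · refine ⟨-1 + k, ?_⟩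
        rw [zpow_add, Equiv.Perm.mul_apply, hk, zpow_neg_one, Equiv.Perm.inv_eq_iff_eq]
        exact (hσ _ _).1 h1
  obtain ⟨f, -, hf⟩ := exists_reversal σ x₀ x₀ tr
  refine h.selfDual_of_equiv f fun x y => ?_
  have e : f x = σ (f y) ↔ y = σ x := by
    rw [← Equiv.Perm.inv_eq_iff_eq, ← hf, f.injective.eq_iff, eq_comm]
  rw [hσ, hσ, e]

theorem selfDual_of_two_ends (h : Pathlike G t) {x₀ x₁ : V} (h₀ : ∀ y, ¬ G.To y x₀)
    (h₁ : ∀ y, ¬ G.To x₁ y) : G.SelfDual := by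
  have hs : ∀ x, ∃ y, G.To x y ∨ (x = x₁ ∧ y = x₀) := by
    intro x
    by_cases hx : ∃ y, G.To x y
    · exact hx.imp fun _ => Or.inl
    · exact ⟨x₀, Or.inr ⟨h.sink_unique h₁ (not_exists.1 hx), rfl⟩⟩
  have hp : ∀ x, ∃ y, G.To y x ∨ (y = x₁ ∧ x = x₀) := by
    intro x
    by_cases hx : ∃ y, G.To y x
    · exact hx.imp fun _ => Or.inl
    · exact ⟨x₁, Or.inr ⟨rfl, h.source_unique h₀ (not_exists.1 hx)⟩⟩
  choose s hs using hs
  choose p hp using hp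
  have ps : ∀ x, p (s x) = x := by
    intro x
    rcases hs x with h1 | ⟨h1, h2⟩ <;> rcases hp (s x) with h3 | ⟨h3, h4⟩
    · exact h.pred h3 h1
    · exact absurd (h4 ▸ h1) (h₀ x)
    · exact absurd (h2 ▸ h3) (h₀ _)
    · rw [h3, h1]
  have sp : ∀ x, s (p x) = x := by
    intro x
    rcases hp x with h1 | ⟨h1, h2⟩ <;> rcases hs (p x) with h3 | ⟨h3, h4⟩
    · exact h.succ h3 h1
    · exact absurd (h3 ▸ h1) (h₁ x)
    · exact absurd (h1 ▸ h3) (h₁ _)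
    · rw [h4, h2]
  let σ : Equiv.Perm V := ⟨s, p, ps, sp⟩
  have hσ : ∀ x y, G.To x y ↔ y = σ x ∧ x ≠ x₁ := by
    refine fun x y => ⟨fun h1 => ?_, fun h1 => ?_⟩
    · have : x ≠ x₁ := by
        rintro rfl
        exact h₁ y h1
      rcases hs x with h2 | h2
      · exact ⟨h.succ h1 h2, this⟩
      · exact absurd h2.1 this
    · rcases hs x with h2 | h2
      · exact h1.1 ▸ h2
      · exact absurd h2.1 h1.2
  have e₁ : σ x₁ = x₀ := (hs x₁).elim (fun h1 => absurd h1 (h₁ _)) And.right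
  have tr : ∀ v, ∃ k : ℤ, (σ ^ k) x₀ = v := by
    intro v
    have := h.reach h₀ v
    induction this with
    | refl => exact ⟨0, rfl⟩
    | @tail u v _ huv ih =>
      obtain ⟨k, hk⟩ := ih
      refine ⟨1 + k, ?_⟩
      rw [zpow_add, Equiv.Perm.mul_apply, hk, zpow_one]
      exact ((hσ _ _).1 huv).1.symm
  obtain ⟨f, f₁, hf⟩ := exists_reversal σ x₀ x₁ tr
  have f₀ : f x₀ = x₁ := by
    rw [← e₁, hf, f₁, Equiv.Perm.inv_eq_iff_eq, e₁]
  refine h.selfDual_of_equiv f fun x y => ?_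
  have e : f x = σ (f y) ↔ y = σ x := by
    rw [← Equiv.Perm.inv_eq_iff_eq, ← hf, f.injective.eq_iff, eq_comm]
  have e' : f y ≠ x₁ ↔ y ≠ x₀ := by rw [← f₀, f.injective.ne_iff]
  rw [hσ, hσ, e, e']
  refine and_congr_right ?_
  rintro rfl
  rw [← e₁, σ.injective.ne_iff]

theorem oneEnd_of_source (h : Pathlike G t) {x₀ : V} (h₀ : ∀ y, ¬ G.To y x₀)
    (hs : ∀ x, ∃ y, G.To x y) : G.OneEndInfiniteConsecutivity := by
  classical
  choose s hs using hs
  have hto : ∀ x y, G.To x y ↔ y = s x := fun x y =>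
    ⟨fun h1 => h.succ h1 (hs x), fun h1 => h1 ▸ hs x⟩
  have sinj : Function.Injective s := fun x y e => h.pred (hs x) (e ▸ hs y)
  let g : ℕ → V := fun n => s^[n] x₀
  have gs : ∀ n, g (n + 1) = s (g n) := fun n => Function.iterate_succ_apply' s n x₀
  have ginj : Function.Injective g := by
    intro i
    induction i with
    | zero =>
      intro j e
      cases j with
      | zero => rfl
      | succ j => exact absurd (((gs j).symm.trans e.symm) ▸ hs (g j)) (h₀ _)
    | succ i ih =>
      intro j e
      cases j with
      | zero => exact absurd (((gs i).symm.trans e) ▸ hs (g i)) (h₀ _)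
      | succ j =>
        rw [gs, gs] at e
        rw [ih (sinj e)]
  have gsurj : Function.Surjective g := by
    intro v
    have := h.reach h₀ v
    induction this with
    | refl => exact ⟨0, rfl⟩
    | @tail u v _ huv ih =>
      obtain ⟨n, rfl⟩ := ih
      exact ⟨n + 1, (gs n).trans ((hto _ _).1 huv).symm⟩
  have gto : ∀ i j, G.To (g i) (g j) ↔ i + 1 = j := by
    intro i j
    rw [hto, ← gs, ginj.eq_iff, eq_comm]
  refine ⟨decide t, Or.inl (Iso.symm ⟨Equiv.ofBijective g ⟨ginj, gsurj⟩, fun i j => ?_⟩)⟩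
  change (consecNat (decide t)).Arc i j ↔ G.Arc (g i) (g j)
  rw [h.arc_iff, gto, gto, ginj.ne_iff]
  simp only [consecNat, ofRel, decide_eq_true_eq]
  constructor
  · rintro ⟨h1, h2 | ⟨h2, h3⟩⟩
    · exact Or.inl h2
    · exact Or.inr ⟨h1, by omega, h2⟩
  · rintro (h1 | ⟨h1, h2, h3⟩)
    · exact ⟨by omega, Or.inl h1⟩
    · refine ⟨h1, ?_⟩
      by_cases h4 : i + 1 = j
      · exact Or.inl h4
      · exact Or.inr ⟨h3, by omega⟩

theorem oneEnd_or_selfDual (h : Pathlike G t) :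
    G.OneEndInfiniteConsecutivity ∨ G.SelfDual := by
  by_cases h₀ : ∃ x₀, ∀ y, ¬ G.To y x₀ <;> by_cases h₁ : ∃ x₁, ∀ y, ¬ G.To x₁ y
  · obtain ⟨x₀, h₀⟩ := h₀
    obtain ⟨x₁, h₁⟩ := h₁
    exact Or.inr (h.selfDual_of_two_ends h₀ h₁)
  · obtain ⟨x₀, h₀⟩ := h₀
    push Not at h₁
    exact Or.inl (h.oneEnd_of_source h₀ h₁)
  · obtain ⟨x₁, h₁⟩ := h₁
    push Not at h₀
    exact Or.inl (h.dual.oneEnd_of_source h₁ h₀).dual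
  · push Not at h₀ h₁
    exact Or.inr (h.selfDual_of_no_end h₁ h₀)

end Pathlike

theorem Neutral.arc_comm {G : Dgraph V} {x y : V} (h : G.Neutral x y) : G.Arc x y ↔ G.Arc y x := by
  have := h.2
  unfold Dir at this
  tauto

namespace PathFour

variable {G G' : Dgraph V} {w y x z : V}

theorem nbr (h : Rules G G') (e : PathFour G G' w y x z) {u : V} (uw : u ≠ w) (uy : u ≠ y)
    (ux : u ≠ x) (uz : u ≠ z) :
    G.Neutral u y ∧ G.Neutral u x ∧ (Rev G G' u w ∨ G.Neutral u w) ∧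
      (Rev G G' u z ∨ G.Neutral u z) := by
  rcases h.types e.left uw uy ux with t | t | t | t | t | t | t <;>
    rcases h.types e.right uy ux uz with s | s | s | s | s | s | s
  all_goals first
    | exact (h.not_kept_wedge e.left t).elim
    | exact (h.not_kept_wedge e.right s).elim
    | exact absurd t.2.1 (Rev.not_kept s.1)
    | exact absurd s.1 (Rev.not_kept t.2.1)
    | exact absurd t.2.1 (Rev.not_neutral s.1)
    | exact absurd s.1 (Rev.not_neutral t.2.1)
    | exact absurd t.2.1 (Kept.not_neutral s.1)
    | exact absurd s.1 (Kept.not_neutral t.2.1)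
    | exact absurd s.2.1 (Rev.not_neutral t.2.2)
    | exact absurd s.2.1 (Rev.not_kept t.2.2)
    | exact absurd s.2.1 (Rev.not_neutral t.2.2.1)
    | skip
  · exact ⟨s.1, s.2.1, Or.inr t.1, Or.inr s.2.2⟩
  · exact ⟨s.1, s.2.1, Or.inr t.1, Or.inl s.2.2.1⟩
  · exact ⟨s.1, s.2.1, Or.inl t.1, Or.inr s.2.2⟩
  · exact ⟨s.1, s.2.1, Or.inl t.1, Or.inl s.2.2.1⟩
  · exact (h.claw e.left.yx.dir e.n.symm e.right.n.symm t.1 t.2.1 s.2.2).elim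

theorem extend_left (h : Rules G G') (e : PathFour G G' w y x z) {u : V} (huw : Rev G G' u w)
    (uy : u ≠ y) : PathFour G G' u w y x := by
  have ux : u ≠ x := by
    rintro rfl
    exact huw.symm.not_neutral e.left.n
  have uz : u ≠ z := by
    rintro rfl
    exact huw.symm.not_neutral e.n
  obtain ⟨n1, n2, -⟩ := e.nbr h huw.ne uy ux uz
  exact ⟨⟨huw, e.left.yx, n1, (h.rrn huw.symm e.left.yx n1).2 e.left.tyx, e.left.tyx⟩, e.left, n2⟩

theorem extend_right (h : Rules G G') (e : PathFour G G' w y x z) {u : V} (huz : Rev G G' z u)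
    (ux : u ≠ x) : PathFour G G' y x z u := by
  have uy : u ≠ y := by
    rintro rfl
    exact huz.symm.not_neutral e.right.n
  have uw : u ≠ w := by
    rintro rfl
    exact huz.symm.not_neutral e.n
  obtain ⟨n1, n2, -⟩ := e.nbr h uw uy ux huz.ne.symm
  exact ⟨e.right, ⟨e.right.xz, huz, n2.symm, e.right.txz,
    (h.rrn e.right.xz.symm huz n2.symm).1 e.right.txz⟩, n1.symm⟩

theorem arc_iff (h : Rules G G') (e : PathFour G G' w y x z) :
    (G.Arc w x ↔ G.Arc w z) ∧ (G.Arc w z ↔ G.Arc y z) := by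
  refine ⟨h.rnn e.right.xz e.left.n e.n, ?_⟩
  rw [e.n.arc_comm, e.right.n.arc_comm]
  exact h.rnn e.left.yx e.n.symm e.right.n.symm

/-- Every vertex lies on a path on four vertices. -/
theorem cover (h : Rules G G') {t : Prop} (e : PathFour G G' w y x z) (ht : G.Arc w x ↔ t) (v : V) :
    ∃ a b c d, PathFour G G' a b c d ∧ (v = a ∨ v = b ∨ v = c ∨ v = d) ∧ (G.Arc a c ↔ t) := by
  have := h.conn w v
  induction this with
  | refl => exact ⟨w, y, x, z, e, Or.inl rfl, ht⟩
  | @tail u v _ huv ih =>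
    obtain ⟨a, b, c, d, p, hu, hp⟩ := ih
    by_cases va : v = a
    · exact ⟨a, b, c, d, p, Or.inl va, hp⟩
    by_cases vb : v = b
    · exact ⟨a, b, c, d, p, Or.inr (Or.inl vb), hp⟩
    by_cases vc : v = c
    · exact ⟨a, b, c, d, p, Or.inr (Or.inr (Or.inl vc)), hp⟩
    by_cases vd : v = d
    · exact ⟨a, b, c, d, p, Or.inr (Or.inr (Or.inr vd)), hp⟩
    obtain ⟨n1, n2, -⟩ := p.nbr h va vb vc vd
    rcases hu with rfl | rfl | rfl | rfl
    · have q := p.extend_left h huv.symm vb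
      refine ⟨v, u, b, c, q, Or.inl rfl, ?_⟩
      rw [(q.arc_iff h).1, (q.arc_iff h).2, hp]
    · exact absurd n1 huv.symm.not_neutral
    · exact absurd n2 huv.symm.not_neutral
    · have q := p.extend_right h huv vc
      refine ⟨b, c, u, v, q, Or.inr (Or.inr (Or.inr rfl)), ?_⟩
      rw [← (p.arc_iff h).2, ← (p.arc_iff h).1, hp]

theorem rev_or_neutral (h : Rules G G') (e : PathFour G G' w y x z) {u v : V} (huv : u ≠ v) :
    Rev G G' u v ∨ G.Neutral u v := by
  obtain ⟨a, b, c, d, p, hv, -⟩ := e.cover h Iff.rfl v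
  have key : ∀ u, u ≠ v → (u = a ∨ u = b ∨ u = c ∨ u = d) → Rev G G' u v ∨ G.Neutral u v := by
    have p1 := p.left.yx
    have p2 := p.left.xz
    have p3 := p.right.xz
    have n1 := p.left.n
    have n2 := p.right.n
    have n3 := p.n
    rintro u hu (rfl | rfl | rfl | rfl) <;> rcases hv with rfl | rfl | rfl | rfl
    all_goals first
      | exact absurd rfl hu
      | exact Or.inl (by assumption)
      | exact Or.inr (by assumption)
      | exact Or.inl (Rev.symm (by assumption))
      | exact Or.inr (Neutral.symm (by assumption))
  by_cases hu : u = a ∨ u = b ∨ u = c ∨ u = d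
  · exact key u huv hu
  · simp only [not_or] at hu
    obtain ⟨n1, n2, n3, n4⟩ := p.nbr h hu.1 hu.2.1 hu.2.2.1 hu.2.2.2
    rcases hv with rfl | rfl | rfl | rfl
    exacts [n3, Or.inr n1, Or.inr n2, n4]

/-- A vertex together with its predecessor and successor. -/
theorem succ_pred (h : Rules G G') (e : PathFour G G' w y x z) {t : Prop} (ht : G.Arc w x ↔ t)
    (v : V) :
    (∀ b c, G.To v b → G.To v c → b = c) ∧ (∀ b c, G.To b v → G.To c v → b = c) ∧
      ∀ b c, G.To b v → G.To v c → G.Neutral b c ∧ (G.Arc b c ↔ t) := by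
  have hR : ∀ {u v}, G.To u v → Rev G G' u v := fun {u v} huv =>
    (e.rev_or_neutral h huv.ne).resolve_right fun h1 => h1.2 (Or.inl huv)
  have hR' : ∀ {u v}, G.Neutral u v → ¬ G.To u v ∧ ¬ G.To v u := fun {u v} huv =>
    ⟨fun h1 => huv.2 (Or.inl h1), fun h1 => huv.2 (Or.inr h1)⟩
  obtain ⟨a, b, c, d, p, hv, hp⟩ := e.cover h ht v
  have i1 := p.arc_iff h
  have key : ∀ u, u ≠ v → (u = a ∨ u = b ∨ u = c ∨ u = d) ∨
    (G.Neutral u b ∧ G.Neutral u c ∧ u ≠ b ∧ u ≠ c) := by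
    intro u hu
    by_cases hu' : u = a ∨ u = b ∨ u = c ∨ u = d
    · exact Or.inl hu'
    · simp only [not_or] at hu'
      obtain ⟨n1, n2, -⟩ := p.nbr h hu'.1 hu'.2.1 hu'.2.2.1 hu'.2.2.2
      exact Or.inr ⟨n1, n2, hu'.2.1, hu'.2.2.1⟩
  have nac := p.left.n
  have nbd := p.right.n
  have nad := p.n
  have tab := p.left.tyx
  have tbc := p.left.txz
  have tcd := p.right.txz
  rcases hv with rfl | rfl | rfl | rfl
  · have hs : ∀ u, G.To v u → u = b := by
      intro u hu
      by_contra hub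
      exact hu.asymm (p.extend_left h (hR hu).symm hub).left.tyx
    have hp' : ∀ u, G.To u v → PathFour G G' u v b c := by
      intro u hu
      refine p.extend_left h (hR hu) ?_
      rintro rfl
      exact hu.asymm tab
    refine ⟨fun x y hx hy => (hs x hx).trans (hs y hy).symm, fun x y hx hy => ?_, fun x y hx hy => ?_⟩
    · by_contra hxy
      have r := (hp' x hx).nbr h (u := y) (Ne.symm hxy) hy.ne (by rintro rfl; exact hy.asymm tab)
        (by rintro rfl; exact (hR' nac).2 hy)
      exact (hR' r.1).1 hy
    · obtain rfl := hs y hy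
      have q := hp' x hx
      exact ⟨q.left.n, by rw [(q.arc_iff h).1, (q.arc_iff h).2, hp]⟩
  · have hs : ∀ u, G.To v u → u = c := by
      intro u hu
      rcases key u hu.ne.symm with (rfl | rfl | rfl | rfl) | h1
      · exact absurd tab hu.asymm
      · exact absurd rfl hu.ne
      · rfl
      · exact absurd hu (hR' nbd).1
      · exact absurd hu (hR' h1.1).2
    have hs' : ∀ u, G.To u v → u = a := by
      intro u hu
      rcases key u hu.ne with (rfl | rfl | rfl | rfl) | h1
      · rfl
      · exact absurd rfl hu.ne
      · exact absurd tbc hu.asymm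
      · exact absurd hu (hR' nbd).2
      · exact absurd hu (hR' h1.1).1
    refine ⟨fun x y hx hy => (hs x hx).trans (hs y hy).symm,
      fun x y hx hy => (hs' x hx).trans (hs' y hy).symm, fun x y hx hy => ?_⟩
    rw [hs' x hx, hs y hy]
    exact ⟨nac, hp⟩
  · have hs : ∀ u, G.To v u → u = d := by
      intro u hu
      rcases key u hu.ne.symm with (rfl | rfl | rfl | rfl) | h1
      · exact absurd hu (hR' nac).2
      · exact absurd tbc hu.asymm
      · exact absurd rfl hu.ne
      · rfl
      · exact absurd hu (hR' h1.2.1).2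
    have hs' : ∀ u, G.To u v → u = b := by
      intro u hu
      rcases key u hu.ne with (rfl | rfl | rfl | rfl) | h1
      · exact absurd hu (hR' nac).1
      · rfl
      · exact absurd rfl hu.ne
      · exact absurd tcd hu.asymm
      · exact absurd hu (hR' h1.2.1).1
    refine ⟨fun x y hx hy => (hs x hx).trans (hs y hy).symm,
      fun x y hx hy => (hs' x hx).trans (hs' y hy).symm, fun x y hx hy => ?_⟩
    rw [hs' x hx, hs y hy]
    exact ⟨nbd, by rw [← i1.2, ← i1.1, hp]⟩
  · have hs : ∀ u, G.To u v → u = c := by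
      intro u hu
      by_contra hub
      exact hu.asymm (p.extend_right h (hR hu).symm hub).right.txz
    have hp' : ∀ u, G.To v u → PathFour G G' b c v u := by
      intro u hu
      refine p.extend_right h (hR hu) ?_
      rintro rfl
      exact hu.asymm tcd
    refine ⟨fun x y hx hy => ?_, fun x y hx hy => (hs x hx).trans (hs y hy).symm, fun x y hx hy => ?_⟩
    · by_contra hxy
      have r := (hp' x hx).nbr h (u := y) (by rintro rfl; exact (hR' nbd).2 hy)
        (by rintro rfl; exact hy.asymm tcd) hy.ne.symm (Ne.symm hxy)
      exact (hR' r.2.1).2 hy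
    · obtain rfl := hs x hx
      have q := hp' y hy
      exact ⟨q.right.n, by rw [← (q.arc_iff h).2, ← (q.arc_iff h).1, ← i1.2, ← i1.1, hp]⟩

theorem arc_of_neutral (h : Rules G G') (e : PathFour G G' w y x z) {u v : V}
    (huv : G.Neutral u v) : G.Arc u v ↔ G.Arc w x := by
  obtain ⟨v₀, hv₀, ht⟩ : ∃ v₀, G.Neutral u v₀ ∧ (G.Arc u v₀ ↔ G.Arc w x) := by
    obtain ⟨a, b, c, d, p, hu, hp⟩ := e.cover h Iff.rfl u
    have i1 := p.arc_iff h
    rcases hu with rfl | rfl | rfl | rfl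
    · exact ⟨c, p.left.n, hp⟩
    · exact ⟨d, p.right.n, by rw [← i1.2, ← i1.1, hp]⟩
    · exact ⟨a, p.left.n.symm, by rw [← p.left.n.arc_comm, hp]⟩
    · exact ⟨a, p.n.symm, by rw [← p.n.arc_comm, ← i1.1, hp]⟩
  have inv : ∀ v, Relation.ReflTransGen (Rev G G') v₀ v → G.Neutral u v →
      (G.Arc u v ↔ G.Arc w x) := by
    intro v hv
    induction hv with
    | refl => exact fun _ => ht
    | @tail v v' _ hvv ih =>
      intro hn
      by_cases huv : u = v
      · subst huv
        exact absurd hn hvv.not_neutral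
      rcases e.rev_or_neutral h huv with h1 | h1
      · rcases h.wedge_or h1.symm hvv hn with h2 | h2
        · exact ((e.succ_pred h Iff.rfl v).2.2 _ _ h2.tyx h2.txz).2
        · rw [hn.arc_comm]
          exact ((e.succ_pred h Iff.rfl v).2.2 _ _ h2.tyx h2.txz).2
      · rw [← h.rnn hvv h1 hn]
        exact ih h1
  exact inv v (h.conn v₀ v) huv

theorem pathlike (h : Rules G G') (e : PathFour G G' w y x z) : Pathlike G (G.Arc w x) where
  n := e.arc_of_neutral h
  succ := fun h1 h2 => (e.succ_pred h Iff.rfl _).1 _ _ h1 h2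
  pred := fun h1 h2 => (e.succ_pred h Iff.rfl _).2.1 _ _ h1 h2
  conn := fun x y => Relation.ReflTransGen.mono (fun _ _ => Rev.dir) x y (h.conn x y)

theorem iso (h : Rules G G') (e : PathFour G G' w y x z)
    (ho : ¬ G.OneEndInfiniteConsecutivity) : Iso G' G := by
  obtain ⟨f, hf⟩ := (e.pathlike h).oneEnd_or_selfDual.resolve_left ho
  refine ⟨f, fun a b => ?_⟩
  have : G'.Arc a b ↔ G.Arc b a := by
    by_cases hab : a = b
    · subst hab
      exact iff_of_false (G'.irrefl a) (G.irrefl a)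
    rcases h.pair hab with h1 | h1 | h1
    · clear * - h1
      unfold Rev To at h1
      tauto
    · exact ((e.rev_or_neutral h hab).elim (fun h2 => h2.not_kept h1) h1.not_neutral).elim
    · rw [h1.2.1, h1.1.arc_comm]
  rw [this]
  exact hf b a

end PathFour

/-- A neutral pair which forms reversed pairs with all the other vertices. -/
structure Poles (G G' : Dgraph V) (a b : V) : Prop where
  rules : Rules G G'
  n : G.Neutral a b
  rev : ∀ w, w ≠ a → w ≠ b → Rev G G' w a ∧ Rev G G' w b

namespace Poles

variable {G G' : Dgraph V} {a b : V}

theorem symm (h : Poles G G' a b) : Poles G G' b a :=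
  ⟨h.rules, h.n.symm, fun w h1 h2 => (h.rev w h2 h1).symm⟩

theorem ne_of_to (h : Poles G G' a b) {x : V} (hx : G.To a x) : x ≠ b := by
  rintro rfl
  exact h.n.2 (Or.inl hx)

theorem rev_left (h : Poles G G' a b) {x : V} (hx : G.To a x) : Rev G G' x a :=
  (h.rev x hx.ne.symm (h.ne_of_to hx)).1

theorem rev_right (h : Poles G G' a b) {x : V} (hx : G.To a x) : Rev G G' x b :=
  (h.rev x hx.ne.symm (h.ne_of_to hx)).2

theorem to_right (h : Poles G G' a b) {x : V} (hx : G.To a x) : G.To x b :=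
  (h.rules.rrn (h.rev_left hx) (h.rev_right hx) h.n).1 hx

theorem to_or (h : Poles G G' a b) {x : V} (xa : x ≠ a) (xb : x ≠ b) : G.To a x ∨ G.To b x := by
  obtain ⟨r1, r2⟩ := h.rev x xa xb
  rcases r1.to_or with h1 | h1
  · exact Or.inr ((h.rules.rrn r2 r1 h.n.symm).2 h1)
  · exact Or.inl h1

theorem dir (h : Poles G G' a b) {x y : V} (hx : G.To a x) (hy : G.To a y) (hxy : x ≠ y) :
    G.Dir x y := by
  by_contra hd
  exact hx.asymm ((h.rules.rrn (h.rev_left hx).symm (h.rev_left hy).symm ⟨hxy, hd⟩).2 hy)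

theorem not_cycle (h : Poles G G' a b) {x y z : V} (hx : G.To a x) (hy : G.To a y)
    (hz : G.To a z) : ¬ (G.To x y ∧ G.To y z ∧ G.To z x) := fun hc =>
  h.rules.source hc.1 hc.2.1 hc.2.2 hx hy hz (h.rev_left hx).symm

theorem rev_or_neutral (h : Poles G G' a b) {x z : V} (hx : G.To a x) (hz : G.To b z) :
    Rev G G' x z ∨ G.Neutral x z := by
  have hne : x ≠ z := by
    rintro rfl
    exact (h.to_right hx).asymm hz
  rcases h.rules.trichotomy hne with h1 | h1 | h1
  · exact Or.inl h1
  · exact absurd ((h.rules.rrk (h.rev_left hx).symm (h.symm.rev_right hz).symm h1).1 hx)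
      (h.symm.to_right hz).asymm
  · exact Or.inr h1

theorem dir_or_neutral (h : Poles G G' a b) {x z : V} (hx : G.To a x) (hz : G.To b z) :
    G.Dir z x ∨ G.Neutral z x :=
  (h.rev_or_neutral hx hz).imp (fun h1 => h1.symm.dir) Neutral.symm

theorem rev_of_dir (h : Poles G G' a b) {x z : V} (hx : G.To a x) (hz : G.To b z)
    (hd : G.Dir z x) : Rev G G' z x :=
  ((h.rev_or_neutral hx hz).resolve_right fun h1 => h1.2 (Or.symm hd)).symm

theorem five (h : Poles G G' a b) {x y z : V} (hx : G.To a x) (hy : G.To a y) (hz : G.To b z)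
    (hxy : G.To x y) (hzx : G.Dir z x) (hzy : G.Dir z y) : G.To y z ∧ G.To z x :=
  h.rules.five h.n (h.rev_left hx).symm (h.rev_right hx).symm (h.rev_left hy).symm
    (h.rev_right hy).symm (h.symm.rev_right hz).symm (h.symm.rev_left hz).symm hx (h.to_right hx)
    hy (h.to_right hy) hz (h.symm.to_right hz) hxy hzx hzy

theorem claw (h : Poles G G' a b) {x y z : V} (hx : G.To a x) (hy : G.To a y) (hz : G.To b z)
    (hxy : x ≠ y) (hzx : G.Neutral z x) (hzy : G.Neutral z y) : False :=
  h.rules.claw (h.dir hx hy hxy) hzx hzy (h.rev_left hx).symm (h.rev_left hy).symm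
    (h.symm.rev_right hz).symm

/-- A vertex `z` which forms a neutral pair with `y` and a reversed one with `x`. -/
theorem rev_of_neutral (h : Poles G G' a b) {x y z : V} (hx : G.To a x) (hy : G.To a y)
    (hxy : x ≠ y) (hzx : Rev G G' z x) (hzy : G.Neutral z y) :
    Rev G G' x y ∧ (G.To z x ↔ G.To x y) := by
  have r : Rev G G' x y := by
    rcases h.rules.trichotomy hxy with h1 | h1 | h1
    · exact h1
    · exact absurd hzy (h.rules.rkn hzx.symm h1)
    · exact absurd (h.dir hx hy hxy) h1.2
  exact ⟨r, h.rules.rrn hzx.symm r hzy⟩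

theorem not_three_aux (h : Poles G G' a b) {x y t z : V} (hx : G.To a x) (hy : G.To a y)
    (ht : G.To a t) (hz : G.To b z) (hxy : G.To x y) (hyt : G.To y t) (hxt : G.To x t) :
    False := by
  rcases h.dir_or_neutral hx hz with d1 | d1 <;> rcases h.dir_or_neutral hy hz with d2 | d2 <;>
    rcases h.dir_or_neutral ht hz with d3 | d3
  · exact (h.five hx hy hz hxy d1 d2).1.asymm (h.five hy ht hz hyt d2 d3).2
  · have r2 := h.rev_of_dir hy hz d2
    exact (h.five hx hy hz hxy d1 d2).1.asymm ((h.rev_of_neutral hy ht hyt.ne r2 d3).2.2 hyt)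
  · have r1 := h.rev_of_dir hx hz d1
    have r3 := h.rev_of_dir ht hz d3
    obtain ⟨t1, t2⟩ := h.five hx ht hz hxt d1 d3
    have r4 := (h.rev_of_neutral hx hy hxy.ne r1 d2).1
    have r5 := (h.rev_of_neutral ht hy hyt.ne.symm r3 d2).1
    have := h.rules.five d2.symm r5.symm r3 (h.rev_right hy) (h.symm.rev_left hz) r4.symm r1 hyt t1
      (h.to_right hy) hz t2 hxy (h.to_right ht) (Or.inl hxt) (h.rev_right hx).dir
    exact this.1.asymm (h.to_right hx)
  · exact h.claw hy ht hz hyt.ne d2 d3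
  · have r2 := h.rev_of_dir hy hz d2
    have e := h.rules.rrn (h.rev_of_neutral hy hx hxy.ne.symm r2 d1).1 r2.symm d1.symm
    exact (h.five hy ht hz hyt d2 d3).2.asymm (e.1 hxy)
  · exact h.claw hx ht hz hxt.ne d1 d3
  · exact h.claw hx hy hz hxy.ne d1 d2
  · exact h.claw hx hy hz hxy.ne d1 d2

theorem not_three (h : Poles G G' a b) {x y t z : V} (hx : G.To a x) (hy : G.To a y)
    (ht : G.To a t) (hz : G.To b z) (hxy : x ≠ y) (hyt : y ≠ t) (hxt : x ≠ t) : False := by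
  rcases h.dir hx hy hxy with d1 | d1 <;> rcases h.dir hy ht hyt with d2 | d2 <;>
    rcases h.dir hx ht hxt with d3 | d3
  · exact h.not_three_aux hx hy ht hz d1 d2 d3
  · exact h.not_cycle hx hy ht ⟨d1, d2, d3⟩
  · exact h.not_three_aux hx ht hy hz d3 d2 d1
  · exact h.not_three_aux ht hx hy hz d3 d1 d2
  · exact h.not_three_aux hy hx ht hz d1 d3 d2
  · exact h.not_three_aux hy ht hx hz d2 d3 d1
  · exact h.not_cycle hx ht hy ⟨d3, d2, d1⟩
  · exact h.not_three_aux ht hy hx hz d2 d1 d3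

theorem not_cycle_aux (h : Poles G G' a b) {x y z : V} (hxy : G.To x y) (hyz : G.To y z)
    (hxz : G.To x z) :
    ¬ (G'.To x y ∧ G'.To y z ∧ G'.To z x) ∧ ¬ (G'.To y x ∧ G'.To z y ∧ G'.To x z) := by
  obtain ⟨-, t2, -, -, t5, -⟩ := h.rules.tri x y z
  constructor
  · rintro ⟨h1, h2, h3⟩
    have k1 : Kept G G' x y := Or.inl ⟨hxy, h1⟩
    have k2 : Kept G G' y z := Or.inl ⟨hyz, h2⟩
    have k3 : Rev G G' x z := Or.inl ⟨hxz, h3⟩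
    exact hxy.asymm ((t5 k3 k1.symm k2).2 hyz)
  · rintro ⟨h1, h2, h3⟩
    have k1 : Rev G G' x y := Or.inl ⟨hxy, h1⟩
    have k2 : Rev G G' y z := Or.inl ⟨hyz, h2⟩
    have k3 : Kept G G' x z := Or.inl ⟨hxz, h3⟩
    exact hxy.asymm ((t2 k1.symm k2 k3).2 hyz)

theorem isChainD_ind (h : Poles G G' a b) : (G.ind {w | G.To a w}).IsChainD :=
  isChainD_ind_of_not_cycle (fun _ hx _ hy => h.dir hx hy)
    (fun _ hx _ hy _ hz h1 h2 h3 => h.not_cycle hx hy hz ⟨h1, h2, h3⟩)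

theorem isChainD_ind' (h : Poles G G' a b) : (G'.ind {w | G.To a w}).IsChainD := by
  have hd : ∀ {x y}, G.To a x → G.To a y → x ≠ y → G'.Dir x y := by
    intro x y hx hy hxy
    by_contra hn
    exact (h.rules.neutral_iff.2 ⟨hxy, hn⟩).2 (h.dir hx hy hxy)
  refine isChainD_ind_of_not_cycle (fun _ hx _ hy => hd hx hy) ?_
  intro x hx y hy z hz h1 h2 h3
  have n1 := h1.ne
  have n2 := h2.ne
  have n3 := h3.ne
  rcases h.dir hx hy n1 with d1 | d1 <;> rcases h.dir hy hz n2 with d2 | d2 <;>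
    rcases h.dir hz hx n3 with d3 | d3
  · exact h.not_cycle hx hy hz ⟨d1, d2, d3⟩
  · exact (h.not_cycle_aux d1 d2 d3).1 ⟨h1, h2, h3⟩
  · exact (h.not_cycle_aux d3 d1 d2).1 ⟨h3, h1, h2⟩
  · exact (h.not_cycle_aux d3 d2 d1).2 ⟨h3, h2, h1⟩
  · exact (h.not_cycle_aux d2 d3 d1).1 ⟨h2, h3, h1⟩
  · exact (h.not_cycle_aux d1 d3 d2).2 ⟨h1, h3, h2⟩
  · exact (h.not_cycle_aux d2 d1 d3).2 ⟨h2, h1, h3⟩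
  · exact h.not_cycle hx hz hy ⟨d3, d2, d1⟩

/-- The case where all the vertices are between the poles. -/
theorem iso_of_forall (h : Poles G G' a b) (hL : ∀ w, w ≠ a → w ≠ b → G.To a w)
    (hfin : {w | G.To a w}.Finite) : Iso G' G := by
  classical
  have ha : ∀ w, G.To a w → w ≠ a := fun w hw => hw.ne.symm
  have hb : ∀ w, G.To a w → w ≠ b := fun w hw => h.ne_of_to hw
  let H : Dgraph V := ⟨fun x y => G.Arc (Equiv.swap a b x) (Equiv.swap a b y),
    fun x => G.irrefl _⟩
  have hH : Iso H G := ⟨Equiv.swap a b, fun _ _ => Iff.rfl⟩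
  refine Iso.trans ?_ hH
  let p : V → Fin 3 := fun x => if x = a then 0 else if x = b then 1 else 2
  have hab := h.n.1
  have pa : p a = 0 := by simp [p]
  have pb : p b = 1 := by simp [p, hab.symm]
  have pL : ∀ w, G.To a w → p w = 2 := fun w hw => by simp [p, ha w hw, hb w hw]
  have p2 : ∀ w, p w = 2 → G.To a w := by
    intro w hw
    refine hL w ?_ ?_
    · rintro rfl
      simp [pa] at hw
    · rintro rfl
      simp [pb] at hw
  have p1 : ∀ w, p w = 1 → w = b := by
    intro w hw
    by_contra hwb
    by_cases hwa : w = a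
    · simp [hwa, pa] at hw
    · simp [pL w (hL w hwa hwb)] at hw
  have p0 : ∀ w, p w = 0 → w = a := by
    intro w hw
    by_contra hwa
    by_cases hwb : w = b
    · simp [hwb, pb] at hw
    · simp [pL w (hL w hwa hwb)] at hw
  have hsL : ∀ w, G.To a w → Equiv.swap a b w = w := fun w hw =>
    Equiv.swap_apply_of_ne_of_ne (ha w hw) (hb w hw)
  have hcases : ∀ w, w = a ∨ w = b ∨ G.To a w := fun w =>
    or_iff_not_imp_left.2 fun h1 => or_iff_not_imp_left.2 fun h2 => hL w h1 h2
  have tL : ∀ w, G.To a w → G'.To w a ∧ G'.To b w ∧ G.To w b := fun w hw =>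
    ⟨(h.rev_left hw).symm.to_of_to hw, (h.rev_right hw).to_of_to (h.to_right hw), h.to_right hw⟩
  obtain ⟨n1, n2⟩ : (G'.Arc a b ↔ G.Arc a b) ∧ (G'.Arc b a ↔ G.Arc b a) := by
    rcases h.rules.pair hab with h1 | h1 | h1
    · exact absurd h.n h1.not_neutral
    · exact absurd h.n h1.not_neutral
    · exact h1.2
  have n3 := h.n.arc_comm
  refine Iso.glue p ?_ ?_
  · intro x y x' y' hne hx hy
    change _ ↔ G.Arc (Equiv.swap a b x') (Equiv.swap a b y')
    rcases hcases x with rfl | rfl | lx <;> rcases hcases y with rfl | rfl | ly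
    · exact absurd rfl hne
    · rw [p0 x' (hx.trans pa), p1 y' (hy.trans pb), Equiv.swap_apply_left, Equiv.swap_apply_right,
        n1, n3]
    · have ly' := p2 y' (hy.trans (pL y ly))
      rw [p0 x' (hx.trans pa), Equiv.swap_apply_left, hsL y' ly']
      exact iff_of_false (tL y ly).1.2 (tL y' ly').2.2.2
    · rw [p1 x' (hx.trans pb), p0 y' (hy.trans pa), Equiv.swap_apply_left, Equiv.swap_apply_right,
        n2, n3]
    · exact absurd rfl hne
    · have ly' := p2 y' (hy.trans (pL y ly))
      rw [p1 x' (hx.trans pb), Equiv.swap_apply_right, hsL y' ly']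
      exact iff_of_true (tL y ly).2.1.1 ly'.1
    · have lx' := p2 x' (hx.trans (pL x lx))
      rw [p0 y' (hy.trans pa), Equiv.swap_apply_left, hsL x' lx']
      exact iff_of_true (tL x lx).1.1 (tL x' lx').2.2.1
    · have lx' := p2 x' (hx.trans (pL x lx))
      rw [p1 y' (hy.trans pb), Equiv.swap_apply_right, hsL x' lx']
      exact iff_of_false (tL x lx).2.1.2 lx'.2
    · exact absurd ((pL x lx).trans (pL y ly).symm) hne
  · have hsub : ∀ (K K' : Dgraph V) (i : Fin 3) (c : V), (∀ w, p w = i → w = c) →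
        Iso (K.ind {y | p y = i}) (K'.ind {y | p y = i}) := by
      intro K K' i c hc
      refine ⟨Equiv.refl _, fun x y => ?_⟩
      have hx := hc x x.2
      have hy := hc y y.2
      have hxy : x = y := Subtype.ext (hx.trans hy.symm)
      subst hxy
      exact iff_of_false ((K.ind _).irrefl x) ((K'.ind _).irrefl x)
    intro i
    have hi : i = 0 ∨ i = 1 ∨ i = 2 := by omega
    rcases hi with rfl | rfl | rfl
    · exact hsub _ _ _ a p0
    · exact hsub _ _ _ b p1
    · have e : {y | p y = 2} = {w | G.To a w} := Set.ext fun w => ⟨p2 w, pL w⟩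
      rw [e]
      have := hfin.to_subtype
      have e' : H.ind {w | G.To a w} = G.ind {w | G.To a w} := by
        have : (H.ind {w | G.To a w}).Arc = (G.ind {w | G.To a w}).Arc := by
          funext x y
          change G.Arc _ _ = G.Arc _ _
          rw [hsL x x.2, hsL y y.2]
        simpa [ind] using this
      rw [e']
      exact h.isChainD_ind'.iso h.isChainD_ind

end Poles

namespace Poles

variable {G G' : Dgraph V} {a b : V}

theorem iso_of_card_le [Finite V] (h : Poles G G' a b) (hV : Nat.card V ≤ 5) : Iso G' G := by
  have hcases : ∀ w, w = a ∨ w = b ∨ G.To a w ∨ G.To b w := fun w =>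
    or_iff_not_imp_left.2 fun h1 => or_iff_not_imp_left.2 fun h2 => h.to_or h1 h2
  have nab := h.n
  obtain ⟨f, -, hf, hA, -, -⟩ := h.rules.exists_map (X := Set.univ) Set.finite_univ
    (by rwa [Set.ncard_univ]) ⟨a, trivial⟩
    (by
      rintro q -
      rcases hcases q with rfl | rfl | hq | hq
      · exact ⟨b, trivial, nab.1.symm, fun h1 => nab.2 (Or.inr h1)⟩
      · exact ⟨a, trivial, nab.1, fun h1 => nab.2 (Or.inl h1)⟩
      · exact ⟨b, trivial, (h.ne_of_to hq).symm, (h.to_right hq).asymm⟩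
      · exact ⟨a, trivial, (h.symm.ne_of_to hq).symm, (h.symm.to_right hq).asymm⟩)
    (by
      rintro q -
      rcases hcases q with rfl | rfl | hq | hq
      · exact ⟨b, trivial, nab.1.symm, fun h1 => nab.2 (Or.inl h1)⟩
      · exact ⟨a, trivial, nab.1, fun h1 => nab.2 (Or.inr h1)⟩
      · exact ⟨a, trivial, hq.ne, hq.asymm⟩
      · exact ⟨b, trivial, hq.ne, hq.asymm⟩)
  have hb : Function.Bijective f := Finite.injective_iff_bijective.1 (Set.injOn_univ.1 hf)
  exact Iso.symm ⟨Equiv.ofBijective f hb, fun x y => hA x trivial y trivial⟩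

theorem cross_neutral (h : Poles G G' a b) {x y z w : V} (hx : G.To a x) (hy : G.To a y)
    (hxy : G.To x y) (hz : G.To b z) (hw : G.To b w) (hzw : G.To z w) :
    G.Neutral z x ∧ G.Neutral w y ∧ Rev G G' z y ∧ Rev G G' w x := by
  rcases h.dir_or_neutral hy hz with d2 | d2
  · rcases h.dir_or_neutral hx hw with d3 | d3
    · rcases h.dir_or_neutral hx hz with d1 | d1
      · exact absurd (h.five hx hy hz hxy d1 d2).2
          (h.symm.five hz hw hx hzw d1.symm d3.symm).2.asymm
      · rcases h.dir_or_neutral hy hw with d4 | d4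
        · exact absurd (h.five hx hy hw hxy d3 d4).1
            (h.symm.five hz hw hy hzw d2.symm d4.symm).1.asymm
        · exact ⟨d1, d4, h.rev_of_dir hy hz d2, h.rev_of_dir hx hw d3⟩
    · rcases h.dir_or_neutral hx hz with d1 | d1
      · have r1 := (h.rev_of_dir hx hz d1).symm
        exact absurd (h.five hx hy hz hxy d1 d2).2
          ((h.symm.rev_of_neutral hz hw hzw.ne r1 d3.symm).2.2 hzw).asymm
      · exact (h.symm.claw hz hw hx hzw.ne d1.symm d3.symm).elim
  · rcases h.dir_or_neutral hy hw with d4 | d4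
    · have r4 := h.rev_of_dir hy hw d4
      have t4 : ¬ G.To y w := fun t =>
        hzw.asymm ((h.symm.rev_of_neutral hw hz hzw.ne.symm r4.symm d2.symm).2.1 t)
      rcases h.dir_or_neutral hx hw with d3 | d3
      · exact absurd (h.five hx hy hw hxy d3 d4).1 t4
      · have r5 := (h.rev_of_neutral hy hx hxy.ne.symm r4 d3).1
        exact absurd ((h.rules.rrn r5 r4.symm d3.symm).1 hxy) t4
    · exact (h.symm.claw hz hw hy hzw.ne d2.symm d4.symm).elim

theorem iso_of_four (h : Poles G G' a b) {x y z w : V} (hx : G.To a x) (hy : G.To a y)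
    (hxy : G.To x y) (hz : G.To b z) (hw : G.To b w) (hzw : G.To z w)
    (hV : ∀ v, v = a ∨ v = b ∨ v = x ∨ v = y ∨ v = z ∨ v = w) : Iso G' G := by
  classical
  obtain ⟨nzx, nwy, rzy, rwx⟩ := h.cross_neutral hx hy hxy hz hw hzw
  obtain ⟨ryx, e1⟩ := h.rev_of_neutral hy hx hxy.ne.symm rzy nzx
  obtain ⟨rwz, e2⟩ := h.symm.rev_of_neutral hw hz hzw.ne.symm rwx.symm nzx.symm
  have tyz : G.To y z := rzy.to_or.resolve_left fun t => hxy.asymm (e1.1 t)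
  have twx : G.To w x := rwx.to_or.resolve_right fun t => hzw.asymm (e2.1 t)
  have hxb := h.to_right hx
  have hyb := h.to_right hy
  have hza := h.symm.to_right hz
  have hwa := h.symm.to_right hw
  have gxa := (h.rev_left hx).symm.to_of_to hx
  have gya := (h.rev_left hy).symm.to_of_to hy
  have gbx := (h.rev_right hx).to_of_to hxb
  have gby := (h.rev_right hy).to_of_to hyb
  have gzb := (h.symm.rev_left hz).symm.to_of_to hz
  have gwb := (h.symm.rev_left hw).symm.to_of_to hw
  have gaz := (h.symm.rev_right hz).to_of_to hza
  have gaw := (h.symm.rev_right hw).to_of_to hwa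
  have gyx := ryx.symm.to_of_to hxy
  have gwz := rwz.symm.to_of_to hzw
  have gzy := rzy.symm.to_of_to tyz
  have gxw := rwx.to_of_to twx
  have neu : ∀ {u v}, G.Neutral u v → (G'.Arc u v ↔ G.Arc u v) ∧ (G'.Arc v u ↔ G.Arc u v) := by
    intro u v hn
    rcases h.rules.pair hn.1 with h1 | h1 | h1
    · exact absurd hn h1.not_neutral
    · exact absurd hn h1.not_neutral
    · exact ⟨h1.2.1, h1.2.2.trans hn.arc_comm.symm⟩
  have arc : G.Arc z x ↔ G.Arc w y := by
    let X : Set V := {x, z, y, w, a}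
    have hX : X.Finite := Set.toFinite _
    have h5 : X.ncard ≤ 5 :=
      (Set.ncard_insert_le _ _).trans (Nat.succ_le_succ
        ((Set.ncard_insert_le _ _).trans (Nat.succ_le_succ
          ((Set.ncard_insert_le _ _).trans (by rw [Set.ncard_pair hwa.ne])))))
    have mx : x ∈ X := by simp [X]
    have my : y ∈ X := by simp [X]
    have mz : z ∈ X := by simp [X]
    have mw : w ∈ X := by simp [X]
    have ma : a ∈ X := by simp [X]
    obtain ⟨f, fX, fi, fA, fT, fN⟩ := h.rules.exists_map hX h5 ⟨x, mx⟩
      (by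
        rintro q (rfl | rfl | rfl | rfl | rfl)
        · exact ⟨z, mz, nzx.1, fun t => nzx.2 (Or.inl t)⟩
        · exact ⟨x, mx, nzx.1.symm, fun t => nzx.2 (Or.inr t)⟩
        · exact ⟨w, mw, nwy.1, fun t => nwy.2 (Or.inl t)⟩
        · exact ⟨y, my, nwy.1.symm, fun t => nwy.2 (Or.inr t)⟩
        · exact ⟨x, mx, hx.ne.symm, hx.asymm⟩)
      (by
        rintro q (rfl | rfl | rfl | rfl | rfl)
        · exact ⟨z, mz, nzx.1, fun t => nzx.2 (Or.inr t)⟩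
        · exact ⟨x, mx, nzx.1.symm, fun t => nzx.2 (Or.inl t)⟩
        · exact ⟨w, mw, nwy.1, fun t => nwy.2 (Or.inr t)⟩
        · exact ⟨y, my, nwy.1.symm, fun t => nwy.2 (Or.inl t)⟩
        · exact ⟨z, mz, hza.ne, hza.asymm⟩)
    have fs := surjOn_of_injOn hX fX fi
    have ha : ∀ v ∈ X, ¬ G.Neutral a v := by
      rintro v (rfl | rfl | rfl | rfl | rfl) hn
      · exact hn.2 (Or.inl hx)
      · exact hn.2 (Or.inr hza)
      · exact hn.2 (Or.inl hy)
      · exact hn.2 (Or.inr hwa)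
      · exact hn.1 rfl
    have ha' : ∀ v ∈ X, ¬ G.Neutral (f a) v := by
      intro v hv hn
      obtain ⟨c, hc, rfl⟩ := fs v hv
      exact ha c hc ((fN a ma c hc).2 hn)
    have fa : f a = a := by
      rcases fX a ma with e | e | e | e | e
      · exact absurd (e ▸ nzx.symm) (ha' z mz)
      · exact absurd (e ▸ nzx) (ha' x mx)
      · exact absurd (e ▸ nwy.symm) (ha' w mw)
      · exact absurd (e ▸ nwy) (ha' y my)
      · exact e
    have plus : ∀ v ∈ X, G.To a v → f v = z ∨ f v = w := by
      intro v hv hav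
      have := (fT a ma v hv).1 hav
      rw [fa] at this
      rcases fX v hv with e | e | e | e | e <;> rw [e] at this
      · exact absurd this gxa.asymm
      · exact Or.inl e
      · exact absurd this gya.asymm
      · exact Or.inr e
      · exact absurd rfl this.ne
    have minus : ∀ v ∈ X, G.To v a → f v = x ∨ f v = y := by
      intro v hv hav
      have := (fT v hv a ma).1 hav
      rw [fa] at this
      rcases fX v hv with e | e | e | e | e <;> rw [e] at this
      · exact Or.inl e
      · exact absurd this gaz.asymm
      · exact Or.inr e
      · exact absurd this gaw.asymm
      · exact absurd rfl this.ne
    have fxy := (fT x mx y my).1 hxy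
    have fx : f x = w := by
      rcases plus x mx hx with e | e
      · rcases plus y my hy with e' | e'
        · rw [e, e'] at fxy
          exact absurd rfl fxy.ne
        · rw [e, e'] at fxy
          exact absurd fxy gwz.asymm
      · exact e
    have fz : f z = y := by
      rcases minus z mz hza with e | e
      · have := (fN z mz x mx).1 nzx
        rw [fx, e] at this
        exact absurd this rwx.symm.not_neutral
      · exact e
    have := fA z mz x mx
    rw [fx, fz] at this
    exact this.trans (neu nwy).2
  obtain ⟨nab, nba⟩ := neu h.n
  obtain ⟨nzx1, nzx2⟩ := neu nzx
  obtain ⟨nwy1, nwy2⟩ := neu nwy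
  let g : V → V := fun v => if v = a then b else if v = b then a else if v = x then y else
    if v = y then x else if v = z then w else z
  have ga : g a = b := by simp [g]
  have gb : g b = a := by simp [g, h.n.1.symm]
  have gx : g x = y := by simp [g, hx.ne.symm, hxb.ne]
  have gy : g y = x := by simp [g, hy.ne.symm, hyb.ne, hxy.ne.symm]
  have gz : g z = w := by simp [g, hza.ne, hz.ne.symm, nzx.1, tyz.ne.symm]
  have gw : g w = z := by simp [g, hwa.ne, hw.ne.symm, twx.ne, nwy.1, hzw.ne.symm]
  have hg : Function.Involutive g := by
    intro v
    rcases hV v with rfl | rfl | rfl | rfl | rfl | rfl <;> simp only [ga, gb, gx, gy, gz, gw]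
  refine ⟨hg.toPerm, fun u v => ?_⟩
  change G'.Arc u v ↔ G.Arc (g u) (g v)
  have c1 := h.n.arc_comm
  have c2 := nzx.arc_comm.symm
  have c3 := nwy.arc_comm.symm
  unfold To at *
  rcases hV u with hu | hu | hu | hu | hu | hu <;> rcases hV v with hv | hv | hv | hv | hv | hv <;>
    rw [hu, hv] <;> simp only [ga, gb, gx, gy, gz, gw]
  all_goals simp [hxy, hzw, hx, hy, hz, hw, tyz, twx, hxb, hyb, hza, hwa, gxa, gya, gbx, gby, gzb,
    gwb, gaz, gaw, gyx, gwz, gzy, gxw, nab, nba, nzx1, nzx2, nwy1, nwy2, c1, c2, c3, arc,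
    G.irrefl, G'.irrefl]

theorem isInterval (h : Poles G G' a b) (hL : ∀ w, w ≠ a → w ≠ b → G.To a w) :
    G.IsInterval {w | G.To a w} := by
  intro x hx
  by_cases hxa : x = a
  · subst hxa
    exact Or.inl fun y hy => hy
  by_cases hxb : x = b
  · subst hxb
    exact Or.inr (Or.inl fun y hy => h.to_right hy)
  exact absurd (hL x hxa hxb) hx

theorem iso_of_forall_or (h : Poles G G' a b)
    (hfin : ∀ Q : Set V, G.IsInterval Q → (G.ind Q).IsChainD → Q.Finite)
    (hL : ∀ w, ¬ G.To b w) : Iso G' G := by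
  have hL' : ∀ w, w ≠ a → w ≠ b → G.To a w := fun w h1 h2 => (h.to_or h1 h2).resolve_right (hL w)
  exact h.iso_of_forall hL' (hfin _ (h.isInterval hL') h.isChainD_ind)

theorem iso_of_unique (h : Poles G G' a b) {x z : V} (hx : G.To a x) (hz : G.To b z)
    (hu : ∀ v, G.To a v → v = x) : Iso G' G := by
  classical
  have key : ∃ w, ∀ v, G.To b v → v = z ∨ v = w := by
    by_cases hw : ∃ w, G.To b w ∧ w ≠ z
    · obtain ⟨w, hw, hwz⟩ := hw
      refine ⟨w, fun v hv => ?_⟩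
      by_contra hc
      push Not at hc
      exact h.symm.not_three hz hw hv hx hwz.symm hc.2.symm hc.1.symm
    · push Not at hw
      exact ⟨z, fun v hv => Or.inl (hw v hv)⟩
  obtain ⟨w, hw⟩ := key
  have hV : ∀ v, v ∈ ({a, b, x, z, w} : Finset V) := by
    intro v
    by_cases h1 : v = a
    · simp [h1]
    by_cases h2 : v = b
    · simp [h2]
    rcases h.to_or h1 h2 with h3 | h3
    · simp [hu v h3]
    · rcases hw v h3 with rfl | rfl <;> simp
  have : Finite V := Set.finite_univ_iff.1
    ((Finset.finite_toSet {a, b, x, z, w}).subset fun v _ => hV v)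
  refine h.iso_of_card_le ?_
  rw [← Set.ncard_univ]
  refine (Set.ncard_le_ncard (t := (({a, b, x, z, w} : Finset V) : Set V)) fun v _ => hV v).trans ?_
  rw [Set.ncard_coe_finset]
  exact Finset.card_le_five

theorem iso (h : Poles G G' a b)
    (hfin : ∀ Q : Set V, G.IsInterval Q → (G.ind Q).IsChainD → Q.Finite) : Iso G' G := by
  by_cases hP : ∃ x, G.To a x
  · by_cases hM : ∃ z, G.To b z
    · obtain ⟨x, hx⟩ := hP
      obtain ⟨z, hz⟩ := hM
      by_cases hP2 : ∃ y, G.To a y ∧ y ≠ x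
      · by_cases hM2 : ∃ w, G.To b w ∧ w ≠ z
        · obtain ⟨y, hy, hyx⟩ := hP2
          obtain ⟨w, hw, hwz⟩ := hM2
          have hV : ∀ v, v = a ∨ v = b ∨ v = x ∨ v = y ∨ v = z ∨ v = w := by
            intro v
            by_contra hc
            push Not at hc
            obtain ⟨h1, h2, h3, h4, h5, h6⟩ := hc
            rcases h.to_or h1 h2 with h7 | h7
            · exact h.not_three hx hy h7 hz hyx.symm h4.symm h3.symm
            · exact h.symm.not_three hz hw h7 hx hwz.symm h6.symm h5.symm
          rcases h.dir hx hy hyx.symm with d1 | d1 <;>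
            rcases h.symm.dir hz hw hwz.symm with d2 | d2
          · exact h.iso_of_four hx hy d1 hz hw d2 hV
          · exact h.iso_of_four hx hy d1 hw hz d2 (fun v => by have := hV v; clear * - this; tauto)
          · exact h.iso_of_four hy hx d1 hz hw d2 (fun v => by have := hV v; clear * - this; tauto)
          · exact h.iso_of_four hy hx d1 hw hz d2 (fun v => by have := hV v; clear * - this; tauto)
        · push Not at hM2
          exact h.symm.iso_of_unique hz hx hM2
      · push Not at hP2
        exact h.iso_of_unique hx hz hP2
    · push Not at hM
      exact h.iso_of_forall_or hfin hM
  · push Not at hP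
    exact h.symm.iso_of_forall_or hfin hP

end Poles

/-- Two digraphs subject to `Rules` are isomorphic, apart from two exceptions. -/
theorem Rules.iso {G G' : Dgraph V} (h : Rules G G')
    (hfin : ∀ Q : Set V, G.IsInterval Q → (G.ind Q).IsChainD → Q.Finite)
    (hno : ¬ (G.OneEndInfiniteConsecutivity ∨ (G.DiamondFreeTournament ∧ ¬ G.SelfDual))) :
    Iso G' G := by
  by_cases ht : G.IsTournament
  · exact h.iso_of_tournament ht hfin fun hd => by_contra fun hs => hno (Or.inr ⟨hd, hs⟩)
  · unfold IsTournament at ht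
    push Not at ht
    obtain ⟨a, b, hab⟩ := ht
    obtain ⟨y, x, z, e⟩ := h.exists_wedge hab
    by_cases hp : ∀ a b c d, ¬ PathFour G G' a b c d
    · exact Poles.iso ⟨h, e.n, fun w hy hz => h.rev_of_not_pathFour hp e hy hz⟩ hfin
    · push Not at hp
      obtain ⟨_, _, _, _, e⟩ := hp
      exact PathFour.iso h e fun ho => hno (Or.inl ho)

theorem IsInterval.dual {G : Dgraph V} {I : Set V} (h : G.IsInterval I) : G.dual.IsInterval I := by
  intro x hx
  rcases h x hx with h1 | h1 | h1 | h1
  · exact Or.inr (Or.inl h1)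
  · exact Or.inl h1
  · exact Or.inr (Or.inr (Or.inl fun y hy => (h1 y hy).symm))
  · exact Or.inr (Or.inr (Or.inr fun y hy => (h1 y hy).symm))

theorem LeHemi.arc_iff_of_not_rev {G G' : Dgraph V} (h : LeHemi 6 G G') {x y : V} (hxy : x ≠ y)
    (hr : ¬ Rev G G' x y) : (G'.Arc x y ↔ G.Arc x y) ∧ (G'.Arc y x ↔ G.Arc y x) := by
  have := h.pair hxy
  unfold Rev To at hr
  clear * - this hr
  tauto

theorem LeHemi.diffStep_iff {G G' : Dgraph V} (h : LeHemi 6 G G') {x y : V} :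
    DiffStep G G' x y ↔ Rev G G' x y := by
  by_cases hxy : x = y
  · subst hxy
    have h1 := G.irrefl x
    have h2 := G'.irrefl x
    unfold DiffStep Rev To
    clear * - h1 h2
    tauto
  · have := h.pair hxy
    unfold DiffStep Rev To
    clear * - this
    tauto

section Class

variable {G G' : Dgraph V} {S : Set V}

theorem rev_induction (conn : ∀ x y, Relation.ReflTransGen (Rev (G.ind S) (G'.ind S)) x y)
    {P : V → Prop} {x y : V} (hx : x ∈ S) (hy : y ∈ S) (h0 : P x)
    (hP : ∀ a ∈ S, ∀ b ∈ S, Rev G G' a b → P a → P b) : P y := by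
  have key : ∀ t : S, Relation.ReflTransGen (Rev (G.ind S) (G'.ind S)) ⟨x, hx⟩ t → P t.1 := by
    intro t ht
    induction ht with
    | refl => exact h0
    | tail _ h1 ih => exact hP _ (Subtype.property _) _ (Subtype.property _) h1 ih
  exact key ⟨y, hy⟩ (conn _ _)

theorem LeHemi.to_uniform (h : LeHemi 6 G G')
    (conn : ∀ x y, Relation.ReflTransGen (Rev (G.ind S) (G'.ind S)) x y)
    (hS : ∀ x ∈ S, ∀ z ∉ S, ¬ Rev G G' x z) {z x y : V} (hz : z ∉ S) (hx : x ∈ S) (hy : y ∈ S) :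
    (G.To z x → G.To z y) ∧ (G.To x z → G.To y z) := by
  have aux : ∀ a ∈ S, ∀ b ∈ S, Rev G G' a b → (G.To z a ↔ G.To z b) ∧ (G.To a z ↔ G.To b z) :=
    fun a ha b hb hr => h.rev_uniform hr (hS a ha z hz) (hS b hb z hz)
      (fun e => hz (e ▸ ha)) (fun e => hz (e ▸ hb))
  exact ⟨fun h0 => rev_induction (P := fun t => G.To z t) conn hx hy h0
      fun a ha b hb hr => (aux a ha b hb hr).1.1,
    fun h0 => rev_induction (P := fun t => G.To t z) conn hx hy h0
      fun a ha b hb hr => (aux a ha b hb hr).2.1⟩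

theorem LeHemi.isInterval_of_dominated (h : LeHemi 6 G G')
    (conn : ∀ x y, Relation.ReflTransGen (Rev (G.ind S) (G'.ind S)) x y)
    (hS : ∀ x ∈ S, ∀ z ∉ S, ¬ Rev G G' x z) {p : V} (hp : ∀ x ∈ S, G.To p x)
    (hp' : ∀ x ∈ S, G'.To p x) : G.IsInterval S := by
  intro z hz
  rcases S.eq_empty_or_nonempty with rfl | ⟨c, hc⟩
  · exact Or.inl (by simp)
  by_cases h1 : G.To z c
  · exact Or.inl fun y hy => (h.to_uniform conn hS hz hc hy).1 h1
  by_cases h2 : G.To c z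
  · exact Or.inr (Or.inl fun y hy => (h.to_uniform conn hS hz hc hy).2 h2)
  have hn : ∀ y ∈ S, G.Neutral z y := by
    refine fun y hy => ⟨fun e => hz (e ▸ hy), ?_⟩
    rintro (h3 | h3)
    · exact h1 ((h.to_uniform conn hS hz hy hc).1 h3)
    · exact h2 ((h.to_uniform conn hS hz hy hc).2 h3)
  have hpz : p ≠ z := by
    rintro rfl
    exact h1 (hp c hc)
  have ha : ∀ y ∈ S, (G.Arc z y ↔ G.Arc z c) := fun y hy =>
    rev_induction (P := fun t => (G.Arc z t ↔ G.Arc z c)) conn hc hy Iff.rfl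
      fun a ha b hb hr ih => (h.rev_neutral_neutral hpz (hp a ha) (hp b hb) (hp' a ha) (hp' b hb) hr
        (hn a ha) (hn b hb)).symm.trans ih
  by_cases h3 : G.Arc z c
  · exact Or.inr (Or.inr (Or.inl fun y hy =>
      ⟨(ha y hy).2 h3, (hn y hy).arc_comm.1 ((ha y hy).2 h3)⟩))
  · exact Or.inr (Or.inr (Or.inr fun y hy =>
      ⟨fun h4 => h3 ((ha y hy).1 h4), fun h4 => h3 ((ha y hy).1 ((hn y hy).arc_comm.2 h4))⟩))

theorem LeHemi.kept_of_not_rev (h : LeHemi 6 G G') {x y : V} (hr : ¬ Rev G G' x y)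
    (hxy : G.To x y) : G'.To x y := by
  have := h.arc_iff_of_not_rev hxy.ne hr
  exact ⟨this.1.2 hxy.1, fun h1 => hxy.2 (this.2.1 h1)⟩

theorem LeHemi.isInterval_and_rules (h : LeHemi 6 G G')
    (conn : ∀ x y, Relation.ReflTransGen (Rev (G.ind S) (G'.ind S)) x y)
    (hS : ∀ x ∈ S, ∀ z ∉ S, ¬ Rev G G' x z) {p c : V} (hc : c ∈ S) (hpS : p ∉ S)
    (hd : G.Dir p c) : G.IsInterval S ∧ Rules (G.ind S) (G'.ind S) := by
  rcases hd with hd | hd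
  · have hp : ∀ x ∈ S, G.To p x := fun x hx => (h.to_uniform conn hS hpS hc hx).1 hd
    have hp' : ∀ x ∈ S, G'.To p x := fun x hx =>
      h.kept_of_not_rev (fun hr => hS x hx p hpS hr.symm) (hp x hx)
    exact ⟨h.isInterval_of_dominated conn hS hp hp', h.rules_of_dominated hp hp' conn⟩
  · have hp : ∀ x ∈ S, G.To x p := fun x hx => (h.to_uniform conn hS hpS hc hx).2 hd
    have hp' : ∀ x ∈ S, G'.To x p := fun x hx => h.kept_of_not_rev (hS x hx p hpS) (hp x hx)
    have conn' : ∀ x y, Relation.ReflTransGen (Rev (G.dual.ind S) (G'.dual.ind S)) x y :=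
      fun x y => Relation.ReflTransGen.mono (fun _ _ hr => Rev.symm hr) x y (conn x y)
    have hS' : ∀ x ∈ S, ∀ z ∉ S, ¬ Rev G.dual G'.dual x z := fun x hx z hz hr =>
      hS x hx z hz (Rev.symm hr)
    exact ⟨(h.dual.isInterval_of_dominated conn' hS' hp hp').dual,
      (h.dual.rules_of_dominated hp hp' conn').dual⟩

theorem LeHemi.isInterval_right (h : LeHemi 6 G G') (hS : ∀ x ∈ S, ∀ z ∉ S, ¬ Rev G G' x z)
    (hI : G.IsInterval S) : G'.IsInterval S := by
  intro z hz
  have key : ∀ y ∈ S, (G'.Arc y z ↔ G.Arc y z) ∧ (G'.Arc z y ↔ G.Arc z y) := fun y hy =>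
    h.arc_iff_of_not_rev (fun e => hz (e ▸ hy)) (hS y hy z hz)
  refine (hI z hz).imp ?_ (Or.imp ?_ (Or.imp ?_ ?_)) <;> intro h1 y hy <;>
    rw [(key y hy).1, (key y hy).2] <;> exact h1 y hy

end Class

theorem Iso.ind_ind (G : Dgraph V) (S : Set V) (Q : Set S) :
    Iso ((G.ind S).ind Q) (G.ind (Subtype.val '' Q)) :=
  ⟨Equiv.Set.image _ Q Subtype.val_injective, fun _ _ => Iff.rfl⟩

theorem IsInterval.image {G : Dgraph V} {S : Set V} (hS : G.IsInterval S) {Q : Set S}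
    (hQ : (G.ind S).IsInterval Q) : G.IsInterval (Subtype.val '' Q) := by
  intro x hx
  have aux : ∀ {P : V → Prop}, (∀ y ∈ Q, P y.1) → ∀ y ∈ Subtype.val '' Q, P y := by
    rintro P h _ ⟨y, hy, rfl⟩
    exact h y hy
  by_cases hxS : x ∈ S
  · have hxQ : (⟨x, hxS⟩ : S) ∉ Q := fun h => hx ⟨_, h, rfl⟩
    exact (hQ _ hxQ).imp aux (Or.imp aux (Or.imp aux aux))
  · have aux' : ∀ {P : V → Prop}, (∀ y ∈ S, P y) → ∀ y ∈ Subtype.val '' Q, P y := fun h =>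
      aux fun y _ => h y y.2
    exact (hS x hxS).imp aux' (Or.imp aux' (Or.imp aux' aux'))

theorem IsInterval.preimage {G : Dgraph V} {I : Set V} (hI : G.IsInterval I) (S : Set V)
    {Q : Set S} (hQ : Subtype.val '' Q = I) : (G.ind S).IsInterval Q := by
  subst hQ
  intro x hx
  have := hI x.1 (by rintro ⟨y, hy, e⟩; exact hx (Subtype.ext e ▸ hy))
  refine this.imp ?_ (Or.imp ?_ (Or.imp ?_ ?_)) <;> exact fun h y hy => h y.1 ⟨y, hy, rfl⟩

theorem IsTournament.of_iso {G : Dgraph V} {H : Dgraph W} (e : Iso G H) (h : G.IsTournament) :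
    H.IsTournament := by
  obtain ⟨f, hf⟩ := e.symm
  intro x y hxy
  have := h (f x) (f y) (f.injective.ne hxy)
  unfold Dir at *
  rwa [hf, hf]

theorem IsChainD.of_iso {G : Dgraph V} {H : Dgraph W} (e : Iso G H) (h : G.IsChainD) :
    H.IsChainD := by
  refine ⟨h.1.of_iso e, ?_⟩
  obtain ⟨f, hf⟩ := e.symm
  intro x y z
  rw [hf, hf, hf]
  exact h.2 _ _ _

theorem SelfDual.of_iso {G : Dgraph V} {H : Dgraph W} (e : Iso G H) (h : G.SelfDual) :
    H.SelfDual :=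
  e.symm.trans (Iso.trans h e.dual)

theorem OneEndInfiniteConsecutivity.of_iso {G : Dgraph V} {H : Dgraph W} (e : Iso G H)
    (h : G.OneEndInfiniteConsecutivity) : H.OneEndInfiniteConsecutivity := by
  obtain ⟨full, h1⟩ := h
  exact ⟨full, h1.imp e.symm.trans e.symm.trans⟩

theorem IsDiamond.of_iso {G : Dgraph V} {H : Dgraph W} (e : Iso G H) (h : G.IsDiamond) :
    H.IsDiamond :=
  h.imp e.symm.trans e.dual.symm.trans

theorem DiamondFreeTournament.of_iso {G : Dgraph V} {H : Dgraph W} (e : Iso G H)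
    (h : G.DiamondFreeTournament) : H.DiamondFreeTournament := by
  refine ⟨h.1.of_iso e, fun X hX => ?_⟩
  obtain ⟨f, hf⟩ := e
  have e' : Iso (G.ind (f ⁻¹' X)) (H.ind X) :=
    ⟨f.subtypeEquiv fun _ => Iff.rfl, fun x y => hf x.1 y.1⟩
  exact h.2 (f ⁻¹' X) (hX.of_iso e'.symm)

theorem IsInterval.arc_iff {G : Dgraph V} {I : Set V} (h : G.IsInterval I) {x y z : V} (hz : z ∉ I)
    (hx : x ∈ I) (hy : y ∈ I) : (G.Arc x z ↔ G.Arc y z) ∧ (G.Arc z x ↔ G.Arc z y) := by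
  rcases h z hz with h1 | h1 | h1 | h1 <;>
    · have h2 := h1 x hx
      have h3 := h1 y hy
      clear * - h2 h3
      tauto

theorem diffRel_iff {G G' : Dgraph V} {x y : V} :
    DiffRel G G' x y ↔ Relation.ReflTransGen (DiffStep G G') x y := by
  rw [Relation.reflTransGen_iff_eq_or_transGen, eq_comm]
  rfl

theorem reflTransGen_symm {r : V → V → Prop} (hr : ∀ x y, r x y → r y x) {x y : V}
    (h : Relation.ReflTransGen r x y) : Relation.ReflTransGen r y x := by
  induction h with
  | refl => exact .refl
  | tail _ h1 ih => exact .head (hr _ _ h1) ih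

theorem ACRel.symm {G : Dgraph V} {x y : V} (h : G.ACRel x y) : G.ACRel y x :=
  reflTransGen_symm (fun _ _ h1 => Or.symm h1) h

section DifferenceClass

variable {G G' : Dgraph V} {D : Set V} {C : Set D}

theorem LeHemi.diffRel_symm (h : LeHemi 6 G G') {x y : D}
    (hxy : DiffRel (G.ind D) (G'.ind D) x y) : DiffRel (G.ind D) (G'.ind D) y x := by
  rw [diffRel_iff] at hxy ⊢
  refine reflTransGen_symm (fun a b h1 => ?_) hxy
  exact (h.diffStep_iff (x := b.1) (y := a.1)).2 (Rev.symm (h.diffStep_iff.1 h1))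

theorem LeHemi.diffClass_conn (h : LeHemi 6 G G') (hC : DiffClass (G.ind D) (G'.ind D) C)
    (x y : (Subtype.val '' C : Set V)) : Relation.ReflTransGen
      (Rev (G.ind (Subtype.val '' C)) (G'.ind (Subtype.val '' C))) x y := by
  obtain ⟨c, hc⟩ := hC
  have hm : ∀ y : D, y ∈ C ↔ Relation.ReflTransGen (DiffStep (G.ind D) (G'.ind D)) c y := by
    intro y
    rw [← diffRel_iff, hc]
    rfl
  have hcC : c.1 ∈ (Subtype.val '' C : Set V) := ⟨c, (hm c).2 .refl, rfl⟩
  have key : ∀ y : D, Relation.ReflTransGen (DiffStep (G.ind D) (G'.ind D)) c y →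
      ∀ hy : y.1 ∈ (Subtype.val '' C : Set V), Relation.ReflTransGen
        (Rev (G.ind (Subtype.val '' C)) (G'.ind (Subtype.val '' C))) ⟨c.1, hcC⟩ ⟨y.1, hy⟩ := by
    intro y hcy
    induction hcy with
    | refl => exact fun _ => .refl
    | tail h1 h2 ih =>
      exact fun hy => (ih ⟨_, (hm _).2 h1, rfl⟩).tail (h.diffStep_iff.1 h2)
  have key' : ∀ y : (Subtype.val '' C : Set V), Relation.ReflTransGen
      (Rev (G.ind (Subtype.val '' C)) (G'.ind (Subtype.val '' C))) ⟨c.1, hcC⟩ y := by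
    rintro ⟨_, y, hy, rfl⟩
    exact key y ((hm y).1 hy) _
  exact (reflTransGen_symm (fun _ _ h1 => Rev.symm h1) (key' x)).trans (key' y)

theorem LeHemi.diffClass_not_rev (h : LeHemi 6 G G') (hD : G.IsACComponent D)
    (hC : DiffClass (G.ind D) (G'.ind D) C) :
    ∀ x ∈ (Subtype.val '' C : Set V), ∀ z ∉ (Subtype.val '' C : Set V), ¬ Rev G G' x z := by
  obtain ⟨d, rfl⟩ := hD
  obtain ⟨c, rfl⟩ := hC
  rintro _ ⟨x, hx, rfl⟩ z hz hr
  have hzD : G.ACRel d z := Relation.ReflTransGen.tail x.2 hr.dir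
  refine hz ⟨⟨z, hzD⟩, ?_, rfl⟩
  exact diffRel_iff.2 ((diffRel_iff.1 hx).tail (h.diffStep_iff.2 hr))

theorem exists_dir_of_ne (hD : G.IsACComponent D) (hC : C.Nonempty)
    (hne : Subtype.val '' C ≠ D) : ∃ c ∈ (Subtype.val '' C : Set V),
      ∃ p ∉ (Subtype.val '' C : Set V), G.Dir p c := by
  by_contra hno
  push Not at hno
  obtain ⟨d, rfl⟩ := hD
  obtain ⟨c, hc⟩ := hC
  refine hne (Set.Subset.antisymm (Subtype.coe_image_subset _ _) fun y hy => ?_)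
  have hcy : G.ACRel c.1 y := Relation.ReflTransGen.trans (ACRel.symm c.2) hy
  induction hcy with
  | refl => exact ⟨c, hc, rfl⟩
  | tail h1 h2 ih =>
    by_contra hn
    exact hno _ (ih (Relation.ReflTransGen.trans c.2 h1)) _ hn (Or.symm h2)

theorem LeHemi.diffClass (h : LeHemi 6 G G') (hD : G.IsACComponent D)
    (hC : DiffClass (G.ind D) (G'.ind D) C) (hne : Subtype.val '' C ≠ D) :
    G.IsInterval (Subtype.val '' C) ∧ G'.IsInterval (Subtype.val '' C) ∧
      Rules (G.ind (Subtype.val '' C)) (G'.ind (Subtype.val '' C)) := by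
  have hC' : C.Nonempty := by
    obtain ⟨x, rfl⟩ := hC
    exact ⟨x, Or.inl rfl⟩
  obtain ⟨c, hc, p, hp, hd⟩ := exists_dir_of_ne hD hC' hne
  have hr := h.diffClass_not_rev hD hC
  obtain ⟨hI, hR⟩ := h.isInterval_and_rules (h.diffClass_conn hC) hr hc hp hd
  exact ⟨hI, h.isInterval_right hr hI, hR⟩

theorem LeHemi.diffClass_iso (h : LeHemi 6 G G') (hcinf : ¬ G.CondCinf) (hD : G.IsACComponent D)
    (hC : DiffClass (G.ind D) (G'.ind D) C)
    (hno : ¬ ((G.ind (Subtype.val '' C)).OneEndInfiniteConsecutivity ∨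
      (DiamondFreeTournament (G.ind (Subtype.val '' C)) ∧
        ¬ SelfDual (G.ind (Subtype.val '' C)))))
    (hne : Subtype.val '' C ≠ D) :
    G.IsInterval (Subtype.val '' C) ∧ G'.IsInterval (Subtype.val '' C) ∧
      Iso (G'.ind (Subtype.val '' C)) (G.ind (Subtype.val '' C)) := by
  obtain ⟨hI, hI', hR⟩ := h.diffClass hD hC hne
  refine ⟨hI, hI', hR.iso (fun Q hQ hc => ?_) hno⟩
  by_contra hQf
  exact hcinf (Or.inl ⟨Subtype.val '' Q,
    (Set.infinite_image_iff Subtype.val_injective.injOn).2 hQf, hI.image hQ,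
    hc.of_iso (Iso.ind_ind _ _ _)⟩)

theorem LeHemi.diffClass_ne (h : LeHemi 6 G G')
    (h2 : AtLeastTwoDiffClasses (G.ind D) (G'.ind D)) (hC : DiffClass (G.ind D) (G'.ind D) C) :
    Subtype.val '' C ≠ D := by
  intro hCD
  obtain ⟨c, rfl⟩ := hC
  have hall : ∀ x, DiffRel (G.ind D) (G'.ind D) c x := by
    intro x
    obtain ⟨y, hy, e⟩ := hCD.ge x.2
    exact Subtype.ext e ▸ hy
  have key : ∀ K, DiffClass (G.ind D) (G'.ind D) K → K = Set.univ := by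
    rintro K ⟨k, rfl⟩
    refine Set.eq_univ_of_forall fun x => diffRel_iff.2 ?_
    exact (diffRel_iff.1 (h.diffRel_symm (hall k))).trans (diffRel_iff.1 (hall x))
  obtain ⟨C₁, C₂, h3, h4, h5⟩ := h2
  exact h5 ((key _ h3).trans (key _ h4).symm)

theorem LeHemi.iso_of_diffClass (h : LeHemi 6 G G') (hD : G.IsACComponent D)
    (hall : ∀ C : Set D, DiffClass (G.ind D) (G'.ind D) C →
      G.IsInterval (Subtype.val '' C) ∧
        Iso (G'.ind (Subtype.val '' C)) (G.ind (Subtype.val '' C))) :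
    Iso (G'.ind D) (G.ind D) := by
  let p : D → Set D := fun x => {y | DiffRel (G.ind D) (G'.ind D) x y}
  have pc : ∀ x, DiffClass (G.ind D) (G'.ind D) (p x) := fun x => ⟨x, rfl⟩
  have self : ∀ x, x ∈ p x := fun x => Or.inl rfl
  have peq : ∀ x y, p y = p x ↔ y ∈ p x := by
    refine fun x y => ⟨fun e => e ▸ self y, fun hxy => Set.ext fun z => ?_⟩
    have hxy' := diffRel_iff.1 hxy
    have hyx := diffRel_iff.1 (h.diffRel_symm hxy)
    exact ⟨fun hz => diffRel_iff.2 (hxy'.trans (diffRel_iff.1 hz)),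
      fun hz => diffRel_iff.2 (hyx.trans (diffRel_iff.1 hz))⟩
  have notMem : ∀ {x y : D}, p x ≠ p y → y.1 ∉ (Subtype.val '' p x : Set V) := by
    rintro x y hne ⟨t, ht, e⟩
    exact hne ((peq x y).2 (Subtype.ext e ▸ ht)).symm
  have mem : ∀ {x x' : D}, p x' = p x → x'.1 ∈ (Subtype.val '' p x : Set V) := fun {x x'} e =>
    ⟨x', (peq x x').1 e, rfl⟩
  refine Iso.glue p ?_ ?_
  · intro x y x' y' hne hx hy
    change G'.Arc x.1 y.1 ↔ G.Arc x'.1 y'.1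
    have hnr := h.diffClass_not_rev hD (pc x) x.1 (mem rfl) y.1 (notMem hne)
    have hxy : x.1 ≠ y.1 := fun e => hne (congrArg p (Subtype.ext e))
    refine (h.arc_iff_of_not_rev hxy hnr).1.trans ?_
    refine ((hall _ (pc x)).1.arc_iff (notMem hne) (mem rfl) (mem hx)).1.trans ?_
    have hne' : p y ≠ p x' := fun e => hne (hx.symm.trans e.symm)
    exact ((hall _ (pc y)).1.arc_iff (notMem hne') (mem rfl) (mem hy)).2
  · intro i
    by_cases hi : ∃ x, p x = i
    · obtain ⟨x, rfl⟩ := hi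
      have e : {y | p y = p x} = p x := Set.ext fun y => peq x y
      rw [e]
      exact (Iso.ind_ind _ _ _).trans ((hall _ (pc x)).2.trans (Iso.ind_ind _ _ _).symm)
    · push Not at hi
      exact ⟨Equiv.refl _, fun x => absurd x.2 (hi x)⟩

end DifferenceClass

end Dgraph

open Dgraph
/-- Lemma l3: behaviour of difference classes of G[D] and G'[D]. -/
theorem lemma_l3 {V : Type u} (G G' : Dgraph V)
    (hhemi : Dgraph.LeHemi 6 G G') (hcinf : ¬ G.CondCinf)
    (D : Set V) (hD : G.IsACComponent D)
    (I₀ : Set V) (hfin : I₀.Finite) (hcard : (I₀.ncard : ℕ∞) = G.Cdual)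
    (hnsd : ¬ Dgraph.SelfDual (G.ind I₀))
    (hiso : Dgraph.Iso (G'.ind I₀) (G.ind I₀)) :
    (∀ C : Set D, Dgraph.DiffClass (G.ind D) (G'.ind D) C →
       ¬ ((G.ind (Subtype.val '' C)).OneEndInfiniteConsecutivity ∨
          (Dgraph.DiamondFreeTournament (G.ind (Subtype.val '' C)) ∧
           ¬ Dgraph.SelfDual (G.ind (Subtype.val '' C)))) →
       Subtype.val '' C ≠ D →
       G.IsInterval (Subtype.val '' C) ∧ G'.IsInterval (Subtype.val '' C) ∧
         Dgraph.Iso (G'.ind (Subtype.val '' C)) (G.ind (Subtype.val '' C))) ∧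
    ((¬ ∃ J : Set D, (G.ind D).IsInterval J ∧
        (((G.ind D).ind J).OneEndInfiniteConsecutivity ∨
         (Dgraph.DiamondFreeTournament ((G.ind D).ind J) ∧
          ¬ Dgraph.SelfDual ((G.ind D).ind J)))) →
      Dgraph.AtLeastTwoDiffClasses (G.ind D) (G'.ind D) →
      (∀ C : Set D, Dgraph.DiffClass (G.ind D) (G'.ind D) C →
         G.IsInterval (Subtype.val '' C) ∧ G'.IsInterval (Subtype.val '' C) ∧
           Dgraph.Iso (G'.ind (Subtype.val '' C)) (G.ind (Subtype.val '' C))) ∧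
      Dgraph.Iso (G'.ind D) (G.ind D)) := by
  have part := fun C hC hno hne => hhemi.diffClass_iso (C := C) hcinf hD hC hno hne
  refine ⟨part, fun hJ h2 => ?_⟩
  have all : ∀ C : Set D, Dgraph.DiffClass (G.ind D) (G'.ind D) C →
      G.IsInterval (Subtype.val '' C) ∧ G'.IsInterval (Subtype.val '' C) ∧
        Dgraph.Iso (G'.ind (Subtype.val '' C)) (G.ind (Subtype.val '' C)) := by
    intro C hC
    have hne := hhemi.diffClass_ne h2 hC
    refine part C hC (fun hbad => hJ ⟨C, ?_, ?_⟩) hne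
    · exact (hhemi.diffClass hD hC hne).1.preimage D rfl
    · have e := (Dgraph.Iso.ind_ind G D C).symm
      exact hbad.imp (fun h => h.of_iso e)
        (fun h => ⟨h.1.of_iso e, fun hs => h.2 (hs.of_iso e.symm)⟩)
  exact ⟨all, hhemi.iso_of_diffClass hD fun C hC => ⟨(all C hC).1, (all C hC).2.2⟩⟩
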